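/- arXiv:1604.02539 — 12 statements merged into one kernel-verified Lean document; each statement's English description precedes it below -/
import Mathlib

section
/- Suppose μ is a non-atomic Borel probability measure on X and σ preserves the metric d, i.e., d(σ(x),σ(y)) = d(x,y) for all x,y ∈ X. Then for every ε > 0 there exists a Borel set A ⊆ X such that 0 < sup_{k∈ℤ} μ(σᵏ(A)) < ε. -/
open MeasureTheory

/-- On a compact metric space, balls of a small enough common radius have uniformly small measure
for a finite measure vanishing on singletons. -/
theorem exists_forall_measure_ball_lt_of_singleton_eq_zero
    {X : Type*} [MetricSpace X] [CompactSpace X] [MeasurableSpace X] [BorelSpace X]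
    (μ : Measure X) [IsFiniteMeasure μ] (hna : ∀ x : X, μ {x} = 0)
    {ε : ENNReal} (hε : 0 < ε) :
    ∃ r > 0, ∀ x : X, μ (Metric.ball x r) < ε := by
  have h : ∀ x : X, ∃ U : Set X, {x} ⊆ U ∧ IsOpen U ∧ μ U < ε := fun x ↦ by
    obtain ⟨U, hxU, hU, hμ⟩ := Set.exists_isOpen_lt_of_lt {x} ε (by rwa [hna x])
    exact ⟨U, hxU, hU, hμ⟩
  choose U hxU hU hμ using h
  obtain ⟨r, hr, hball⟩ := lebesgue_number_lemma_of_metric (isCompact_univ (X := X)) hU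
    (fun x _ ↦ Set.mem_iUnion.2 ⟨x, hxU x rfl⟩)
  refine ⟨r, hr, fun x ↦ ?_⟩
  obtain ⟨y, hy⟩ := hball x (Set.mem_univ x)
  exact (measure_mono hy).trans_lt (hμ y)

/-- Integer powers of a distance-preserving permutation preserve distances. -/
theorem Equiv.Perm.dist_zpow_apply {X : Type*} [PseudoMetricSpace X] (f : Equiv.Perm X)
    (hf : ∀ x y : X, dist (f x) (f y) = dist x y) (k : ℤ) (x y : X) :
    dist ((f ^ k) x) ((f ^ k) y) = dist x y := by
  induction k generalizing x y with
  | zero => simp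
  | succ n ih => rw [zpow_add_one, Equiv.Perm.mul_apply, Equiv.Perm.mul_apply, ih, hf]
  | pred n ih =>
    rw [zpow_sub_one, Equiv.Perm.mul_apply, Equiv.Perm.mul_apply, ih, ← hf]
    simp

/-- If μ is a non-atomic Borel probability measure on a compact metric
space X and the homeomorphism σ preserves the metric, then for every ε > 0 there is a
Borel set A with 0 < sup_{k∈ℤ} μ(σᵏ(A)) < ε. -/
theorem stmt1
    (X : Type*) [MetricSpace X] [CompactSpace X]
    [MeasurableSpace X] [BorelSpace X]
    (σ : X ≃ₜ X)
    (hiso : ∀ x y : X, dist (σ x) (σ y) = dist x y)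
    (μ : Measure X) [IsProbabilityMeasure μ]
    (hna : ∀ x : X, μ {x} = 0) :
    ∀ ε : ENNReal, 0 < ε →
      ∃ A : Set X, MeasurableSet A ∧
        0 < ⨆ k : ℤ, μ ((σ.toEquiv ^ k) '' A) ∧
        (⨆ k : ℤ, μ ((σ.toEquiv ^ k) '' A)) < ε := by
  intro ε hε
  obtain ⟨δ, hδ, hδε⟩ := exists_between hε
  obtain ⟨r, hr, hball⟩ := exists_forall_measure_ball_lt_of_singleton_eq_zero μ hna hδ
  obtain ⟨x, hx⟩ : ∃ x : X, μ (Metric.ball x r) ≠ 0 := by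
    by_contra! h
    refine IsProbabilityMeasure.ne_zero μ (Measure.measure_univ_eq_zero.1 ?_)
    exact measure_null_of_locally_null _ fun x _ ↦
      ⟨_, mem_nhdsWithin_of_mem_nhds (Metric.ball_mem_nhds x hr), h x⟩
  refine ⟨Metric.ball x r, Metric.isOpen_ball.measurableSet, ?_, ?_⟩
  · refine (pos_iff_ne_zero.2 hx).trans_le (le_iSup_of_le 0 ?_)
    simp
  · refine (iSup_le fun k ↦ ?_).trans_lt hδε
    refine (measure_mono ?_).trans (hball ((σ.toEquiv ^ k) x)).le
    rintro _ ⟨y, hy, rfl⟩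
    rw [Metric.mem_ball, Equiv.Perm.dist_zpow_apply σ.toEquiv hiso]
    exact hy
end

section
/- Let T : X → Mₙ(ℂ) be a continuous function satisfying T(σ⁻¹(x)) = W(x)* T(x) W(x) for all x ∈ X. Then there exists T₀ ∈ Mₙ(ℂ) such that the range of T is exactly the finite set Γ = {(uᵖvᵠ) T₀ (uᵖvᵠ)* : 0 ≤ p, q ≤ n−1}. -/
open scoped Matrix

open Filter Topology

/-- The ordered product `w (f (m - 1)) * ⋯ * w (f 0)` of a weight `w` along a sequence `f`. -/
def wordProd {A G : Type*} [Monoid G] (w : A → G) (f : ℕ → A) : ℕ → G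
  | 0 => 1
  | m + 1 => w (f m) * wordProd w f m

section wordProd

variable {A G : Type*}

theorem wordProd_congr [Monoid G] (w : A → G) {f g : ℕ → A} {m : ℕ}
    (h : ∀ k < m, f k = g k) : wordProd w f m = wordProd w g m := by
  induction m with
  | zero => rfl
  | succ m ih =>
    simp only [wordProd, h m (Nat.lt_succ_self m), ih fun k hk => h k (hk.trans m.lt_succ_self)]

theorem wordProd_add [Monoid G] (w : A → G) (f : ℕ → A) (a b : ℕ) :
    wordProd w f (a + b) = wordProd w (fun k => f (a + k)) b * wordProd w f a := by
  induction b with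
  | zero => simp [wordProd]
  | succ b ih => rw [← add_assoc, wordProd, wordProd, ih, mul_assoc]

theorem wordProd_mem_closure [Group G] (w : A → G) (f : ℕ → A) (m : ℕ) :
    wordProd w f m ∈ Subgroup.closure (Set.range w) := by
  induction m with
  | zero => exact one_mem _
  | succ m ih => exact mul_mem (Subgroup.subset_closure ⟨_, rfl⟩) ih

/-- If every weight has finite order, every element of the subgroup generated by the weights is
the product of the weights along a finite word. -/
theorem exists_wordProd_eq [Group G] [Nonempty A] (w : A → G) (hw : ∀ a, IsOfFinOrder (w a))
    {g : G} (hg : g ∈ Subgroup.closure (Set.range w)) :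
    ∃ (f : ℕ → A) (m : ℕ), wordProd w f m = g := by
  rw [← Subgroup.mem_toSubmonoid, Subgroup.closure_toSubmonoid_of_isOfFinOrder
    (by rintro _ ⟨a, rfl⟩; exact hw a)] at hg
  induction hg using Submonoid.closure_induction_left with
  | one => exact ⟨fun _ => Classical.arbitrary A, 0, rfl⟩
  | mul_left a ha g _ ih =>
    obtain ⟨c, rfl⟩ := ha
    obtain ⟨f, m, rfl⟩ := ih
    refine ⟨Function.update f m c, m + 1, ?_⟩
    rw [wordProd, Function.update_self]
    congr 1
    exact wordProd_congr w fun k hk => Function.update_of_ne hk.ne _ _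

/-- Bi-infinite sequences `z` agreeing with `x` on the coordinates below `N`, whose translate by
some `m` agrees with `y` from `-N` on, can be chosen with prescribed product over `[0, m)`. -/
theorem exists_connecting_sequence [Group G] [Nonempty A] (w : A → G)
    (hw : ∀ a, IsOfFinOrder (w a)) {g : G} (hg : g ∈ Subgroup.closure (Set.range w))
    (x y : ℤ → A) (N : ℕ) :
    ∃ (z : ℤ → A) (m : ℕ), (∀ k : ℤ, k < N → z k = x k) ∧
      (∀ k : ℤ, -N ≤ k → z (k + m) = y k) ∧ wordProd w (fun k => z k) m = g := by
  obtain ⟨f, l, hf⟩ := exists_wordProd_eq w hw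
    (mul_mem (mul_mem (inv_mem (wordProd_mem_closure w (fun k => y (k - N)) N)) hg)
      (inv_mem (wordProd_mem_closure w (fun k => x k) N)))
  let z : ℤ → A := fun k => if k < N then x k else if k < N + l then f (k - N).toNat
    else y (k - (N + l + N))
  have hzx (k : ℤ) (hk : k < N) : z k = x k := if_pos hk
  have hzf (k : ℕ) (hk : k < l) : z (N + k : ℕ) = f k := by
    simp only [z]
    rw [if_neg (by omega), if_pos (by omega)]
    congr 1
    omega
  have hzy (k : ℤ) (hk : N + l ≤ k) : z k = y (k - (N + l + N)) := by
    simp only [z]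
    rw [if_neg (by omega), if_neg (by omega)]
  refine ⟨z, N + l + N, hzx, fun k hk => ?_, ?_⟩
  · push_cast
    rw [hzy _ (by omega), add_sub_cancel_right]
  · have hright (k : ℕ) : z (N + l + k : ℕ) = y (k - N) := by
      rw [hzy _ (by omega)]
      congr 1
      push_cast
      ring
    rw [wordProd_add, wordProd_add, wordProd_congr w (m := l) hzf, hf,
      wordProd_congr w (fun k hk => hzx k (by omega)),
      wordProd_congr w (fun k _ => hright k)]
    group

end wordProd

/-- A continuous function on the full shift which the shift transforms by a cocycle in a
topological action, depending on one coordinate through weights of finite order, satisfies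
`T y = g • T x` for all points `x`, `y` and all `g` in the group generated by the weights. -/
theorem eq_smul_of_cocycle {A G Y : Type*} [TopologicalSpace A] [Group G] [TopologicalSpace Y]
    [T2Space Y] [MulAction G Y] [ContinuousConstSMul G Y] (w : A → G)
    (hw : ∀ a, IsOfFinOrder (w a)) {T : (ℤ → A) → Y} (hT : Continuous T)
    (hrel : ∀ x : ℤ → A, T (fun k => x (k + 1)) = w (x 0) • T x)
    {g : G} (hg : g ∈ Subgroup.closure (Set.range w)) (x y : ℤ → A) : T y = g • T x := by
  have hiter (z : ℤ → A) (m : ℕ) :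
      T (fun k => z (k + m)) = wordProd w (fun k => z k) m • T z := by
    induction m with
    | zero => simp [wordProd]
    | succ m ih =>
      rw [wordProd, mul_smul, ← ih]
      convert hrel (fun k => z (k + m)) using 3 with k
      · congr 1; push_cast; ring
      · simp
  have : Nonempty A := ⟨x 0⟩
  choose z m hz hzm hg using exists_connecting_sequence w hw hg x y
  have hx : Tendsto z atTop (𝓝 x) := tendsto_pi_nhds.2 fun k =>
    tendsto_const_nhds.congr' <| by
      filter_upwards [eventually_gt_atTop k.toNat] with N hN
      exact (hz N k (by omega)).symm
  have hy : Tendsto (fun N k => z N (k + m N)) atTop (𝓝 y) := tendsto_pi_nhds.2 fun k =>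
    tendsto_const_nhds.congr' <| by
      filter_upwards [eventually_gt_atTop (-k).toNat] with N hN
      exact (hzm N k (by omega)).symm
  refine tendsto_nhds_unique ((hT.tendsto y).comp hy)
    ((((hT.tendsto x).comp hx).const_smul g).congr fun N => ?_)
  simp [hiter, hg]



/-- For the Bernoulli shift on X = Λ^ℤ and the unitary-valued cocycle W
built from the canonical pair u, v (with vuv⁻¹ = ωu, ω = e^{2πi/n}), any continuous
T : X → Mₙ(ℂ) with T(σ⁻¹x) = W(x)* T(x) W(x) has range exactly
Γ = {(uᵖvᵠ) T₀ (uᵖvᵠ)* : 0 ≤ p,q ≤ n−1} for some T₀. -/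
theorem stmt2
    (Λ : Type*) [Fintype Λ] [TopologicalSpace Λ] [DiscreteTopology Λ]
    (hΛ : 1 < Fintype.card Λ)
    (n : ℕ) (hn : 2 ≤ n)
    (ω : ℂ) (hω : ω = Complex.exp (2 * Real.pi * Complex.I / n))
    (u v : Matrix (Fin n) (Fin n) ℂ)
    (hu : u ∈ Matrix.unitaryGroup (Fin n) ℂ)
    (hv : v ∈ Matrix.unitaryGroup (Fin n) ℂ)
    (hun : u ^ n = 1) (hvn : v ^ n = 1)
    (hcomm : v * u * v⁻¹ = ω • u)
    (C₁ : Set Λ) [DecidablePred (· ∈ C₁)] (hC₁ : C₁.Nonempty) (hC₁' : C₁ ≠ Set.univ)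
    (W : (ℤ → Λ) → Matrix (Fin n) (Fin n) ℂ)
    (hW : ∀ x : ℤ → Λ, W x = if x 0 ∈ C₁ then star u else star v)
    (T : (ℤ → Λ) → Matrix (Fin n) (Fin n) ℂ)
    (hT : Continuous T)
    (hTrel : ∀ x : ℤ → Λ, T (fun k => x (k + 1)) = star (W x) * T x * W x) :
    ∃ T₀ : Matrix (Fin n) (Fin n) ℂ,
      Set.range T =
        {M | ∃ p q : ℕ, p ≤ n - 1 ∧ q ≤ n - 1 ∧
          M = (u ^ p * v ^ q) * T₀ * star (u ^ p * v ^ q)} := by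
  have huf : IsOfFinOrder (⟨u, hu⟩ : Matrix.unitaryGroup (Fin n) ℂ) :=
    isOfFinOrder_iff_pow_eq_one.2 ⟨n, by omega, Subtype.ext hun⟩
  have hvf : IsOfFinOrder (⟨v, hv⟩ : Matrix.unitaryGroup (Fin n) ℂ) :=
    isOfFinOrder_iff_pow_eq_one.2 ⟨n, by omega, Subtype.ext hvn⟩
  let w : Λ → ConjAct (Matrix (Fin n) (Fin n) ℂ)ˣ := fun a =>
    ConjAct.toConjAct (Unitary.toUnits
      (if a ∈ C₁ then ⟨u, hu⟩ else ⟨v, hv⟩ : Matrix.unitaryGroup (Fin n) ℂ))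
  have hsmul (g : Matrix.unitaryGroup (Fin n) ℂ) (M : Matrix (Fin n) (Fin n) ℂ) :
      ConjAct.toConjAct (Unitary.toUnits g) • M = (g : Matrix (Fin n) (Fin n) ℂ) * M * star g.1 :=
    rfl
  have hw (a : Λ) : IsOfFinOrder (w a) := by
    refine MonoidHom.isOfFinOrder
      (ConjAct.toConjAct.toMonoidHom.comp Unitary.toUnits) (?_ : IsOfFinOrder _)
    split_ifs <;> assumption
  have hrel (x : ℤ → Λ) : T (fun k => x (k + 1)) = w (x 0) • T x := by
    rw [hTrel, hW, hsmul]
    split_ifs <;> simp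
  have : ContinuousConstSMul (ConjAct (Matrix (Fin n) (Fin n) ℂ)ˣ) (Matrix (Fin n) (Fin n) ℂ) :=
    ⟨fun g => (continuous_const.mul continuous_id).mul continuous_const⟩
  obtain ⟨a, ha⟩ := hC₁
  obtain ⟨b, hb⟩ := (Set.ne_univ_iff_exists_notMem _).1 hC₁'
  have key (p q : ℕ) (x y : ℤ → Λ) :
      T y = (u ^ p * v ^ q) * T x * star (u ^ p * v ^ q) := by
    have hg : w a ^ p * w b ^ q ∈ Subgroup.closure (Set.range w) :=
      mul_mem (pow_mem (Subgroup.subset_closure (Set.mem_range_self a)) p)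
        (pow_mem (Subgroup.subset_closure (Set.mem_range_self b)) q)
    rw [eq_smul_of_cocycle w hw hT hrel hg x y]
    simp only [w, if_pos ha, if_neg hb, ← map_pow, ← map_mul]
    rw [hsmul]
    rfl
  refine ⟨T fun _ => a, Set.ext fun M => ⟨?_, ?_⟩⟩
  · rintro ⟨y, rfl⟩
    exact ⟨0, 0, Nat.zero_le _, Nat.zero_le _, key 0 0 _ y⟩
  · rintro ⟨p, q, -, -, rfl⟩
    exact ⟨fun _ => a, key p q _ _⟩
end

section
/- (a) Every continuous function f : X → ℂ with f(σ(x)) = f(x) for all x ∈ X is constant. (b) Every continuous function T : X → Mₙ(ℂ) satisfying T(σ⁻¹(x)) = W(x)* T(x) W(x) for all x ∈ X is of the form T(x) = c·1 for a single constant c ∈ ℂ (where 1 is the identity matrix). -/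
open scoped Matrix

open Filter

/-- If two sequences of configurations eventually agree at each coordinate, then a continuous map
cannot keep them at a constant positive distance. -/
lemma dist_eq_zero_of_eventually_eq {ι Λ E : Type*} [Finite Λ] [TopologicalSpace Λ]
    [DiscreteTopology Λ] [MetricSpace E] {T : (ι → Λ) → E} (hT : Continuous T)
    {a b : ℕ → ι → Λ} (hab : ∀ k, ∀ᶠ m in atTop, a m k = b m k) {c : ℝ}
    (hc : ∀ m, dist (T (a m)) (T (b m)) = c) : c = 0 := by
  obtain ⟨p, hp⟩ := exists_clusterPt_of_compactSpace (map (fun m => (a m, b m)) atTop)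
  have mem_of_eventually : ∀ s : Set ((ι → Λ) × (ι → Λ)), IsClosed s →
      (∀ᶠ m in atTop, (a m, b m) ∈ s) → p ∈ s := fun s hs h =>
    hs.closure_eq ▸ mem_closure_iff_clusterPt.2 (hp.mono (le_principal_iff.2 h))
  have hpc : dist (T p.1) (T p.2) = c :=
    mem_of_eventually {q | dist (T q.1) (T q.2) = c}
      (isClosed_eq (by fun_prop) continuous_const) (Eventually.of_forall hc)
  have hpp : p.1 = p.2 := funext fun k =>
    mem_of_eventually {q | q.1 k = q.2 k} (isClosed_eq (by fun_prop) (by fun_prop)) (hab k)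
  rw [← hpc, hpp, dist_self]

/-- A continuous function on the full shift which is equivariant for a cocycle of isometries
depending on one coordinate is constant. -/
lemma eq_of_shift_equivariant {Λ E : Type*} [Finite Λ] [TopologicalSpace Λ]
    [DiscreteTopology Λ] [MetricSpace E] {T : (ℤ → Λ) → E} (hT : Continuous T)
    {φ : Λ → E → E} (hφ : ∀ l, Isometry (φ l))
    (h : ∀ x : ℤ → Λ, T (fun k => x (k + 1)) = φ (x 0) (T x)) (x y : ℤ → Λ) : T x = T y := by
  have dist_shift : ∀ x y : ℤ → Λ, x 0 = y 0 →
      dist (T fun k => x (k + 1)) (T fun k => y (k + 1)) = dist (T x) (T y) := by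
    intro x y hxy
    rw [h, h, hxy, (hφ _).dist_eq]
  have right : ∀ x y : ℤ → Λ, (∀ k, 0 ≤ k → x k = y k) → T x = T y := by
    intro x y hxy
    refine dist_eq_zero.1 (dist_eq_zero_of_eventually_eq hT
      (a := fun m k => x (k + m)) (b := fun m k => y (k + m)) ?_ ?_)
    · intro k
      filter_upwards [eventually_ge_atTop k.natAbs] with m hm
      exact hxy _ (by omega)
    · intro m
      induction m with
      | zero => simp
      | succ m ih =>
        rw [← ih, ← dist_shift (fun k => x (k + m)) (fun k => y (k + m)) (hxy _ (by omega))]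
        simp only [Nat.cast_succ, add_assoc, add_comm (1 : ℤ)]
  have left : ∀ x y : ℤ → Λ, (∀ k, k < 0 → x k = y k) → T x = T y := by
    intro x y hxy
    refine dist_eq_zero.1 (dist_eq_zero_of_eventually_eq hT
      (a := fun m k => x (k - m)) (b := fun m k => y (k - m)) ?_ ?_)
    · intro k
      filter_upwards [eventually_gt_atTop k.natAbs] with m hm
      exact hxy _ (by omega)
    · intro m
      induction m with
      | zero => simp
      | succ m ih =>
        rw [← ih, ← dist_shift (fun k => x (k - (m + 1 : ℕ))) (fun k => y (k - (m + 1 : ℕ)))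
          (hxy _ (by omega))]
        simp only [Nat.cast_succ, add_sub_add_right_eq_sub]
  rw [left x (fun k => if k < 0 then x k else y k) (fun k hk => by simp [hk])]
  exact right _ _ fun k hk => by simp [hk]

/-- Endomorphisms `u`, `v` of an `n`-dimensional space with `v u = ω u v`, for `ω` a primitive
`n`-th root of unity and `v` injective, have only scalars in their common commutant. -/
lemma Module.End.exists_eq_smul_one_of_commute {K V : Type*} [Field K] [IsAlgClosed K]
    [AddCommGroup V] [Module K V] [FiniteDimensional K V] [Nontrivial V] {ω : K}
    (hω : IsPrimitiveRoot ω (Module.finrank K V)) {u v T : Module.End K V}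
    (hu : Function.Injective u) (hv : Function.Injective v) (huv : v * u = ω • (u * v))
    (hTu : Commute T u) (hTv : Commute T v) : ∃ c : K, T = c • 1 := by
  obtain ⟨c, hc⟩ := Module.End.exists_eigenvalue T
  set F := T.eigenspace c
  have : Nontrivial F := Submodule.nontrivial_iff_ne_bot.2 hc
  have huF : ∀ x ∈ F, u x ∈ F := fun x hx => by
    rw [Module.End.mem_eigenspace_iff] at hx ⊢
    rw [← Module.End.mul_apply, hTu.eq, Module.End.mul_apply, hx, map_smul]
  have hvF : ∀ x ∈ F, v x ∈ F := fun x hx => by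
    rw [Module.End.mem_eigenspace_iff] at hx ⊢
    rw [← Module.End.mul_apply, hTv.eq, Module.End.mul_apply, hx, map_smul]
  obtain ⟨l, hl⟩ := Module.End.exists_eigenvalue (u.restrict huF)
  obtain ⟨e, he⟩ := hl.exists_hasEigenvector
  have hω0 : ω ≠ 0 := hω.ne_zero Module.finrank_pos.ne'
  have he0 : (e : V) ≠ 0 := fun h => he.2 (Subtype.ext h)
  have hue : u e = l • (e : V) := congrArg Subtype.val he.apply_eq_smul
  have hl0 : l ≠ 0 := by
    rintro rfl
    exact he0 (hu (by simpa using hue))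
  have hvu : ∀ x, u (v x) = ω⁻¹ • v (u x) := fun x => by
    have := LinearMap.congr_fun huv x
    simp only [Module.End.mul_apply, LinearMap.smul_apply] at this
    rw [this, inv_smul_smul₀ hω0]
  have hmem : ∀ k : ℕ, (v ^ k) e ∈ F := fun k => by
    induction k with
    | zero => exact e.2
    | succ k ih => rw [pow_succ', Module.End.mul_apply]; exact hvF _ ih
  have heig : ∀ k : ℕ, u ((v ^ k) e) = (ω⁻¹ ^ k * l) • (v ^ k) (e : V) := fun k => by
    induction k with
    | zero => simpa using hue
    | succ k ih =>
      rw [pow_succ' v, Module.End.mul_apply, hvu, ih, map_smul, smul_smul]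
      congr 1
      ring
  have hne : ∀ k : ℕ, (v ^ k) (e : V) ≠ 0 := fun k => by
    induction k with
    | zero => exact he0
    | succ k ih =>
      rw [pow_succ', Module.End.mul_apply]
      exact (map_ne_zero_iff v hv).2 ih
  have hli : LinearIndependent K fun k : Fin (Module.finrank K V) => (v ^ (k : ℕ)) (e : V) := by
    refine Module.End.eigenvectors_linearIndependent' u (fun k : Fin _ => ω⁻¹ ^ (k : ℕ) * l) ?_ _
      fun k => ⟨Module.End.mem_eigenspace_iff.2 (heig k), hne k⟩
    intro i j hij
    exact Fin.ext (hω.inv.pow_inj i.2 j.2 (mul_right_cancel₀ hl0 hij))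
  have hF : F = ⊤ := by
    rw [eq_top_iff, ← hli.span_eq_top_of_card_eq_finrank' (by simp), Submodule.span_le]
    rintro _ ⟨k, rfl⟩
    exact hmem k
  refine ⟨c, LinearMap.ext fun x => ?_⟩
  have hx : x ∈ F := hF ▸ Submodule.mem_top
  simpa using Module.End.mem_eigenspace_iff.1 hx

/-- Matrix form of `Module.End.exists_eq_smul_one_of_commute`. -/
lemma Matrix.exists_eq_smul_one_of_commute {K : Type*} [Field K] [IsAlgClosed K] {n : ℕ}
    [NeZero n] {ω : K} (hω : IsPrimitiveRoot ω n) {u v T : Matrix (Fin n) (Fin n) K}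
    (hu : IsUnit u) (hv : IsUnit v) (huv : v * u = ω • (u * v))
    (hTu : Commute T u) (hTv : Commute T v) : ∃ c : K, T = c • 1 := by
  let L := Matrix.toLinAlgEquiv' (R := K) (n := Fin n)
  obtain ⟨c, hc⟩ := Module.End.exists_eq_smul_one_of_commute (ω := ω) (u := L u) (v := L v)
    (T := L T) (by simpa using hω)
    ((Module.End.isUnit_iff _).1 (hu.map L)).1 ((Module.End.isUnit_iff _).1 (hv.map L)).1
    (by rw [← map_mul, huv, map_smul, map_mul]) (hTu.map L) (hTv.map L)
  exact ⟨c, L.injective (by rw [hc, map_smul, map_one])⟩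

open scoped Matrix.Norms.L2Operator in
/-- Equivariance under conjugation by unitaries forces a continuous matrix-valued function on the
full shift to be constant. -/
lemma eq_of_shift_conj {Λ : Type*} [Finite Λ] [TopologicalSpace Λ] [DiscreteTopology Λ]
    {n : ℕ} {g : Λ → Matrix (Fin n) (Fin n) ℂ} (hg : ∀ l, g l ∈ Matrix.unitaryGroup (Fin n) ℂ)
    {T : (ℤ → Λ) → Matrix (Fin n) (Fin n) ℂ} (hT : Continuous T)
    (h : ∀ x : ℤ → Λ, T (fun k => x (k + 1)) = g (x 0) * T x * star (g (x 0)))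
    (x y : ℤ → Λ) : T x = T y := by
  refine eq_of_shift_equivariant hT (φ := fun l A => g l * A * star (g l)) (fun l => ?_) h x y
  refine Isometry.of_dist_eq fun A B => ?_
  rw [dist_eq_norm, dist_eq_norm, ← sub_mul, ← mul_sub,
    CStarRing.norm_mul_mem_unitary _ (Unitary.star_mem (hg l)),
    CStarRing.norm_mem_unitary_mul _ (hg l)]

/-- For the Bernoulli shift on X = Λ^ℤ:
(a) every continuous shift-invariant f : X → ℂ is constant;
(b) every continuous T : X → Mₙ(ℂ) with T(σ⁻¹x) = W(x)* T(x) W(x) is a constant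
scalar multiple of the identity matrix. -/
theorem stmt3
    (Λ : Type*) [Fintype Λ] [TopologicalSpace Λ] [DiscreteTopology Λ]
    (hΛ : 1 < Fintype.card Λ)
    (n : ℕ) (hn : 2 ≤ n)
    (ω : ℂ) (hω : ω = Complex.exp (2 * Real.pi * Complex.I / n))
    (u v : Matrix (Fin n) (Fin n) ℂ)
    (hu : u ∈ Matrix.unitaryGroup (Fin n) ℂ)
    (hv : v ∈ Matrix.unitaryGroup (Fin n) ℂ)
    (hun : u ^ n = 1) (hvn : v ^ n = 1)
    (hcomm : v * u * v⁻¹ = ω • u)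
    (C₁ : Set Λ) [DecidablePred (· ∈ C₁)] (hC₁ : C₁.Nonempty) (hC₁' : C₁ ≠ Set.univ)
    (W : (ℤ → Λ) → Matrix (Fin n) (Fin n) ℂ)
    (hW : ∀ x : ℤ → Λ, W x = if x 0 ∈ C₁ then star u else star v) :
    (∀ f : (ℤ → Λ) → ℂ, Continuous f →
      (∀ x : ℤ → Λ, f (fun k => x (k - 1)) = f x) → ∃ c : ℂ, ∀ x, f x = c) ∧
    (∀ T : (ℤ → Λ) → Matrix (Fin n) (Fin n) ℂ, Continuous T →
      (∀ x : ℤ → Λ, T (fun k => x (k + 1)) = star (W x) * T x * W x) →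
      ∃ c : ℂ, ∀ x, T x = c • (1 : Matrix (Fin n) (Fin n) ℂ)) := by
  have : NeZero n := ⟨by omega⟩
  constructor
  · intro f hf hfs
    have : Nonempty Λ := hC₁.to_type
    refine ⟨f fun _ => Classical.arbitrary Λ, fun x =>
      eq_of_shift_equivariant hf (φ := fun _ => id) (fun _ => isometry_id) (fun x => ?_) _ _⟩
    simpa using (hfs fun k => x (k + 1)).symm
  · intro T hT hTs
    have hconst := eq_of_shift_conj (g := fun l => if l ∈ C₁ then u else v)
      (fun l => by split_ifs <;> assumption) hT
      (fun x => by rw [hTs, hW]; split_ifs <;> simp)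
    obtain ⟨a, ha⟩ := hC₁
    obtain ⟨b, hb⟩ := (Set.ne_univ_iff_exists_notMem C₁).1 hC₁'
    have comm_of_conj : ∀ g ∈ Matrix.unitaryGroup (Fin n) ℂ,
        T (fun _ => a) = g * T (fun _ => a) * star g → Commute (T fun _ => a) g := by
      intro g hg h
      rw [Commute, SemiconjBy]
      nth_rw 1 [h]
      rw [mul_assoc, Unitary.star_mul_self_of_mem hg, mul_one]
    have hTu := comm_of_conj u hu (by simpa [hW, ha] using hTs fun _ => a)
    have hTv := comm_of_conj v hv (by
      simpa [hW, hb, hconst (fun _ => b) (fun _ => a)] using hTs fun _ => b)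
    have hvu : v * u = ω • (u * v) := by
      rw [← smul_mul_assoc, ← hcomm, mul_assoc _ v⁻¹, Matrix.nonsing_inv_mul _
        (Matrix.UnitaryGroup.det_isUnit ⟨v, hv⟩), mul_one]
    obtain ⟨c, hc⟩ := Matrix.exists_eq_smul_one_of_commute
      (hω ▸ Complex.isPrimitiveRoot_exp n (NeZero.ne n))
      (Unitary.isUnit_coe (U := ⟨u, hu⟩))
      (Unitary.isUnit_coe (U := ⟨v, hv⟩)) hvu hTu hTv
    exact ⟨c, fun x => (hconst x _).trans hc⟩
end

section
/- Let C₁' be a nonempty proper subset of Λ with C₁' ≠ C₁, let C' = {x ∈ X : x₀ ∈ C₁'}, D' = X \ C', and define W' : X → Mₙ(ℂ) by W'(x) = u* for x ∈ C' and W'(x) = v* for x ∈ D'. Then the following are equivalent: (1) there exists a measurable function ζ : X → Mₙ(ℂ) with ζ(x) unitary for μ-almost every x such that W(x) = ζ(x) W'(x) ζ(σ⁻¹(x))* for μ-almost every x; (2) n = 2 and C₁' = Λ \ C₁. -/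
open MeasureTheory ProbabilityTheory Filter Topology
open scoped Matrix ENNReal

/-- Translation of the coordinates of a bi-infinite sequence by `a`. -/
def coordShift {Λ : Type*} (a : ℤ) (x : ℤ → Λ) : ℤ → Λ := fun k => x (k + a)

theorem coordShift_coordShift {Λ : Type*} (a b : ℤ) (x : ℤ → Λ) :
    coordShift a (coordShift b x) = coordShift (a + b) x := by
  funext k
  simp only [coordShift, add_assoc]

theorem coordShift_zero {Λ : Type*} (x : ℤ → Λ) : coordShift 0 x = x := by
  funext k
  simp [coordShift]

section Approximation

variable {Ω : Type*} {m m₀ : MeasurableSpace Ω} {μ : Measure Ω}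

/-- An integrable function which is an `L¹`-limit of `m`-measurable functions agrees almost
everywhere with its conditional expectation given `m`. -/
theorem condExp_ae_eq_self_of_approx [IsFiniteMeasure μ] (hm : m ≤ m₀) {f : Ω → ℂ}
    (hf : Integrable f μ)
    (H : ∀ ε : ℝ≥0∞, ε ≠ 0 → ∃ h : Ω → ℂ, StronglyMeasurable[m] h ∧ eLpNorm (f - h) 1 μ ≤ ε) :
    μ[f | m] =ᵐ[μ] f := by
  have key : eLpNorm (f - μ[f | m]) 1 μ = 0 := by
    refine le_antisymm (ENNReal.le_of_forall_pos_le_add fun ε hε _ => ?_) zero_le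
    obtain ⟨h, hh, hle⟩ := H (ε / 2 : NNReal) (by simpa using hε.ne')
    have hfh : Integrable (f - h) μ := by
      rw [← memLp_one_iff_integrable]
      exact ⟨hf.1.sub (hh.mono hm).aestronglyMeasurable, hle.trans_lt ENNReal.coe_lt_top⟩
    have hhi : Integrable h μ := by simpa using hf.sub hfh
    have h1 : f - μ[f | m] =ᵐ[μ] (f - h) - μ[f - h | m] := by
      filter_upwards [condExp_sub hf hhi m] with x hx
      have h2 := congrFun (condExp_of_stronglyMeasurable hm hh hhi) x
      simp only [Pi.sub_apply] at hx ⊢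
      rw [hx, h2]
      ring
    rw [eLpNorm_congr_ae h1]
    calc eLpNorm ((f - h) - μ[f - h | m]) 1 μ
        ≤ eLpNorm (f - h) 1 μ + eLpNorm (μ[f - h | m]) 1 μ :=
          eLpNorm_sub_le hfh.1 integrable_condExp.1 le_rfl
      _ ≤ (ε / 2 : NNReal) + (ε / 2 : NNReal) :=
          add_le_add hle ((eLpNorm_condExp_le_eLpNorm _ le_rfl).trans hle)
      _ = 0 + ε := by rw [← ENNReal.coe_add, add_halves, zero_add]
  rw [eLpNorm_eq_zero_iff (hf.1.sub integrable_condExp.1) one_ne_zero] at key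
  filter_upwards [key] with x hx
  exact (sub_eq_zero.1 hx).symm

/-- A complex integrable function is approximated in `L¹` by functions measurable with respect
to the members of an exhausting filtration. -/
theorem eventually_exists_eLpNorm_sub_le [IsFiniteMeasure μ] (ℱ : Filtration ℕ m₀)
    (hℱ : ⨆ n, ℱ n = m₀) {f : Ω → ℂ} (hf : Integrable f μ) {ε : ℝ≥0∞} (hε : ε ≠ 0) :
    ∀ᶠ n in atTop, ∃ g : Ω → ℂ, StronglyMeasurable[ℱ n] g ∧ eLpNorm (f - g) 1 μ ≤ ε := by
  have aux (g : Ω → ℝ) (hg : Integrable g μ) :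
      ∀ᶠ n in atTop, eLpNorm (g - μ[g | ℱ n]) 1 μ ≤ ε / 2 := by
    have h1 := tendsto_eLpNorm_condExp (μ := μ) (ℱ := ℱ) g
    have h2 : μ[g | ⨆ n, ℱ n] =ᵐ[μ] g := by
      refine condExp_of_aestronglyMeasurable' (iSup_le ℱ.le) ?_ hg
      rw [hℱ]
      exact hg.1
    filter_upwards [(ENNReal.tendsto_nhds_zero.1 h1) (ε / 2) (ENNReal.half_pos hε)] with n hn
    rw [eLpNorm_sub_comm]
    refine le_trans (le_of_eq (eLpNorm_congr_ae ?_)) hn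
    filter_upwards [h2] with x hx
    simp [hx]
  filter_upwards [aux _ hf.re, aux _ hf.im] with n hre him
  set a := μ[fun x => RCLike.re (f x) | ℱ n] with ha
  set b := μ[fun x => RCLike.im (f x) | ℱ n] with hb
  have hma : StronglyMeasurable[ℱ n] a := stronglyMeasurable_condExp
  have hmb : StronglyMeasurable[ℱ n] b := stronglyMeasurable_condExp
  refine ⟨fun x => (a x : ℂ) + Complex.I * (b x : ℂ), ?_, ?_⟩
  · exact (Complex.continuous_ofReal.comp_stronglyMeasurable hma).add
      ((Complex.continuous_ofReal.comp_stronglyMeasurable hmb).const_mul _)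
  · have hia : Integrable a μ := integrable_condExp
    have hib : Integrable b μ := integrable_condExp
    calc eLpNorm (f - fun x => (a x : ℂ) + Complex.I * (b x : ℂ)) 1 μ
        ≤ eLpNorm ((fun x => RCLike.re (f x)) - a) 1 μ
            + eLpNorm ((fun x => RCLike.im (f x)) - b) 1 μ := by
          simp only [eLpNorm_one_eq_lintegral_enorm]
          rw [← lintegral_add_left' (hf.re.sub hia).1.enorm]
          refine lintegral_mono fun x => ?_
          have : (f - fun x => (a x : ℂ) + Complex.I * (b x : ℂ)) x
              = (((f x).re - a x : ℝ) : ℂ) + Complex.I * (((f x).im - b x : ℝ) : ℂ) := by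
            apply Complex.ext <;> simp
          rw [this]
          refine (enorm_add_le _ _).trans (le_of_eq ?_)
          rw [enorm_mul]
          simp only [← ofReal_norm, Complex.norm_real, Complex.norm_I, ENNReal.ofReal_one, one_mul]
          rfl
      _ ≤ ε / 2 + ε / 2 := add_le_add hre him
      _ = ε := ENNReal.add_halves ε

/-- An integrable function which is measurable, up to null sets, with respect to two independent
sub-`σ`-algebras is almost everywhere constant. -/
theorem ae_eq_const_of_condExp_indep [IsProbabilityMeasure μ] {m₁ m₂ : MeasurableSpace Ω}
    (h₁ : m₁ ≤ m₀) (h₂ : m₂ ≤ m₀) (hind : Indep m₁ m₂ μ) {f : Ω → ℂ}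
    (hf₁ : μ[f | m₁] =ᵐ[μ] f) (hf₂ : μ[f | m₂] =ᵐ[μ] f) : ∃ c : ℂ, f =ᵐ[μ] fun _ => c := by
  have h := condExp_indep_eq h₁ h₂ (stronglyMeasurable_condExp (f := f) (μ := μ)) hind
  exact ⟨_, hf₂.symm.trans ((condExp_congr_ae hf₁.symm).trans h)⟩

end Approximation

section Shift

variable {Λ : Type*} [MeasurableSpace Λ]

theorem measurable_coordShift_cylinderEvents {Δ Δ' : Set ℤ} {a : ℤ} (h : ∀ k ∈ Δ', k + a ∈ Δ) :
    Measurable[cylinderEvents Δ, cylinderEvents Δ'] (coordShift a : (ℤ → Λ) → ℤ → Λ) := by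
  rw [measurable_cylinderEvents_iff]
  exact fun i hi => measurable_cylinderEvent_apply (h i hi)

theorem measurePreserving_coordShift {μ₁ : Measure Λ} [IsProbabilityMeasure μ₁]
    {μ : Measure (ℤ → Λ)}
    (hμ : ∀ (s : Finset ℤ) (B : ℤ → Set Λ), μ {x | ∀ i ∈ s, x i ∈ B i} = ∏ i ∈ s, μ₁ (B i))
    (a : ℤ) : MeasurePreserving (coordShift a) μ μ := by
  have hmeas : Measurable (coordShift a : (ℤ → Λ) → ℤ → Λ) :=
    measurable_pi_iff.2 fun k => measurable_pi_apply (k + a)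
  refine ⟨hmeas, ?_⟩
  have h1 : μ = Measure.infinitePi fun _ => μ₁ :=
    Measure.eq_infinitePi _ fun s t _ => by simpa [Set.pi] using hμ s t
  have h2 : μ.map (coordShift a) = Measure.infinitePi fun _ => μ₁ := by
    refine Measure.eq_infinitePi _ fun s t ht => ?_
    rw [Measure.map_apply hmeas (MeasurableSet.pi s.countable_toSet fun i _ => ht i)]
    have h3 := hμ (s.map (addRightEmbedding a)) fun k => t (k - a)
    simp only [Finset.prod_map, addRightEmbedding_apply, add_sub_cancel_right] at h3
    rw [← h3]
    congr 1
    ext x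
    simp [coordShift]
  rw [h2, h1]

theorem indep_cylinderEvents_compl {μ₁ : Measure Λ} {μ : Measure (ℤ → Λ)}
    (hμ : ∀ (s : Finset ℤ) (B : ℤ → Set Λ), μ {x | ∀ i ∈ s, x i ∈ B i} = ∏ i ∈ s, μ₁ (B i))
    (Δ : Set ℤ) :
    Indep (cylinderEvents (X := fun _ : ℤ => Λ) Δ) (cylinderEvents Δᶜ) μ := by
  have h : iIndepFun (fun (i : ℤ) (x : ℤ → Λ) => x i) μ := by
    rw [iIndepFun_iff_measure_inter_preimage_eq_mul]
    intro S B _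
    have h1 : (⋂ i ∈ S, (fun x : ℤ → Λ => x i) ⁻¹' B i) = {x | ∀ i ∈ S, x i ∈ B i} := by
      ext x
      simp
    rw [h1, hμ]
    refine Finset.prod_congr rfl fun i _ => ?_
    have h2 := hμ {i} B
    simp only [Finset.mem_singleton, forall_eq, Finset.prod_singleton] at h2
    exact h2.symm
  exact indep_iSup_of_disjoint (fun i => (measurable_pi_apply i).comap_le) h
    disjoint_compl_right

/-- The filtration whose `m`-th member is generated by the coordinates that translation by `m * e`
moves into `Δ`. -/
def translateFiltration (Δ : Set ℤ) (e : ℤ) (hΔ : ∀ k ∈ Δ, k + e ∈ Δ) :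
    Filtration ℕ (MeasurableSpace.pi : MeasurableSpace (ℤ → Λ)) where
  seq m := cylinderEvents {k | k + m * e ∈ Δ}
  mono' := by
    refine monotone_nat_of_le_succ fun m => cylinderEvents_mono fun k hk => ?_
    have := hΔ _ hk
    simp only [Set.mem_ofPred_eq, Nat.cast_add, Nat.cast_one]
    rwa [show k + ((m : ℤ) + 1) * e = k + m * e + e by ring]
  le' _ := cylinderEvents_le_pi

theorem iSup_translateFiltration {Δ : Set ℤ} {e : ℤ} (hΔ : ∀ k ∈ Δ, k + e ∈ Δ)
    (hex : ∀ k, ∃ m : ℕ, k + m * e ∈ Δ) :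
    ⨆ m, translateFiltration (Λ := Λ) Δ e hΔ m = MeasurableSpace.pi := by
  refine le_antisymm (iSup_le (Filtration.le _)) (iSup_le fun k => ?_)
  obtain ⟨m, hm⟩ := hex k
  refine le_trans ?_ (le_iSup _ m)
  exact (measurable_cylinderEvent_apply (X := fun _ : ℤ => Λ)
    (Δ := {k | k + (m : ℤ) * e ∈ Δ}) hm).comap_le

variable {n : ℕ} {μ : Measure (ℤ → Λ)}

/-- Iterating a cohomological equation. -/
theorem exists_iterate_cohomology {Δ : Set ℤ} {e : ℤ} (hΔ : ∀ k ∈ Δ, k + e ∈ Δ)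
    (hS : ∀ a, MeasurePreserving (coordShift a) μ μ)
    {A A' ζ : (ℤ → Λ) → Matrix (Fin n) (Fin n) ℂ}
    (hA : ∀ i j, Measurable[cylinderEvents Δ] fun x => A x i j)
    (hA' : ∀ i j, Measurable[cylinderEvents Δ] fun x => A' x i j)
    (hAu : ∀ x, A x ∈ Matrix.unitaryGroup (Fin n) ℂ)
    (hAu' : ∀ x, A' x ∈ Matrix.unitaryGroup (Fin n) ℂ)
    (hζ : ∀ᵐ x ∂μ, ζ x = A x * ζ (coordShift e x) * A' x) (m : ℕ) :
    ∃ V V' : (ℤ → Λ) → Matrix (Fin n) (Fin n) ℂ,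
      (∀ i j, Measurable[cylinderEvents Δ] fun x => V x i j) ∧
      (∀ i j, Measurable[cylinderEvents Δ] fun x => V' x i j) ∧
      (∀ x, V x ∈ Matrix.unitaryGroup (Fin n) ℂ) ∧
      (∀ x, V' x ∈ Matrix.unitaryGroup (Fin n) ℂ) ∧
      ∀ᵐ x ∂μ, ζ x = V x * ζ (coordShift (m * e) x) * V' x := by
  induction m with
  | zero =>
    refine ⟨fun _ => 1, fun _ => 1, fun i j => measurable_const, fun i j => measurable_const,
      fun _ => one_mem _, fun _ => one_mem _, ae_of_all _ fun x => ?_⟩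
    simp [coordShift_zero]
  | succ m ih =>
    obtain ⟨V, V', hV, hV', hVu, hVu', h⟩ := ih
    have hs := measurable_coordShift_cylinderEvents (Λ := Λ) hΔ
    refine ⟨fun x => A x * V (coordShift e x), fun x => V' (coordShift e x) * A' x, fun i j => ?_,
      fun i j => ?_, fun x => mul_mem (hAu x) (hVu _), fun x => mul_mem (hVu' _) (hAu' x), ?_⟩
    · simp only [Matrix.mul_apply]
      exact Finset.measurable_sum _ fun l _ => (hA i l).mul ((hV l j).comp hs)
    · simp only [Matrix.mul_apply]
      exact Finset.measurable_sum _ fun l _ => ((hV' i l).comp hs).mul (hA' l j)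
    · filter_upwards [hζ, (hS e).quasiMeasurePreserving.ae h] with x hx hx'
      rw [hx, hx', coordShift_coordShift]
      push_cast
      rw [show (m : ℤ) * e + e = (m + 1) * e by ring]
      simp only [Matrix.mul_assoc]

theorem enorm_entry_le_one {U : Matrix (Fin n) (Fin n) ℂ}
    (hU : U ∈ Matrix.unitaryGroup (Fin n) ℂ) (i j : Fin n) : ‖U i j‖ₑ ≤ 1 := by
  rw [← ofReal_norm]
  exact ENNReal.ofReal_le_one.2 (entry_norm_bound_of_unitary hU i j)

theorem enorm_mul_mul_apply_le {V V' : Matrix (Fin n) (Fin n) ℂ}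
    (hV : V ∈ Matrix.unitaryGroup (Fin n) ℂ) (hV' : V' ∈ Matrix.unitaryGroup (Fin n) ℂ)
    (B : Matrix (Fin n) (Fin n) ℂ) (i j : Fin n) :
    ‖(V * B * V') i j‖ₑ ≤ ∑ b, ∑ a, ‖B a b‖ₑ := by
  simp only [Matrix.mul_apply, Finset.sum_mul]
  refine (enorm_sum_le _ _).trans (Finset.sum_le_sum fun b _ => (enorm_sum_le _ _).trans
    (Finset.sum_le_sum fun a _ => ?_))
  rw [enorm_mul, enorm_mul]
  calc ‖V i a‖ₑ * ‖B a b‖ₑ * ‖V' b j‖ₑ ≤ 1 * ‖B a b‖ₑ * 1 := by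
        gcongr
        · exact enorm_entry_le_one hV i a
        · exact enorm_entry_le_one hV' b j
    _ = ‖B a b‖ₑ := by simp

/-- A solution of a cohomological equation with `Δ`-measurable coefficients is itself
`Δ`-measurable up to null sets, if the translations push all coordinates into `Δ`. -/
theorem condExp_ae_eq_self_of_cohomology [IsProbabilityMeasure μ] {Δ : Set ℤ} {e : ℤ}
    (hΔ : ∀ k ∈ Δ, k + e ∈ Δ) (hex : ∀ k, ∃ m : ℕ, k + m * e ∈ Δ)
    (hS : ∀ a, MeasurePreserving (coordShift a) μ μ)
    {A A' ζ : (ℤ → Λ) → Matrix (Fin n) (Fin n) ℂ}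
    (hA : ∀ i j, Measurable[cylinderEvents Δ] fun x => A x i j)
    (hA' : ∀ i j, Measurable[cylinderEvents Δ] fun x => A' x i j)
    (hAu : ∀ x, A x ∈ Matrix.unitaryGroup (Fin n) ℂ)
    (hAu' : ∀ x, A' x ∈ Matrix.unitaryGroup (Fin n) ℂ)
    (hint : ∀ i j, Integrable (fun x => ζ x i j) μ)
    (hζ : ∀ᵐ x ∂μ, ζ x = A x * ζ (coordShift e x) * A' x) (i j : Fin n) :
    μ[fun x => ζ x i j | cylinderEvents Δ] =ᵐ[μ] fun x => ζ x i j := by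
  refine condExp_ae_eq_self_of_approx cylinderEvents_le_pi (hint i j) fun ε hε => ?_
  have hev : ∀ᶠ m in atTop, ∀ a b : Fin n, ∃ g : (ℤ → Λ) → ℂ,
      StronglyMeasurable[translateFiltration Δ e hΔ m] g ∧
        eLpNorm ((fun x => ζ x a b) - g) 1 μ ≤ ε / (n * n) :=
    eventually_all.2 fun a => eventually_all.2 fun b =>
      eventually_exists_eLpNorm_sub_le _ (iSup_translateFiltration hΔ hex) (hint a b)
        (ENNReal.div_ne_zero.2 ⟨hε, by finiteness⟩)
  obtain ⟨m, hm⟩ := hev.exists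
  choose g hg hgε using hm
  obtain ⟨V, V', hV, hV', hVu, hVu', h⟩ :=
    exists_iterate_cohomology hΔ hS hA hA' hAu hAu' hζ m
  have hs : Measurable[cylinderEvents Δ, translateFiltration Δ e hΔ m]
      (coordShift (m * e) : (ℤ → Λ) → ℤ → Λ) :=
    measurable_coordShift_cylinderEvents fun k hk => hk
  set G : (ℤ → Λ) → Matrix (Fin n) (Fin n) ℂ := fun x => Matrix.of fun a b => g a b x with hG
  refine ⟨fun x => (V x * G (coordShift (m * e) x) * V' x) i j, ?_, ?_⟩
  · refine Measurable.stronglyMeasurable ?_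
    simp only [Matrix.mul_apply]
    exact Finset.measurable_sum _ fun b _ => (Finset.measurable_sum _ fun a _ =>
      (hV i a).mul ((hg a b).measurable.comp hs)).mul (hV' b j)
  · have hgm (a b : Fin n) : AEStronglyMeasurable ((fun x => ζ x a b) - g a b) μ :=
      (hint a b).1.sub ((hg a b).mono (Filtration.le _ m)).aestronglyMeasurable
    have hgm' (a b : Fin n) : AEMeasurable
        (fun x => ‖((fun x => ζ x a b) - g a b) (coordShift (m * e) x)‖ₑ) μ :=
      ((hgm a b).comp_measurePreserving (hS _)).enorm
    calc eLpNorm ((fun x => ζ x i j) - fun x => (V x * G (coordShift (m * e) x) * V' x) i j) 1 μ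
        ≤ ∫⁻ x, ∑ b, ∑ a, ‖((fun x => ζ x a b) - g a b) (coordShift (m * e) x)‖ₑ ∂μ := by
          rw [eLpNorm_one_eq_lintegral_enorm]
          refine lintegral_mono_ae ?_
          filter_upwards [h] with x hx
          have : ((fun x => ζ x i j) - fun x => (V x * G (coordShift (m * e) x) * V' x) i j) x
              = (V x * (ζ (coordShift (m * e) x) - G (coordShift (m * e) x)) * V' x) i j := by
            rw [Matrix.mul_sub, Matrix.sub_mul, ← hx]
            rfl
          rw [this]
          exact enorm_mul_mul_apply_le (hVu x) (hVu' x) _ i j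
      _ = ∑ b, ∑ a, eLpNorm ((fun x => ζ x a b) - g a b) 1 μ := by
          rw [lintegral_finsetSum' _ fun b _ => Finset.aemeasurable_fun_sum _ fun a _ => hgm' a b]
          refine Finset.sum_congr rfl fun b _ => ?_
          rw [lintegral_finsetSum' _ fun a _ => hgm' a b]
          refine Finset.sum_congr rfl fun a _ => ?_
          rw [← eLpNorm_comp_measurePreserving (hgm a b) (hS (m * e)),
            eLpNorm_one_eq_lintegral_enorm]
          rfl
      _ ≤ ∑ _b : Fin n, ∑ _a : Fin n, ε / (n * n) :=
          Finset.sum_le_sum fun b _ => Finset.sum_le_sum fun a _ => hgε a b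
      _ ≤ ε := by
          simp only [Finset.sum_const, Finset.card_univ, Fintype.card_fin, nsmul_eq_mul]
          rw [← mul_assoc]
          exact ENNReal.mul_div_le

end Shift

section Unitary

variable {n : ℕ} {u v z : Matrix (Fin n) (Fin n) ℂ} {ω : ℂ}

theorem eq_two_of_swap (hn : 2 ≤ n) (hω : IsPrimitiveRoot ω n)
    (hu : u ∈ Matrix.unitaryGroup (Fin n) ℂ) (hv : v ∈ Matrix.unitaryGroup (Fin n) ℂ)
    (hz : z ∈ Matrix.unitaryGroup (Fin n) ℂ) (hvu : v * u = ω • (u * v))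
    (h₁ : z * v = u * z) (h₂ : z * u = v * z) : n = 2 := by
  have : Nonempty (Fin n) := ⟨⟨0, by omega⟩⟩
  have huv : u * v = ω • (v * u) := by
    have h : (u * v) * z = (ω • (v * u)) * z := by
      calc (u * v) * z = z * (v * u) := by
            rw [Matrix.mul_assoc, ← h₂, ← Matrix.mul_assoc, ← h₁, Matrix.mul_assoc]
        _ = ω • (z * (u * v)) := by rw [hvu, Matrix.mul_smul]
        _ = ω • ((v * u) * z) := by
            rw [← Matrix.mul_assoc, h₂, Matrix.mul_assoc, h₁, ← Matrix.mul_assoc]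
        _ = (ω • (v * u)) * z := by rw [Matrix.smul_mul]
    have h' := congrArg (· * star z) h
    simpa only [Matrix.mul_assoc, Matrix.mem_unitaryGroup_iff.1 hz, Matrix.mul_one] using h'
  have h3 : (ω ^ 2) • (u * v) = u * v := by
    conv_rhs => rw [huv, hvu, smul_smul, ← pow_two]
  have h4 : (ω ^ 2) • (1 : Matrix (Fin n) (Fin n) ℂ) = 1 := by
    have h' := congrArg (· * star (u * v)) h3
    simpa only [Matrix.smul_mul, Matrix.mem_unitaryGroup_iff.1 (mul_mem hu hv)] using h'
  have h5 : ω ^ 2 = 1 := by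
    have := congrFun (congrFun h4 ⟨0, by omega⟩) ⟨0, by omega⟩
    simpa using this
  exact le_antisymm (Nat.le_of_dvd two_pos (hω.dvd_of_pow_eq_one 2 h5)) hn

theorem ne_of_commutation (hn : 2 ≤ n) (hω : IsPrimitiveRoot ω n)
    (hu : u ∈ Matrix.unitaryGroup (Fin n) ℂ)
    (hvu : v * u = ω • (u * v)) : u ≠ v := by
  rintro rfl
  have h4 : (1 : Matrix (Fin n) (Fin n) ℂ) = ω • (1 : Matrix (Fin n) (Fin n) ℂ) := by
    have h' := congrArg (· * star (u * u)) hvu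
    simpa only [Matrix.smul_mul, Matrix.mem_unitaryGroup_iff.1 (mul_mem hu hu)] using h'
  have h5 : 1 = ω := by
    have := congrFun (congrFun h4 ⟨0, by omega⟩) ⟨0, by omega⟩
    simpa using this
  exact hω.ne_one (by omega) h5.symm

/-- If a unitary intertwines the assignments of `u` and `v` to two different sets and their
complements, the two sets are complementary. -/
theorem eq_compl_of_intertwining {Λ : Type*} {C C' : Set Λ} [DecidablePred (· ∈ C)]
    [DecidablePred (· ∈ C')] (hz : z ∈ Matrix.unitaryGroup (Fin n) ℂ) (huv : u ≠ v)
    (hCC : C' ≠ C)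
    (h : ∀ l, (if l ∈ C then u else v) * z = z * (if l ∈ C' then u else v)) : C' = Cᶜ := by
  have hR {a b : Matrix (Fin n) (Fin n) ℂ} (hab : a * z = b * z) : a = b := by
    have h' := congrArg (· * star z) hab
    simpa only [Matrix.mul_assoc, Matrix.mem_unitaryGroup_iff.1 hz, Matrix.mul_one] using h'
  have hL {a b : Matrix (Fin n) (Fin n) ℂ} (hab : z * a = z * b) : a = b := by
    have h' := congrArg (star z * ·) hab
    simpa only [← Matrix.mul_assoc, Matrix.mem_unitaryGroup_iff'.1 hz, Matrix.one_mul] using h'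
  obtain ⟨k, hk⟩ : ∃ k, ¬(k ∈ C' ↔ k ∈ C) := by
    by_contra! h
    exact hCC (Set.ext h)
  have hk1 := h k
  ext l
  have hl1 := h l
  rw [Set.mem_compl_iff]
  by_cases h1 : l ∈ C <;> by_cases h2 : l ∈ C' <;> by_cases h3 : k ∈ C <;>
    by_cases h4 : k ∈ C' <;> simp only [h1, h2, h3, h4,
      if_true, if_false, not_true, not_false_eq_true] at hl1 hk1 hk ⊢
  · exact (huv (hL (hl1.symm.trans hk1))).elim
  · exact (huv (hR (hl1.trans hk1.symm))).elim
  · exact (huv (hR (hk1.trans hl1.symm))).elim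
  · exact (huv (hL (hk1.symm.trans hl1))).elim

/-- In the case `n = 2`, the unitary `(u + v) / √2` exchanges `u` and `v`. -/
theorem exists_unitary_swap (hu : u ∈ Matrix.unitaryGroup (Fin n) ℂ)
    (hv : v ∈ Matrix.unitaryGroup (Fin n) ℂ) (hu2 : u ^ 2 = 1) (hv2 : v ^ 2 = 1)
    (hvu : v * u = -(u * v)) :
    ∃ z ∈ Matrix.unitaryGroup (Fin n) ℂ, star u = z * star v * star z ∧
      star v = z * star u * star z := by
  have hus : star u = u := by
    calc star u = star u * (u * u) := by rw [← pow_two, hu2, Matrix.mul_one]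
      _ = u := by rw [← Matrix.mul_assoc, Matrix.mem_unitaryGroup_iff'.1 hu, Matrix.one_mul]
  have hvs : star v = v := by
    calc star v = star v * (v * v) := by rw [← pow_two, hv2, Matrix.mul_one]
      _ = v := by rw [← Matrix.mul_assoc, Matrix.mem_unitaryGroup_iff'.1 hv, Matrix.one_mul]
  rw [pow_two] at hu2 hv2
  set c : ℂ := (((√2)⁻¹ : ℝ) : ℂ) with hc
  have hcc : c * c = 1 / 2 := by
    rw [hc, ← Complex.ofReal_mul, ← mul_inv, Real.mul_self_sqrt (by norm_num)]
    norm_num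
  have hcs : star c = c := Complex.conj_ofReal _
  have hzs : star (c • (u + v)) = c • (u + v) := by rw [star_smul, star_add, hus, hvs, hcs]
  have hhalf (a : Matrix (Fin n) (Fin n) ℂ) : (1 / 2 : ℂ) • (a + a) = a := by
    rw [← two_smul ℂ a, smul_smul]
    norm_num
  have huvu : u * v * u = -v := by
    rw [Matrix.mul_assoc, hvu, Matrix.mul_neg, ← Matrix.mul_assoc, hu2, Matrix.one_mul]
  have hvuv : v * u * v = -u := by
    rw [hvu, Matrix.neg_mul, Matrix.mul_assoc, hv2, Matrix.mul_one]
  refine ⟨c • (u + v), Matrix.mem_unitaryGroup_iff.2 ?_, ?_, ?_⟩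
  · rw [hzs, Matrix.smul_mul, Matrix.mul_smul, smul_smul, hcc]
    simp only [Matrix.add_mul, Matrix.mul_add, hu2, hv2, hvu]
    rw [show 1 + -(u * v) + (u * v + 1) = (1 : Matrix (Fin n) (Fin n) ℂ) + 1 by abel, hhalf]
  · rw [hzs, hus, hvs, Matrix.smul_mul, Matrix.smul_mul, Matrix.mul_smul, smul_smul, hcc]
    simp only [Matrix.add_mul, Matrix.mul_add, hv2, huvu, Matrix.mul_assoc u v v,
      Matrix.mul_one, Matrix.one_mul]
    rw [show -v + u + (u + v) = u + u by abel, hhalf]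
  · rw [hzs, hus, hvs, Matrix.smul_mul, Matrix.smul_mul, Matrix.mul_smul, smul_smul, hcc]
    simp only [Matrix.add_mul, Matrix.mul_add, hu2, hvuv, Matrix.mul_assoc v u u, Matrix.mul_one,
      Matrix.one_mul]
    rw [show u + v + (v + -u) = v + v by abel, hhalf]

end Unitary

/-- Every letter occurs at the origin of some point satisfying a given almost sure property. -/
theorem exists_of_ae {Λ : Type*} [MeasurableSpace Λ] {μ₁ : Measure Λ} {μ : Measure (ℤ → Λ)}
    (hμ₁ : ∀ l : Λ, 0 < μ₁ {l})
    (hμ : ∀ (s : Finset ℤ) (B : ℤ → Set Λ), μ {x | ∀ i ∈ s, x i ∈ B i} = ∏ i ∈ s, μ₁ (B i))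
    {p : (ℤ → Λ) → Prop} (hp : ∀ᵐ x ∂μ, p x) (l : Λ) : ∃ x, x 0 = l ∧ p x := by
  have h := hμ {0} fun _ => {l}
  simp only [Finset.mem_singleton, forall_eq, Set.mem_singleton_iff, Finset.prod_singleton] at h
  have hfr : ∃ᵐ x ∂μ, x 0 = l := by
    rw [frequently_ae_iff, h]
    exact (hμ₁ l).ne'
  exact (hfr.and_eventually hp).exists

/-- For the Bernoulli shift with product measure μ, the cocycles W and W'
built from nonempty proper subsets C₁ ≠ C₁' of Λ are cohomologous via a measurable
a.e.-unitary ζ (i.e. W(x) = ζ(x) W'(x) ζ(σ⁻¹x)* a.e.) if and only if n = 2 and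
C₁' = Λ \ C₁. -/
theorem stmt6
    (Λ : Type*) [Fintype Λ] [MeasurableSpace Λ] [DiscreteMeasurableSpace Λ]
    (hΛ : 1 < Fintype.card Λ)
    (μ₁ : Measure Λ) [IsProbabilityMeasure μ₁] (hμ₁ : ∀ l : Λ, 0 < μ₁ {l})
    (μ : Measure (ℤ → Λ)) [IsProbabilityMeasure μ]
    (hμ : ∀ (s : Finset ℤ) (B : ℤ → Set Λ),
      μ {x | ∀ i ∈ s, x i ∈ B i} = ∏ i ∈ s, μ₁ (B i))
    (n : ℕ) (hn : 2 ≤ n)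
    (ω : ℂ) (hω : ω = Complex.exp (2 * Real.pi * Complex.I / n))
    (u v : Matrix (Fin n) (Fin n) ℂ)
    (hu : u ∈ Matrix.unitaryGroup (Fin n) ℂ)
    (hv : v ∈ Matrix.unitaryGroup (Fin n) ℂ)
    (hun : u ^ n = 1) (hvn : v ^ n = 1)
    (hcomm : v * u * v⁻¹ = ω • u)
    (C₁ : Set Λ) [DecidablePred (· ∈ C₁)] (hC₁ : C₁.Nonempty) (hC₁uni : C₁ ≠ Set.univ)
    (C₁' : Set Λ) [DecidablePred (· ∈ C₁')] (hC₁'ne : C₁'.Nonempty)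
    (hC₁'uni : C₁' ≠ Set.univ) (hCC : C₁' ≠ C₁)
    (W W' : (ℤ → Λ) → Matrix (Fin n) (Fin n) ℂ)
    (hW : ∀ x : ℤ → Λ, W x = if x 0 ∈ C₁ then star u else star v)
    (hW' : ∀ x : ℤ → Λ, W' x = if x 0 ∈ C₁' then star u else star v) :
    (∃ ζ : (ℤ → Λ) → Matrix (Fin n) (Fin n) ℂ,
      (∀ i j : Fin n, Measurable fun x => ζ x i j) ∧
      (∀ᵐ x ∂μ, ζ x ∈ Matrix.unitaryGroup (Fin n) ℂ) ∧
      (∀ᵐ x ∂μ, W x = ζ x * W' x * star (ζ (fun k => x (k + 1))))) ↔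
    (n = 2 ∧ C₁' = C₁ᶜ) := by
  have hprim : IsPrimitiveRoot ω n := by
    rw [hω]
    exact Complex.isPrimitiveRoot_exp n (by omega)
  have hvv : v⁻¹ * v = 1 := Matrix.nonsing_inv_mul _
    ((Matrix.isUnit_iff_isUnit_det v).1 (Unitary.toUnits ⟨v, hv⟩).isUnit)
  have hvu : v * u = ω • (u * v) := by
    rw [← Matrix.smul_mul, ← hcomm, Matrix.mul_assoc, hvv, Matrix.mul_one]
  have hsu : star u ∈ Matrix.unitaryGroup (Fin n) ℂ := Unitary.star_mem hu
  have hsv : star v ∈ Matrix.unitaryGroup (Fin n) ℂ := Unitary.star_mem hv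
  constructor
  · rintro ⟨ζ, hζm, hζu, hζ⟩
    have hS := measurePreserving_coordShift hμ
    have hWu (x : ℤ → Λ) : W x ∈ Matrix.unitaryGroup (Fin n) ℂ := by
      rw [hW]; split_ifs <;> assumption
    have hWu' (x : ℤ → Λ) : W' x ∈ Matrix.unitaryGroup (Fin n) ℂ := by
      rw [hW']; split_ifs <;> assumption
    have hWm (Δ : Set ℤ) (a : ℤ) (ha : a ∈ Δ) (F : Λ → ℂ) :
        Measurable[cylinderEvents Δ] fun x : ℤ → Λ => F (x a) :=
      (measurable_of_finite F).comp (measurable_cylinderEvent_apply ha)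
    have hint (i j : Fin n) : Integrable (fun x => ζ x i j) μ := by
      refine Integrable.of_bound (hζm i j).aestronglyMeasurable 1 ?_
      filter_upwards [hζu] with x hx
      exact entry_norm_bound_of_unitary hx i j
    have hfwd : ∀ᵐ x ∂μ, ζ x = W x * ζ (coordShift 1 x) * star (W' x) := by
      filter_upwards [hζ, (hS 1).quasiMeasurePreserving.ae hζu] with x hx hxu
      rw [hx]
      change ζ x = ζ x * W' x * star (ζ (coordShift 1 x)) * ζ (coordShift 1 x) * star (W' x)
      rw [Matrix.mul_assoc (ζ x * W' x), Matrix.mem_unitaryGroup_iff'.1 hxu, Matrix.mul_one,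
        Matrix.mul_assoc, Matrix.mem_unitaryGroup_iff.1 (hWu' x), Matrix.mul_one]
    have hbwd : ∀ᵐ x ∂μ, ζ x =
        star (W (coordShift (-1) x)) * ζ (coordShift (-1) x) * W' (coordShift (-1) x) := by
      filter_upwards [(hS (-1)).quasiMeasurePreserving.ae hfwd] with x hx
      rw [hx, coordShift_coordShift, add_neg_cancel, coordShift_zero]
      simp only [Matrix.mul_assoc]
      rw [Matrix.mem_unitaryGroup_iff'.1 (hWu' _), Matrix.mul_one, ← Matrix.mul_assoc,
        Matrix.mem_unitaryGroup_iff'.1 (hWu _), Matrix.one_mul]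
    have hconst (i j : Fin n) : ∃ c : ℂ, (fun x => ζ x i j) =ᵐ[μ] fun _ => c := by
      refine ae_eq_const_of_condExp_indep cylinderEvents_le_pi cylinderEvents_le_pi
        (indep_cylinderEvents_compl hμ {k | 0 ≤ k}) ?_ ?_
      · refine condExp_ae_eq_self_of_cohomology (e := 1) ?_ ?_ hS ?_ ?_ hWu
          (fun x => Unitary.star_mem (hWu' x)) hint hfwd i j
        · intro k hk
          simp only [Set.mem_ofPred_eq] at *
          omega
        · intro k
          refine ⟨k.natAbs, ?_⟩
          simp only [Set.mem_ofPred_eq]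
          omega
        · intro a b
          simp only [hW]
          exact hWm _ 0 (by simp) fun l => (if l ∈ C₁ then star u else star v) a b
        · intro a b
          simp only [hW']
          exact hWm _ 0 (by simp) fun l => star (if l ∈ C₁' then star u else star v) a b
      · refine condExp_ae_eq_self_of_cohomology (e := -1) ?_ ?_ hS ?_ ?_
          (fun x => Unitary.star_mem (hWu _)) (fun x => hWu' _) hint hbwd i j
        · intro k hk
          simp only [Set.mem_compl_iff, Set.mem_ofPred_eq] at *
          omega
        · intro k
          refine ⟨k.natAbs + 1, ?_⟩
          simp only [Set.mem_compl_iff, Set.mem_ofPred_eq]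
          omega
        · intro a b
          simp only [hW, coordShift]
          exact hWm _ (0 + -1) (by simp) fun l => star (if l ∈ C₁ then star u else star v) a b
        · intro a b
          simp only [hW', coordShift]
          exact hWm _ (0 + -1) (by simp) fun l => (if l ∈ C₁' then star u else star v) a b
    choose c hc using hconst
    set z : Matrix (Fin n) (Fin n) ℂ := Matrix.of c with hz_def
    have hz : ∀ᵐ x ∂μ, ζ x = z := by
      have : ∀ᵐ x ∂μ, ∀ i j, ζ x i j = c i j := ae_all_iff.2 fun i => ae_all_iff.2 fun j => hc i j
      filter_upwards [this] with x hx
      ext i j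
      exact hx i j
    have hzu : z ∈ Matrix.unitaryGroup (Fin n) ℂ := by
      obtain ⟨x, hx, hx'⟩ := (hz.and hζu).exists
      exact hx ▸ hx'
    have hl (l : Λ) : (if l ∈ C₁ then u else v) * z = z * (if l ∈ C₁' then u else v) := by
      obtain ⟨x, rfl, hx, hxz, hxz'⟩ := exists_of_ae hμ₁ hμ
        (hζ.and (hz.and ((hS 1).quasiMeasurePreserving.ae hz))) l
      change W x = ζ x * W' x * star (ζ (coordShift 1 x)) at hx
      rw [hxz, hxz', hW, hW'] at hx
      have h := congrArg star hx
      rw [star_mul, star_mul, star_star, apply_ite star, apply_ite star, star_star, star_star] at h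
      rw [h, Matrix.mul_assoc, Matrix.mul_assoc, Matrix.mem_unitaryGroup_iff'.1 hzu,
        Matrix.mul_one]
    have hcompl := eq_compl_of_intertwining hzu (ne_of_commutation hn hprim hu hvu) hCC hl
    refine ⟨?_, hcompl⟩
    obtain ⟨p, hp⟩ := hC₁
    obtain ⟨q, hq⟩ := hC₁'ne
    have hp1 := hl p
    have hq1 := hl q
    have hp' : p ∉ C₁' := fun h => (hcompl ▸ h : p ∈ C₁ᶜ) hp
    have hq' : q ∉ C₁ := (hcompl ▸ hq : q ∈ C₁ᶜ)
    rw [if_pos hp, if_neg hp'] at hp1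
    rw [if_neg hq', if_pos hq] at hq1
    exact eq_two_of_swap hn hprim hu hv hzu hvu hp1.symm hq1.symm
  · rintro ⟨rfl, rfl⟩
    have hω1 : ω = -1 := hprim.eq_neg_one_of_two_right
    obtain ⟨z, hz, h₁, h₂⟩ := exists_unitary_swap hu hv hun hvn (by rw [hvu, hω1, neg_one_smul])
    refine ⟨fun _ => z, fun _ _ => measurable_const, ae_of_all _ fun _ => hz,
      ae_of_all _ fun x => ?_⟩
    rw [hW, hW']
    by_cases h : x 0 ∈ C₁ <;>
      simp only [Set.mem_compl_iff, h, not_true, not_false_eq_true, if_true, if_false]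
    · exact h₁
    · exact h₂
end

section
/- Let C be the image in 𝕋 of the interval [0, θ). For m a positive integer and x ∈ 𝕋, let c'(x,m) = #{i : 0 ≤ i < m, x − iθ ∈ C}, and let [mθ] denote the largest integer ≤ mθ. Then μ({x ∈ 𝕋 : c'(x,m) = [mθ]}) = [mθ] + 1 − mθ and μ({x ∈ 𝕋 : c'(x,m) = [mθ] + 1}) = mθ − [mθ]. -/
open MeasureTheory

/-- The representative in `[0, 1)` of a point of the circle transports Haar measure to
Lebesgue measure on `[0, 1)`. -/
theorem UnitAddCircle.volume_preimage_equivIco {S : Set ℝ} (hS : MeasurableSet S) :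
    volume ((fun x : UnitAddCircle => (AddCircle.equivIco 1 0 x : ℝ)) ⁻¹' S) =
      volume (S ∩ Set.Ico 0 1) := by
  have hg : Measurable (fun x : UnitAddCircle => (AddCircle.equivIco 1 0 x : ℝ)) :=
    measurable_subtype_coe.comp (AddCircle.measurableEquivIco 1 0).measurable
  have hpres := UnitAddCircle.measurePreserving_mk 0
  rw [← hpres.measure_preimage (hg hS).nullMeasurableSet,
    ← Measure.restrict_congr_set Ico_ae_eq_Ioc,
    show Set.Ico (0 : ℝ) 1 = Set.Ico 0 (0 + 1) by rw [zero_add],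
    Measure.restrict_apply (hpres.measurable (hg hS))]
  congr 1
  ext t
  simp only [Set.mem_inter_iff, Set.mem_preimage, and_congr_left_iff]
  intro ht
  rw [AddCircle.equivIco_coe_of_mem (p := (1 : ℝ)) (a := 0) ht]

theorem UnitAddCircle.coe_mem_image_Ico_iff {θ : ℝ} (hθ : θ ≤ 1) (s : ℝ) :
    (s : UnitAddCircle) ∈ (fun t : ℝ => (t : UnitAddCircle)) '' Set.Ico 0 θ ↔
      Int.fract s < θ := by
  have hfract : ((Int.fract s : ℝ) : UnitAddCircle) = s := by
    rw [Int.fract, AddCircle.coe_sub, sub_eq_self]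
    exact AddCircle.coe_eq_zero_iff (1 : ℝ) |>.2 ⟨⌊s⌋, by simp⟩
  constructor
  · rintro ⟨t, ht, h⟩
    have : t = Int.fract s := by
      refine (AddCircle.coe_eq_coe_iff_of_mem_Ico (p := (1 : ℝ)) (a := 0) ?_ ?_).1
        (h.trans hfract.symm)
      · exact ⟨ht.1, by linarith [ht.2]⟩
      · exact ⟨Int.fract_nonneg s, by simpa using Int.fract_lt_one s⟩
    exact this ▸ ht.2
  · exact fun h => ⟨Int.fract s, ⟨Int.fract_nonneg s, h⟩, hfract⟩

theorem Int.floor_sub_floor_sub_eq_ite {θ : ℝ} (h0 : 0 ≤ θ) (h1 : θ ≤ 1) (s : ℝ) :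
    ⌊s⌋ - ⌊s - θ⌋ = if Int.fract s < θ then 1 else 0 := by
  have hs := Int.floor_add_fract s
  have hs0 := Int.fract_nonneg s
  have hs1 := Int.fract_lt_one s
  split_ifs with h
  · have : ⌊s - θ⌋ = ⌊s⌋ - 1 := by
      rw [Int.floor_eq_iff]
      push_cast
      constructor <;> linarith
    omega
  · have : ⌊s - θ⌋ = ⌊s⌋ := by
      rw [Int.floor_eq_iff]
      constructor <;> linarith
    omega

/-- The number of visits to `[0, θ)` of the backward orbit of `t` under rotation by `θ`. -/
theorem UnitAddCircle.ncard_rotation_visits {θ : ℝ} (h0 : 0 ≤ θ) (h1 : θ ≤ 1) (t : ℝ) (m : ℕ) :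
    ({i : ℕ | i < m ∧ (t : UnitAddCircle) - (((i : ℝ) * θ : ℝ) : UnitAddCircle) ∈
      (fun t : ℝ => (t : UnitAddCircle)) '' Set.Ico 0 θ}.ncard : ℤ) = ⌊t⌋ - ⌊t - m * θ⌋ := by
  have hset : {i : ℕ | i < m ∧ (t : UnitAddCircle) - (((i : ℝ) * θ : ℝ) : UnitAddCircle) ∈
      (fun t : ℝ => (t : UnitAddCircle)) '' Set.Ico 0 θ} =
      ((Finset.range m).filter fun i : ℕ => Int.fract (t - i * θ) < θ : Finset ℕ) := by
    ext i
    simp only [Set.mem_ofPred_eq, ← AddCircle.coe_sub, UnitAddCircle.coe_mem_image_Ico_iff h1,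
      Finset.coe_filter, Finset.mem_range]
  rw [hset, Set.ncard_coe_finset, Finset.natCast_card_filter]
  have hsum := Finset.sum_range_sub' (fun i : ℕ => ⌊t - i * θ⌋) m
  simp only [Nat.cast_zero, zero_mul, sub_zero] at hsum
  rw [← hsum]
  refine Finset.sum_congr rfl fun i _ => ?_
  rw [← Int.floor_sub_floor_sub_eq_ite h0 h1]
  congr 2
  push_cast
  ring

/-- For the rotation by an irrational θ ∈ (0,1/2) on 𝕋 = ℝ/ℤ and
C = [0,θ) ⊂ 𝕋, the number c'(x,m) of 0 ≤ i < m with x − iθ ∈ C equals ⌊mθ⌋ on a set of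
Haar measure ⌊mθ⌋+1−mθ and equals ⌊mθ⌋+1 on a set of measure mθ−⌊mθ⌋. -/
theorem stmt9
    (θ : ℝ) (hθirr : Irrational θ) (hθmem : θ ∈ Set.Ioo (0 : ℝ) (1 / 2))
    (C : Set UnitAddCircle) (hC : C = (fun t : ℝ => (t : UnitAddCircle)) '' Set.Ico 0 θ)
    (c' : UnitAddCircle → ℕ → ℕ)
    (hc' : ∀ (x : UnitAddCircle) (m : ℕ),
      c' x m = {i : ℕ | i < m ∧ x - (((i : ℝ) * θ : ℝ) : UnitAddCircle) ∈ C}.ncard)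
    (m : ℕ) (hm : 0 < m) :
    volume {x : UnitAddCircle | (c' x m : ℤ) = ⌊(m : ℝ) * θ⌋} =
      ENNReal.ofReal ((⌊(m : ℝ) * θ⌋ : ℝ) + 1 - (m : ℝ) * θ) ∧
    volume {x : UnitAddCircle | (c' x m : ℤ) = ⌊(m : ℝ) * θ⌋ + 1} =
      ENNReal.ofReal ((m : ℝ) * θ - (⌊(m : ℝ) * θ⌋ : ℝ)) := by
  have key (x : UnitAddCircle) :
      (c' x m : ℤ) = ⌊(m : ℝ) * θ⌋ +
        if (AddCircle.equivIco 1 0 x : ℝ) < Int.fract ((m : ℝ) * θ) then 1 else 0 := by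
    obtain ⟨ht0, ht1⟩ := (AddCircle.equivIco (1 : ℝ) 0 x).2
    have hx : ((AddCircle.equivIco (1 : ℝ) 0 x : ℝ) : UnitAddCircle) = x :=
      AddCircle.coe_equivIco
    set t : ℝ := (AddCircle.equivIco (1 : ℝ) 0 x : ℝ)
    rw [zero_add] at ht1
    rw [hc', hC, ← hx, UnitAddCircle.ncard_rotation_visits hθmem.1.le (by linarith [hθmem.2]),
      Int.floor_eq_zero_iff.2 ⟨ht0, ht1⟩]
    have hf := Int.floor_add_fract ((m : ℝ) * θ)
    have hf0 := Int.fract_nonneg ((m : ℝ) * θ)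
    have hf1 := Int.fract_lt_one ((m : ℝ) * θ)
    split_ifs with h
    · have : ⌊t - m * θ⌋ = -⌊(m : ℝ) * θ⌋ - 1 := by
        rw [Int.floor_eq_iff]
        push_cast
        constructor <;> linarith
      omega
    · have : ⌊t - m * θ⌋ = -⌊(m : ℝ) * θ⌋ := by
        rw [Int.floor_eq_iff]
        push_cast
        constructor <;> linarith
      omega
  have hf0 := Int.fract_nonneg ((m : ℝ) * θ)
  have hf1 := Int.fract_lt_one ((m : ℝ) * θ)
  constructor
  · have hset : {x : UnitAddCircle | (c' x m : ℤ) = ⌊(m : ℝ) * θ⌋} =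
        (fun x : UnitAddCircle => (AddCircle.equivIco 1 0 x : ℝ)) ⁻¹'
          Set.Ici (Int.fract ((m : ℝ) * θ)) := by
      ext x
      simp [key x]
    have hinter : Set.Ici (Int.fract ((m : ℝ) * θ)) ∩ Set.Ico 0 1 =
        Set.Ico (Int.fract ((m : ℝ) * θ)) 1 := by
      ext t
      exact ⟨fun h => ⟨h.1, h.2.2⟩, fun h => ⟨h.1, hf0.trans h.1, h.2⟩⟩
    rw [hset, UnitAddCircle.volume_preimage_equivIco measurableSet_Ici, hinter,
      Real.volume_Ico, Int.fract]
    congr 1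
    ring
  · have hset : {x : UnitAddCircle | (c' x m : ℤ) = ⌊(m : ℝ) * θ⌋ + 1} =
        (fun x : UnitAddCircle => (AddCircle.equivIco 1 0 x : ℝ)) ⁻¹'
          Set.Iio (Int.fract ((m : ℝ) * θ)) := by
      ext x
      simp [key x]
    rw [hset, UnitAddCircle.volume_preimage_equivIco measurableSet_Iio, Set.inter_comm,
      Set.Ico_inter_Iio, min_eq_right hf1.le, Real.volume_Ico, Int.fract, sub_zero]
end

section
/- Let θ ∈ (0,1/2) be irrational and η ∈ ℝ. Suppose that for every sequence (q_k) of integers, if q_kθ converges to 0 in 𝕋 = ℝ/ℤ then q_kη converges to 0 in 𝕋. Then there exists m ∈ ℤ such that η − mθ ∈ ℤ, i.e., η = mθ in 𝕋. -/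
open Filter Topology

/-- If every integer sequence driving the multiples of `a` to zero also drives the multiples of `b`
to zero, then `n • a ↦ n • b` satisfies an `ε`-`δ` estimate at zero. -/
lemma exists_delta_of_forall_tendsto_zsmul {G H : Type*} [SeminormedAddCommGroup G]
    [SeminormedAddCommGroup H] {a : G} {b : H}
    (h : ∀ q : ℕ → ℤ, Tendsto (fun k => q k • a) atTop (𝓝 0) →
      Tendsto (fun k => q k • b) atTop (𝓝 0)) {ε : ℝ} (hε : 0 < ε) :
    ∃ δ > 0, ∀ n : ℤ, ‖n • a‖ < δ → ‖n • b‖ < ε := by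
  by_contra! hc
  choose q hq hqε using fun k : ℕ => hc (1 / ((k : ℝ) + 1)) Nat.one_div_pos_of_nat
  have hb : Tendsto (fun k => ‖q k • b‖) atTop (𝓝 0) := by
    refine tendsto_zero_iff_norm_tendsto_zero.1 (h q ?_)
    exact squeeze_zero_norm (fun k => (hq k).le) tendsto_one_div_add_atTop_nhds_zero_nat
  exact hε.not_ge (ge_of_tendsto' hb hqε)

/-- If the multiples of `a` are dense and `n • a ↦ n • b` is sequentially continuous at zero, then
there is a continuous map conjugating the translation by `a` to the translation by `b`. -/
lemma exists_continuous_map_add_eq {G H : Type*} [NormedAddCommGroup G]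
    [NormedAddCommGroup H] [CompleteSpace H] {a : G} {b : H}
    (ha : DenseRange (fun n : ℤ => n • a))
    (h : ∀ q : ℕ → ℤ, Tendsto (fun k => q k • a) atTop (𝓝 0) →
      Tendsto (fun k => q k • b) atTop (𝓝 0)) :
    ∃ F : G → H, Continuous F ∧ ∀ x, F (x + a) = F x + b := by
  have hrange (x : Set.range fun n : ℤ => n • a) : ∃ n : ℤ, n • a = x := x.2
  choose q hq using hrange
  have hf : UniformContinuous fun x => q x • b := by
    rw [Metric.uniformContinuous_iff]
    intro ε hε
    obtain ⟨δ, hδ, hδε⟩ := exists_delta_of_forall_tendsto_zsmul h hε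
    refine ⟨δ, hδ, fun {x y} hxy => ?_⟩
    rw [dist_eq_norm, ← sub_smul]
    apply hδε
    rwa [sub_smul, hq x, hq y, ← dist_eq_norm]
  have hq_zsmul (n : ℤ) : q ⟨n • a, Set.mem_range_self n⟩ • b = n • b := by
    rw [← sub_eq_zero, ← sub_smul]
    have hconst := h (fun _ => q ⟨n • a, Set.mem_range_self n⟩ - n) (by
      simp only [sub_smul, hq, sub_self, tendsto_const_nhds])
    exact tendsto_const_nhds_iff.1 hconst
  have hF : Continuous (Dense.extend ha fun x => q x • b) :=
    (Dense.uniformContinuous_extend ha hf).continuous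
  have hF_zsmul (n : ℤ) : Dense.extend ha (fun x => q x • b) (n • a) = n • b :=
    (Dense.extend_of_ind ha hf ⟨n • a, Set.mem_range_self n⟩).trans (hq_zsmul n)
  refine ⟨_, hF, fun x => ha.induction_on x
    (isClosed_eq (hF.comp (continuous_add_const a)) (hF.add continuous_const)) fun n => ?_⟩
  simp only [← add_one_zsmul, hF_zsmul]

/-- A nonzero continuous function on the circle which is multiplied by `c` under the translation by
`a` forces `c` to be the value at `a` of a Fourier monomial. -/
lemma exists_fourier_eq_of_map_add_eq_mul {T : ℝ} [Fact (0 < T)] {f : C(AddCircle T, ℂ)}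
    (hf : f ≠ 0) {a : AddCircle T} {c : ℂ} (hfa : ∀ x, f (x + a) = f x * c) :
    ∃ n : ℤ, fourier n a = c := by
  by_contra! hc
  have hcoeff (n : ℤ) : fourierCoeff f n = 0 := by
    have htrans : fourierCoeff f n = fourier (-n) a * c * fourierCoeff f n := by
      unfold fourierCoeff
      rw [← MeasureTheory.integral_const_mul, ← MeasureTheory.integral_add_right_eq_self _ a]
      refine MeasureTheory.integral_congr_ae (.of_forall fun t => ?_)
      simp only [hfa, fourier_apply, zsmul_add, AddCircle.toCircle_add, Circle.coe_mul, smul_eq_mul]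
      ring
    by_contra h0
    have hone : fourier (-n) a * c = 1 := (mul_eq_right₀ h0).1 htrans.symm
    refine hc n ?_
    calc fourier n a = fourier n a * (fourier (-n) a * c) := by rw [hone, mul_one]
      _ = c := by rw [← mul_assoc, ← fourier_add, add_neg_cancel, fourier_zero, one_mul]
  have hzero : fourierCoeff f = 0 := funext hcoeff
  refine hf (ContinuousMap.ext fun x => ?_)
  have hsum := has_pointwise_sum_fourier_series_of_summable (f := f) (hzero ▸ summable_zero) x
  simp only [hcoeff, zero_smul] at hsum
  exact hsum.unique hasSum_zero

/-- If θ ∈ (0,1/2) is irrational and η ∈ ℝ is such that for every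
integer sequence (q_k), q_kθ → 0 in 𝕋 = ℝ/ℤ implies q_kη → 0 in 𝕋, then η = mθ mod ℤ
for some integer m. -/
theorem stmt11
    (θ : ℝ) (hθirr : Irrational θ) (hθmem : θ ∈ Set.Ioo (0 : ℝ) (1 / 2))
    (η : ℝ)
    (h : ∀ q : ℕ → ℤ,
      Tendsto (fun k => (((q k : ℝ) * θ : ℝ) : UnitAddCircle)) atTop (𝓝 0) →
      Tendsto (fun k => (((q k : ℝ) * η : ℝ) : UnitAddCircle)) atTop (𝓝 0)) :
    ∃ m k : ℤ, η - (m : ℝ) * θ = (k : ℝ) := by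
  have hdense : DenseRange fun n : ℤ => n • (θ : UnitAddCircle) :=
    AddCircle.denseRange_zsmul_coe_iff.2 (by rwa [div_one])
  simp only [← zsmul_eq_mul, AddCircle.coe_zsmul] at h
  obtain ⟨F, hF, hFθ⟩ := exists_continuous_map_add_eq (G := UnitAddCircle) (H := UnitAddCircle) hdense h
  let f : C(UnitAddCircle, ℂ) :=
    ⟨fun x => AddCircle.toCircle (F x), continuous_subtype_val.comp (AddCircle.continuous_toCircle.comp hF)⟩
  have hf : f ≠ 0 := fun h0 => Circle.coe_ne_zero (AddCircle.toCircle (F 0)) (DFunLike.congr_fun h0 0)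
  obtain ⟨m, hm⟩ := exists_fourier_eq_of_map_add_eq_mul hf (a := (θ : UnitAddCircle))
    (c := AddCircle.toCircle (η : UnitAddCircle)) fun x => by
      simp [f, hFθ, AddCircle.toCircle_add]
  have hmη : m • (θ : UnitAddCircle) = η :=
    AddCircle.injective_toCircle one_ne_zero (Circle.ext hm)
  have hη : ((η - m * θ : ℝ) : UnitAddCircle) = 0 := by
    rw [AddCircle.coe_sub, ← zsmul_eq_mul, AddCircle.coe_zsmul, hmη, sub_self]
  obtain ⟨k, hk⟩ := (AddCircle.coe_eq_zero_iff 1).1 hη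
  exact ⟨m, k, by rw [← hk, zsmul_one]⟩
end

section
/- Let λ : ℕ → {−1,0,1} and set t = Σ_{i≥1} λ_i⟨m_iθ⟩ (the series converges absolutely). Then |t| < 1/2, and the sequence (λ_i) is uniquely determined by t: if λ' : ℕ → {−1,0,1} also satisfies t = Σ_{i≥1} λ'_i⟨m_iθ⟩, then λ'_i = λ_i for all i. -/
/-- A sequence whose terms shrink by a factor of at least `3` is dominated by a geometric one. -/
lemma abs_le_geometric_of_abs_succ_lt {a : ℕ → ℝ} (ha : ∀ i, |a (i + 1)| < |a i| / 3) (i : ℕ) :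
    |a i| ≤ |a 0| * (1 / 3) ^ i := by
  induction i with
  | zero => simp
  | succ n ih =>
    rw [pow_succ]
    linarith [ha n]

lemma summable_abs_mul_of_abs_succ_lt {a c : ℕ → ℝ} {K : ℝ}
    (ha : ∀ i, |a (i + 1)| < |a i| / 3) (hc : ∀ i, |c i| ≤ K) :
    Summable fun i => |c i * a i| := by
  have hgeom : Summable fun i : ℕ => K * (|a 0| * (1 / 3 : ℝ) ^ i) :=
    ((summable_geometric_of_lt_one (by norm_num) (by norm_num)).mul_left _).mul_left _
  refine hgeom.of_nonneg_of_le (fun i => abs_nonneg _) fun i => ?_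
  rw [abs_mul]
  exact mul_le_mul (hc i) (abs_le_geometric_of_abs_succ_lt ha i) (abs_nonneg _)
    ((abs_nonneg _).trans (hc i))

lemma abs_tsum_mul_le_of_abs_succ_lt {a c : ℕ → ℝ} {K : ℝ}
    (ha : ∀ i, |a (i + 1)| < |a i| / 3) (hc : ∀ i, |c i| ≤ K) :
    |∑' i, c i * a i| ≤ K * (|a 0| * (3 / 2)) := by
  have hgeom : HasSum (fun i : ℕ => K * (|a 0| * (1 / 3 : ℝ) ^ i)) (K * (|a 0| * (3 / 2))) := by
    have h := hasSum_geometric_of_lt_one (r := (1 / 3 : ℝ)) (by norm_num) (by norm_num)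
    rw [show (1 - 1 / 3 : ℝ)⁻¹ = 3 / 2 by norm_num] at h
    exact (h.mul_left _).mul_left _
  rw [← Real.norm_eq_abs (∑' _, _)]
  refine tsum_of_norm_bounded hgeom fun i => ?_
  rw [Real.norm_eq_abs, abs_mul]
  exact mul_le_mul (hc i) (abs_le_geometric_of_abs_succ_lt ha i) (abs_nonneg _)
    ((abs_nonneg _).trans (hc i))

/-- Integer coefficients of absolute value at most `2` in a vanishing series are all zero. -/
lemma eq_zero_of_tsum_mul_eq_zero {a : ℕ → ℝ} (ha : ∀ i, |a (i + 1)| < |a i| / 3)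
    {d : ℕ → ℤ} (hd : ∀ i, |(d i : ℝ)| ≤ 2) (hsum : ∑' i, (d i : ℝ) * a i = 0) (n : ℕ) :
    d n = 0 := by
  induction n using Nat.strong_induction_on with
  | _ n ih =>
    by_contra hne
    have hsplit := (summable_abs_mul_of_abs_succ_lt ha hd).of_abs.sum_add_tsum_nat_add (n + 1)
    have hhead : ∑ i ∈ Finset.range n, (d i : ℝ) * a i = 0 :=
      Finset.sum_eq_zero fun i hi => by simp [ih i (Finset.mem_range.mp hi)]
    rw [hsum, Finset.sum_range_succ, hhead, zero_add] at hsplit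
    have htail := abs_tsum_mul_le_of_abs_succ_lt (a := fun i => a (i + (n + 1)))
      (c := fun i => (d (i + (n + 1)) : ℝ)) (K := 2)
      (fun i => by simpa only [Nat.add_right_comm] using ha (i + (n + 1)))
      (fun i => hd _)
    rw [← abs_neg, ← eq_neg_of_add_eq_zero_left hsplit, abs_mul, zero_add] at htail
    have hone : (1 : ℝ) ≤ |(d n : ℝ)| := by exact_mod_cast Int.one_le_abs hne
    linarith [ha n, mul_le_mul_of_nonneg_right hone (abs_nonneg (a n))]

/-- With ⟨x⟩ the representative of x + ℤ in (−1/2,1/2] and a rapidly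
decreasing sequence |⟨m_iθ⟩| (each less than a third of the previous, the first < 1/3),
any series t = Σ λ_i⟨m_iθ⟩ with λ_i ∈ {−1,0,1} converges absolutely, satisfies
|t| < 1/2, and the coefficients (λ_i) are uniquely determined by t. -/
theorem stmt14
    (θ : ℝ) (hθirr : Irrational θ) (hθmem : θ ∈ Set.Ioo (0 : ℝ) 1)
    (e : ℝ → ℝ)
    (he : ∀ x : ℝ, e x ∈ Set.Ioc (-(1 / 2) : ℝ) (1 / 2) ∧ ∃ k : ℤ, x - e x = k)
    (m : ℕ → ℕ) (hmono : StrictMono m) (hpos : ∀ i, 0 < m i)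
    (hm0 : |e ((m 0 : ℝ) * θ)| < 1 / 3)
    (hmdec : ∀ i : ℕ, |e ((m (i + 1) : ℝ) * θ)| < |e ((m i : ℝ) * θ)| / 3)
    (lam : ℕ → ℤ) (hlam : ∀ i, lam i = -1 ∨ lam i = 0 ∨ lam i = 1) :
    Summable (fun i => |(lam i : ℝ) * e ((m i : ℝ) * θ)|) ∧
    |∑' i : ℕ, (lam i : ℝ) * e ((m i : ℝ) * θ)| < 1 / 2 ∧
    (∀ lam' : ℕ → ℤ, (∀ i, lam' i = -1 ∨ lam' i = 0 ∨ lam' i = 1) →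
      (∑' i : ℕ, (lam' i : ℝ) * e ((m i : ℝ) * θ)) =
        (∑' i : ℕ, (lam i : ℝ) * e ((m i : ℝ) * θ)) →
      lam' = lam) := by
  have habs : ∀ l : ℕ → ℤ, (∀ i, l i = -1 ∨ l i = 0 ∨ l i = 1) → ∀ i, |(l i : ℝ)| ≤ 1 := by
    intro l hl i
    rcases hl i with h | h | h <;> simp [h]
  have hsummable := fun l hl => summable_abs_mul_of_abs_succ_lt
    (a := fun i => e ((m i : ℝ) * θ)) hmdec (habs l hl)
  refine ⟨hsummable lam hlam, ?_, fun lam' hlam' heq => ?_⟩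
  · have h := abs_tsum_mul_le_of_abs_succ_lt
      (a := fun i => e ((m i : ℝ) * θ)) hmdec (habs lam hlam)
    linarith
  · funext n
    refine sub_eq_zero.mp (eq_zero_of_tsum_mul_eq_zero (a := fun i => e ((m i : ℝ) * θ)) hmdec
      (d := fun i => lam' i - lam i) (fun i => ?_) ?_ n)
    · push_cast
      linarith [abs_sub (lam' i : ℝ) (lam i), habs lam hlam i, habs lam' hlam' i]
    · simp only [Int.cast_sub, sub_mul]
      rw [(hsummable lam' hlam').of_abs.tsum_sub (hsummable lam hlam).of_abs, heq, sub_self]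
end

section
/- The map Φ is continuous and injective, and its image Φ(P) is a compact subset of 𝕋 of Haar (Lebesgue) measure zero. -/
open MeasureTheory

lemma abs_le_geometric_of_abs_succ_le {a : ℕ → ℝ} (h : ∀ i, |a (i + 1)| ≤ |a i| / 3) (n : ℕ) :
    |a n| ≤ |a 0| * (1 / 3) ^ n := by
  induction n with
  | zero => simp
  | succ k ih =>
    calc |a (k + 1)| ≤ |a k| / 3 := h k
      _ ≤ (|a 0| * (1 / 3) ^ k) / 3 := by gcongr
      _ = |a 0| * (1 / 3) ^ (k + 1) := by ring

lemma norm_mul_le_geometric {a c : ℕ → ℝ} (h : ∀ i, |a (i + 1)| ≤ |a i| / 3)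
    (hc : ∀ i, |c i| ≤ 1) (n : ℕ) : ‖c n * a n‖ ≤ |a 0| * (1 / 3) ^ n := by
  rw [Real.norm_eq_abs, abs_mul]
  calc |c n| * |a n| ≤ 1 * |a n| := by gcongr; exact hc n
    _ ≤ _ := by rw [one_mul]; exact abs_le_geometric_of_abs_succ_le h n

lemma hasSum_geometric_third (r : ℝ) : HasSum (fun n : ℕ => r * (1 / 3) ^ n) (3 / 2 * r) := by
  have := (hasSum_geometric_of_lt_one (r := (1 / 3 : ℝ)) (by norm_num) (by norm_num)).mul_left r
  rwa [show r * (1 - 1 / 3)⁻¹ = 3 / 2 * r by ring] at this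

lemma summable_mul_of_abs_le_one {a c : ℕ → ℝ} (h : ∀ i, |a (i + 1)| ≤ |a i| / 3)
    (hc : ∀ i, |c i| ≤ 1) : Summable fun i => c i * a i :=
  .of_norm_bounded (hasSum_geometric_third |a 0|).summable (norm_mul_le_geometric h hc)

lemma abs_tsum_mul_le {a c : ℕ → ℝ} (h : ∀ i, |a (i + 1)| ≤ |a i| / 3)
    (hc : ∀ i, |c i| ≤ 1) : |∑' i, c i * a i| ≤ 3 / 2 * |a 0| :=
  tsum_of_norm_bounded (hasSum_geometric_third |a 0|) (norm_mul_le_geometric h hc)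

/-- A signed sum of a sequence decaying faster than `3⁻ⁿ` does not vanish. -/
lemma tsum_mul_ne_zero {a c : ℕ → ℝ} (h : ∀ i, |a (i + 1)| < |a i| / 3)
    (hc : ∀ i, |c i| ≤ 1) {n : ℕ} (hlt : ∀ i < n, c i = 0) (hn : |c n| = 1) :
    ∑' i, c i * a i ≠ 0 := by
  intro h0
  have hs := summable_mul_of_abs_le_one (fun i => (h i).le) hc
  rw [← hs.sum_add_tsum_nat_add (n + 1), Finset.sum_range_succ,
    Finset.sum_eq_zero fun i hi => by rw [hlt i (Finset.mem_range.1 hi), zero_mul],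
    zero_add] at h0
  have ht := abs_tsum_mul_le (a := fun i => a (i + (n + 1))) (c := fun i => c (i + (n + 1)))
    (fun i => by simpa [add_right_comm] using (h (i + (n + 1))).le) (fun i => hc _)
  have habs : |c n * a n| = |∑' i, c (i + (n + 1)) * a (i + (n + 1))| := by
    rw [eq_neg_of_add_eq_zero_left h0, abs_neg]
  rw [abs_mul, hn, one_mul] at habs
  rw [zero_add] at ht
  have := h n
  have := abs_nonneg (a (n + 1))
  linarith

lemma abs_fin_two_le_one (b : Fin 2) : |((b : ℕ) : ℝ)| ≤ 1 := by
  fin_cases b <;> simp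

lemma abs_fin_two_sub_le_one (b d : Fin 2) : |((b : ℕ) : ℝ) - ((d : ℕ) : ℝ)| ≤ 1 := by
  fin_cases b <;> fin_cases d <;> simp

lemma abs_fin_two_sub_eq_one {b d : Fin 2} (h : b ≠ d) :
    |((b : ℕ) : ℝ) - ((d : ℕ) : ℝ)| = 1 := by
  fin_cases b <;> fin_cases d <;> simp_all

lemma continuous_tsum_digits {a : ℕ → ℝ} (h : ∀ i, |a (i + 1)| ≤ |a i| / 3) :
    Continuous fun x : ℕ → Fin 2 => ∑' i, ((x i : ℕ) : ℝ) * a i := by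
  refine continuous_tsum (fun i => ?_) (hasSum_geometric_third |a 0|).summable
    fun n x => norm_mul_le_geometric h (fun i => abs_fin_two_le_one (x i)) n
  exact (continuous_of_discreteTopology (f := fun b : Fin 2 => ((b : ℕ) : ℝ) * a i)).comp
    (continuous_apply i)

lemma injective_coe_tsum_digits {a : ℕ → ℝ} (h : ∀ i, |a (i + 1)| < |a i| / 3)
    (h0 : |a 0| < 1 / 3) :
    Function.Injective fun x : ℕ → Fin 2 =>
      ((∑' i, ((x i : ℕ) : ℝ) * a i : ℝ) : UnitAddCircle) := by
  intro x y hxy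
  by_contra hne
  have hle := fun i => (h i).le
  have hsx := summable_mul_of_abs_le_one hle fun i => abs_fin_two_le_one (x i)
  have hsy := summable_mul_of_abs_le_one hle fun i => abs_fin_two_le_one (y i)
  have hc := fun i => abs_fin_two_sub_le_one (x i) (y i)
  have hex : ∃ i, x i ≠ y i := Function.ne_iff.1 hne
  classical
  have hnz := tsum_mul_ne_zero (c := fun i => ((x i : ℕ) : ℝ) - ((y i : ℕ) : ℝ)) h hc
    (n := Nat.find hex)
    (fun i hi => by rw [not_not.1 (Nat.find_min hex hi), sub_self])
    (abs_fin_two_sub_eq_one (Nat.find_spec hex))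
  have hb := abs_tsum_mul_le hle hc
  have hsub : ∑' i, (((x i : ℕ) : ℝ) - ((y i : ℕ) : ℝ)) * a i =
      ∑' i, ((x i : ℕ) : ℝ) * a i - ∑' i, ((y i : ℕ) : ℝ) * a i := by
    rw [← hsx.tsum_sub hsy]
    simp only [sub_mul]
  obtain ⟨k, hk⟩ := AddSubgroup.mem_zmultiples_iff.1 (QuotientAddGroup.eq.1 hxy)
  have hk' : ∑' i, (((x i : ℕ) : ℝ) - ((y i : ℕ) : ℝ)) * a i = ((-k : ℤ) : ℝ) := by
    rw [hsub]
    simp only [zsmul_eq_mul, mul_one] at hk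
    push_cast
    linarith
  rw [hk'] at hb
  have hlt : |((-k : ℤ) : ℝ)| < 1 := by linarith
  have hk0 : -k = 0 := Int.abs_lt_one_iff.1 (by exact_mod_cast hlt)
  exact hnz (by rw [hk', hk0, Int.cast_zero])

open scoped Pointwise in
lemma volume_range_coe_tsum_digits_le (n : ℕ) {a : ℕ → ℝ}
    (h : ∀ i, |a (i + 1)| ≤ |a i| / 3) :
    volume (Set.range fun x : ℕ → Fin 2 =>
      ((∑' i, ((x i : ℕ) : ℝ) * a i : ℝ) : UnitAddCircle)) ≤
      2 ^ n * ENNReal.ofReal (3 * |a n|) := by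
  induction n generalizing a with
  | zero =>
    calc _ ≤ volume (Metric.closedBall (0 : UnitAddCircle) (3 / 2 * |a 0|)) := by
          refine measure_mono (Set.range_subset_iff.2 fun x => ?_)
          rw [mem_closedBall_zero_iff]
          exact QuotientAddGroup.norm_mk_le_norm.trans
            (abs_tsum_mul_le h fun i => abs_fin_two_le_one (x i))
      _ ≤ _ := by
          rw [AddCircle.volume_closedBall, pow_zero, one_mul]
          refine ENNReal.ofReal_le_ofReal ((min_le_right _ _).trans_eq ?_)
          ring
  | succ n ih =>
    set R := Set.range fun x : ℕ → Fin 2 =>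
      ((∑' i, ((x i : ℕ) : ℝ) * a (i + 1) : ℝ) : UnitAddCircle) with hR
    have hRle := ih (a := fun i => a (i + 1)) fun i => h (i + 1)
    calc _ ≤ volume (R ∪ ((a 0 : UnitAddCircle) +ᵥ R)) := by
          refine measure_mono (Set.range_subset_iff.2 fun x => ?_)
          have hs := summable_mul_of_abs_le_one h fun i => abs_fin_two_le_one (x i)
          have hmem : ((∑' i, ((x (i + 1) : ℕ) : ℝ) * a (i + 1) : ℝ) : UnitAddCircle) ∈ R :=
            ⟨fun i => x (i + 1), rfl⟩
          rw [hs.tsum_eq_zero_add]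
          obtain h0 | h0 : x 0 = 0 ∨ x 0 = 1 := by omega
          · left
            simpa [h0] using hmem
          · right
            refine ⟨_, hmem, ?_⟩
            simp [h0]
      _ ≤ volume R + volume ((a 0 : UnitAddCircle) +ᵥ R) := measure_union_le _ _
      _ = 2 * volume R := by rw [measure_vadd, two_mul]
      _ ≤ 2 * (2 ^ n * ENNReal.ofReal (3 * |a (n + 1)|)) := by gcongr
      _ = _ := by rw [← mul_assoc, pow_succ']

lemma volume_range_coe_tsum_digits {a : ℕ → ℝ} (h : ∀ i, |a (i + 1)| ≤ |a i| / 3) :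
    volume (Set.range fun x : ℕ → Fin 2 =>
      ((∑' i, ((x i : ℕ) : ℝ) * a i : ℝ) : UnitAddCircle)) = 0 := by
  have hlim : Filter.Tendsto (fun n : ℕ => ENNReal.ofReal (3 * |a 0| * (2 / 3) ^ n))
      Filter.atTop (nhds 0) := by
    rw [← ENNReal.ofReal_zero]
    refine ENNReal.tendsto_ofReal ?_
    simpa using (tendsto_pow_atTop_nhds_zero_of_lt_one (r := (2 / 3 : ℝ))
      (by norm_num) (by norm_num)).const_mul (3 * |a 0|)
  refine le_antisymm (ge_of_tendsto' hlim fun n =>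
    (volume_range_coe_tsum_digits_le n h).trans ?_) zero_le
  have h2 : (2 : ENNReal) ^ n = ENNReal.ofReal (2 ^ n) := by
    rw [ENNReal.ofReal_pow zero_le_two, ENNReal.ofReal_ofNat]
  rw [h2, ← ENNReal.ofReal_mul (by positivity)]
  refine ENNReal.ofReal_le_ofReal ?_
  calc (2 : ℝ) ^ n * (3 * |a n|) ≤ 2 ^ n * (3 * (|a 0| * (1 / 3) ^ n)) := by
        gcongr
        exact abs_le_geometric_of_abs_succ_le h n
    _ = 3 * |a 0| * (2 / 3) ^ n := by
        rw [div_pow, div_pow, one_pow]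
        ring

open MeasureTheory

/-- The map Φ : P = {0,1}^ℕ → 𝕋, Φ(x) = Σ x_i⟨m_iθ⟩ (mod 1), is
continuous and injective, and its image is a compact subset of 𝕋 of Lebesgue (Haar)
measure zero. -/
theorem stmt15
    (θ : ℝ) (hθirr : Irrational θ) (hθmem : θ ∈ Set.Ioo (0 : ℝ) 1)
    (e : ℝ → ℝ)
    (he : ∀ x : ℝ, e x ∈ Set.Ioc (-(1 / 2) : ℝ) (1 / 2) ∧ ∃ k : ℤ, x - e x = k)
    (m : ℕ → ℕ) (hmono : StrictMono m) (hpos : ∀ i, 0 < m i)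
    (hm0 : |e ((m 0 : ℝ) * θ)| < 1 / 3)
    (hmdec : ∀ i : ℕ, |e ((m (i + 1) : ℝ) * θ)| < |e ((m i : ℝ) * θ)| / 3)
    (Φ : (ℕ → Fin 2) → UnitAddCircle)
    (hΦ : ∀ x : ℕ → Fin 2,
      Φ x = ((∑' i : ℕ, ((x i : ℕ) : ℝ) * e ((m i : ℝ) * θ) : ℝ) : UnitAddCircle)) :
    Continuous Φ ∧ Function.Injective Φ ∧
    IsCompact (Set.range Φ) ∧ volume (Set.range Φ) = 0 := by
  obtain rfl : Φ = fun x => _ := funext hΦ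
  have hle := fun i => (hmdec i).le
  have hcont := (AddCircle.continuous_mk' (1 : ℝ)).comp
    (continuous_tsum_digits (a := fun i => e ((m i : ℝ) * θ)) hle)
  exact ⟨hcont, injective_coe_tsum_digits (a := fun i => e ((m i : ℝ) * θ)) hmdec hm0,
    isCompact_range hcont,
    volume_range_coe_tsum_digits (a := fun i => e ((m i : ℝ) * θ)) hle⟩
end

section
/- For t ∈ ℝ, the set Φ(P) ∩ (Φ(P) + t) (intersection taken in 𝕋, with t acting by translation) has ν₀'-measure zero if and only if there is no finitely supported sequence λ : ℕ → {−1,0,1} and integer k with t = Σ_{i≥1} λ_i⟨m_iθ⟩ + k. -/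
open MeasureTheory

section ThirdDecay

variable {g : ℕ → ℝ}

lemma abs_add_le_geometric_of_lt_third (h : ∀ i, |g (i + 1)| < |g i| / 3) (n k : ℕ) :
    |g (n + k)| ≤ |g n| * (1 / 3) ^ k := by
  induction k with
  | zero => simp
  | succ k ih =>
    have := h (n + k)
    rw [pow_succ, ← add_assoc]
    linarith

lemma summable_abs_of_lt_third (h : ∀ i, |g (i + 1)| < |g i| / 3) : Summable fun i => |g i| := by
  refine Summable.of_nonneg_of_le (fun _ => abs_nonneg _) (fun i => ?_)
    ((summable_geometric_of_lt_one (r := (1 / 3 : ℝ)) (by norm_num) (by norm_num)).mul_left |g 0|)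
  simpa using abs_add_le_geometric_of_lt_third h 0 i

lemma summable_intCast_mul_of_lt_third (h : ∀ i, |g (i + 1)| < |g i| / 3) {lam : ℕ → ℤ} {C : ℝ}
    (hlam : ∀ i, |(lam i : ℝ)| ≤ C) : Summable fun i => (lam i : ℝ) * g i := by
  refine Summable.of_norm_bounded ((summable_abs_of_lt_third h).mul_left C) (fun i => ?_)
  rw [Real.norm_eq_abs, abs_mul]
  exact mul_le_mul_of_nonneg_right (hlam i) (abs_nonneg _)

lemma tsum_abs_tail_lt_of_lt_third (h : ∀ i, |g (i + 1)| < |g i| / 3) (n : ℕ) :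
    ∑' i, |g (i + (n + 1))| < |g n| / 2 := by
  have hgeo : HasSum (fun i : ℕ => |g n| / 3 * (1 / 3 : ℝ) ^ i) (|g n| / 2) := by
    have := (hasSum_geometric_of_lt_one (r := (1 / 3 : ℝ)) (by norm_num) (by norm_num)).mul_left
      (|g n| / 3)
    have heq : |g n| / 3 * (1 - 1 / 3)⁻¹ = |g n| / 2 := by
      rw [show ((1 : ℝ) - 1 / 3)⁻¹ = 3 / 2 by norm_num]
      ring
    rwa [heq] at this
  have hs : Summable fun i => |g (i + (n + 1))| :=
    (summable_nat_add_iff (f := fun i => |g i|) (n + 1)).2 (summable_abs_of_lt_third h)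
  rw [← hgeo.tsum_eq]
  refine Summable.tsum_lt_tsum (i := 0) (fun i => ?_) ?_ hs hgeo.summable
  · have h1 := abs_add_le_geometric_of_lt_third h (n + 1) i
    have h2 : |g (n + 1)| * (1 / 3 : ℝ) ^ i ≤ |g n| / 3 * (1 / 3 : ℝ) ^ i :=
      mul_le_mul_of_nonneg_right (h n).le (by positivity)
    rw [add_comm i]
    exact h1.trans h2
  · simpa using h n

lemma eq_zero_of_tsum_eq_zero_of_lt_third (h : ∀ i, |g (i + 1)| < |g i| / 3) {lam : ℕ → ℤ}
    (hlam : ∀ i, |(lam (i + 1) : ℝ)| ≤ 2) (hsum : ∑' i, (lam i : ℝ) * g i = 0) (n : ℕ) :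
    lam n = 0 := by
  induction n using Nat.strong_induction_on with
  | _ n ih =>
    by_contra hne
    have htail : ∀ k, ‖(lam (k + (n + 1)) : ℝ) * g (k + (n + 1))‖ ≤ 2 * |g (k + (n + 1))| := by
      intro k
      rw [Real.norm_eq_abs, abs_mul]
      exact mul_le_mul_of_nonneg_right (hlam (k + n)) (abs_nonneg _)
    have habs : Summable fun k => 2 * |g (k + (n + 1))| :=
      ((summable_nat_add_iff (n + 1)).2 (summable_abs_of_lt_third h)).mul_left 2
    have hs : Summable fun i => (lam i : ℝ) * g i :=
      (summable_nat_add_iff (n + 1)).1 (Summable.of_norm_bounded habs htail)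
    rw [← hs.sum_add_tsum_nat_add (n + 1), Finset.sum_range_succ,
      Finset.sum_eq_zero (fun i hi => by simp [ih i (Finset.mem_range.1 hi)]), zero_add] at hsum
    have hle := tsum_of_norm_bounded habs.hasSum htail
    rw [tsum_mul_left, Real.norm_eq_abs] at hle
    have hlt := tsum_abs_tail_lt_of_lt_third h n
    have hone : (1 : ℝ) ≤ |(lam n : ℝ)| := by exact_mod_cast Int.one_le_abs hne
    have hge : |g n| ≤ |(lam n : ℝ) * g n| := by
      rw [abs_mul]
      exact le_mul_of_one_le_left (abs_nonneg _) hone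
    rw [eq_neg_of_add_eq_zero_left hsum, abs_neg] at hge
    linarith

/-- Expansions `k + ∑ λᵢ rᵢ` with digits in `{-1, 0, 1}` are unique when `r` decays fast enough. -/
lemma digits_unique_of_lt_third {r : ℕ → ℝ} (h0 : |r 0| < 1 / 3)
    (h : ∀ i, |r (i + 1)| < |r i| / 3) {lam mu : ℕ → ℤ} {j k : ℤ}
    (hlam : ∀ i, |(lam i : ℝ)| ≤ 1) (hmu : ∀ i, |(mu i : ℝ)| ≤ 1)
    (heq : ∑' i, (lam i : ℝ) * r i + j = ∑' i, (mu i : ℝ) * r i + k) : lam = mu := by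
  obtain ⟨g, hg0, hgs⟩ : ∃ g : ℕ → ℝ, g 0 = 1 ∧ ∀ i, g (i + 1) = r i :=
    ⟨fun n => Nat.casesOn n 1 r, rfl, fun _ => rfl⟩
  obtain ⟨d, hd0, hds⟩ : ∃ d : ℕ → ℤ, d 0 = j - k ∧ ∀ i, d (i + 1) = lam i - mu i :=
    ⟨fun n => Nat.casesOn n (j - k) fun i => lam i - mu i, rfl, fun _ => rfl⟩
  have hg : ∀ i, |g (i + 1)| < |g i| / 3 := by
    intro i
    cases i with
    | zero => simpa [hg0, hgs] using h0
    | succ i => simpa only [hgs] using h i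
  have hd : ∀ i, |(d (i + 1) : ℝ)| ≤ 2 := by
    intro i
    rw [hds, Int.cast_sub]
    linarith [abs_sub (lam i : ℝ) (mu i), hlam i, hmu i]
  have hsl := summable_intCast_mul_of_lt_third h hlam
  have hsm := summable_intCast_mul_of_lt_third h hmu
  have htail : (fun i => (d (i + 1) : ℝ) * g (i + 1)) =
      fun i => (lam i : ℝ) * r i - (mu i : ℝ) * r i := by
    funext i
    simp [hds, hgs, sub_mul]
  have hs' : Summable fun i => (d (i + 1) : ℝ) * g (i + 1) := by
    rw [htail]
    exact hsl.sub hsm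
  have hs : Summable fun i => (d i : ℝ) * g i :=
    (summable_nat_add_iff (f := fun i => (d i : ℝ) * g i) 1).1 hs'
  have hsum : ∑' i, (d i : ℝ) * g i = 0 := by
    rw [hs.tsum_eq_zero_add, htail, hsl.tsum_sub hsm]
    rw [hd0, hg0, Int.cast_sub]
    linarith
  funext i
  exact sub_eq_zero.1 ((hds i).symm.trans (eq_zero_of_tsum_eq_zero_of_lt_third hg hd hsum (i + 1)))

end ThirdDecay

/-- A cylinder fixing infinitely many coordinates is null when the one-coordinate
probabilities stay away from `1`. -/
lemma measure_infinite_cylinder_eq_zero {ν : Measure (ℕ → Fin 2)} {p : ℕ → Fin 2 → ENNReal}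
    {M : ENNReal} (hM : M < 1) (hp : ∀ i b, p i b ≤ M)
    (hν : ∀ (s : Finset ℕ) (b : ℕ → Fin 2), ν {x | ∀ i ∈ s, x i = b i} = ∏ i ∈ s, p i (b i))
    {S : Set ℕ} (hS : S.Infinite) (b : ℕ → Fin 2) : ν {x | ∀ i ∈ S, x i = b i} = 0 := by
  have hle : ∀ n : ℕ, ν {x | ∀ i ∈ S, x i = b i} ≤ M ^ n := by
    intro n
    obtain ⟨s, hsS, rfl⟩ := hS.exists_subset_card_eq n
    calc ν {x | ∀ i ∈ S, x i = b i} ≤ ν {x | ∀ i ∈ s, x i = b i} :=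
          measure_mono fun x hx i hi => hx i (hsS hi)
      _ = ∏ i ∈ s, p i (b i) := hν s b
      _ ≤ M ^ s.card := Finset.prod_le_pow_card _ _ _ fun i _ => hp i _
  exact le_antisymm
    (ge_of_tendsto' (ENNReal.tendsto_pow_atTop_nhds_zero_of_lt_one hM) hle) zero_le

lemma continuous_tsum_fin_two_mul {r : ℕ → ℝ} (hr : Summable fun i => |r i|) :
    Continuous fun x : ℕ → Fin 2 => ∑' i, ((x i : ℕ) : ℝ) * r i := by
  refine continuous_tsum (fun i => ?_) hr fun i x => ?_
  · exact (continuous_of_discreteTopology.comp (continuous_apply i) :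
      Continuous ((fun b : Fin 2 => ((b : ℕ) : ℝ)) ∘ fun x : ℕ → Fin 2 => x i)).mul continuous_const
  · rw [Real.norm_eq_abs, abs_mul]
    refine mul_le_of_le_one_left (abs_nonneg _) ?_
    have : (x i : ℕ) ≤ 1 := Nat.lt_succ_iff.1 (x i).isLt
    rw [Nat.abs_cast]
    exact_mod_cast this

/-- With ν₀ the product measure on P = {0,1}^ℕ (with ν₀({x_i = 0}) = a_i)
and ν₀' = ν₀ ∘ Φ⁻¹ on 𝕋, the set Φ(P) ∩ (Φ(P) + t) is ν₀'-null if and only if t is not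
of the form Σ λ_i⟨m_iθ⟩ + k with λ finitely supported in {−1,0,1} and k ∈ ℤ. -/
theorem stmt16
    (θ : ℝ) (hθirr : Irrational θ) (hθmem : θ ∈ Set.Ioo (0 : ℝ) 1)
    (e : ℝ → ℝ)
    (he : ∀ x : ℝ, e x ∈ Set.Ioc (-(1 / 2) : ℝ) (1 / 2) ∧ ∃ k : ℤ, x - e x = k)
    (m : ℕ → ℕ) (hmono : StrictMono m) (hpos : ∀ i, 0 < m i)
    (hm0 : |e ((m 0 : ℝ) * θ)| < 1 / 3)
    (hmdec : ∀ i : ℕ, |e ((m (i + 1) : ℝ) * θ)| < |e ((m i : ℝ) * θ)| / 3)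
    (Φ : (ℕ → Fin 2) → UnitAddCircle)
    (hΦ : ∀ x : ℕ → Fin 2,
      Φ x = ((∑' i : ℕ, ((x i : ℕ) : ℝ) * e ((m i : ℝ) * θ) : ℝ) : UnitAddCircle))
    (a : ℕ → ℝ) (ha : ∃ c d : ℝ, 0 < c ∧ d < 1 ∧ ∀ i, c ≤ a i ∧ a i ≤ d)
    (ν₀ : Measure (ℕ → Fin 2)) [IsProbabilityMeasure ν₀]
    (hν₀ : ∀ (s : Finset ℕ) (b : ℕ → Fin 2),
      ν₀ {x | ∀ i ∈ s, x i = b i} =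
        ∏ i ∈ s, (if b i = 0 then ENNReal.ofReal (a i) else ENNReal.ofReal (1 - a i)))
    (ν₀' : Measure UnitAddCircle) (hν₀' : ν₀' = Measure.map Φ ν₀)
    (t : ℝ) :
    ν₀' (Set.range Φ ∩ ((fun y => y + (t : UnitAddCircle)) '' Set.range Φ)) = 0 ↔
    ¬ ∃ lam : ℕ → ℤ, (Function.support lam).Finite ∧
        (∀ i, lam i = -1 ∨ lam i = 0 ∨ lam i = 1) ∧
        ∃ k : ℤ, t = (∑' i : ℕ, (lam i : ℝ) * e ((m i : ℝ) * θ)) + k := by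
  set r : ℕ → ℝ := fun i => e ((m i : ℝ) * θ)
  have hsr : Summable fun i => |r i| := summable_abs_of_lt_third hmdec
  have hΦc : Continuous Φ := by
    rw [funext hΦ]
    exact (AddCircle.continuous_mk' 1).comp (continuous_tsum_fin_two_mul hsr)
  obtain ⟨c, d, hc, hd, hcd⟩ := ha
  have hdiff : ∀ x y : ℕ → Fin 2, ∀ i, |((((x i : ℕ) : ℤ) - ((y i : ℕ) : ℤ) : ℤ) : ℝ)| ≤ 1 := by
    intro x y i
    have h : |((x i : ℕ) : ℤ) - ((y i : ℕ) : ℤ)| ≤ 1 := by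
      rw [abs_le]
      have := (x i).isLt
      have := (y i).isLt
      omega
    exact_mod_cast h
  have hsum : ∀ x : ℕ → Fin 2, Summable fun i => ((x i : ℕ) : ℝ) * r i := by
    intro x
    have hs := summable_intCast_mul_of_lt_third (g := r) hmdec
      (lam := fun i => ((x i : ℕ) : ℤ)) (C := 1) fun i => by simpa using hdiff x 0 i
    simpa using hs
  have hdiffsum : ∀ x y : ℕ → Fin 2,
      ∑' i, ((((x i : ℕ) : ℤ) - ((y i : ℕ) : ℤ) : ℤ) : ℝ) * r i =
        ∑' i, ((x i : ℕ) : ℝ) * r i - ∑' i, ((y i : ℕ) : ℝ) * r i := by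
    intro x y
    rw [← (hsum x).tsum_sub (hsum y)]
    refine tsum_congr fun i => ?_
    push_cast
    ring
  have hiff : ∀ x y : ℕ → Fin 2, Φ y + (t : UnitAddCircle) = Φ x ↔
      ∃ k : ℤ, t = ∑' i, ((((x i : ℕ) : ℤ) - ((y i : ℕ) : ℤ) : ℤ) : ℝ) * r i + k := by
    intro x y
    rw [hΦ, hΦ, ← AddCircle.coe_add, hdiffsum, ← sub_eq_zero, ← AddCircle.coe_sub,
      AddCircle.coe_eq_zero_iff]
    refine exists_congr fun k => ?_
    rw [zsmul_one]
    constructor <;> intro h <;> linarith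
  have hmeas : ν₀' (Set.range Φ ∩ ((fun y => y + (t : UnitAddCircle)) '' Set.range Φ)) =
      ν₀ {x | ∃ y, Φ y + (t : UnitAddCircle) = Φ x} := by
    have hcomp : IsCompact (Set.range Φ) := isCompact_range hΦc
    rw [hν₀', Measure.map_apply hΦc.measurable (hcomp.measurableSet.inter
      (hcomp.image (continuous_add_const _)).measurableSet)]
    congr 1
    ext x
    simp [eq_add_neg_iff_add_eq]
  rw [hmeas]
  constructor
  · rintro hzero ⟨lam, hfin, hlam, k, hk⟩
    let b : ℕ → Fin 2 := fun i => if lam i = 1 then 1 else 0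
    have hsub : {x : ℕ → Fin 2 | ∀ i ∈ hfin.toFinset, x i = b i} ⊆
        {x | ∃ y, Φ y + (t : UnitAddCircle) = Φ x} := by
      intro x hx
      let y : ℕ → Fin 2 := fun i => if lam i = 0 then x i else if lam i = 1 then 0 else 1
      refine ⟨y, (hiff x y).2 ⟨k, ?_⟩⟩
      rw [hk]
      congr 2
      funext i
      have hxi : lam i ≠ 0 → x i = b i := fun h => hx i (by simpa using h)
      congr 2
      rcases hlam i with h | h | h
      · simp [y, hxi (by omega), b, h]
      · simp [y, h]
      · simp [y, hxi (by omega), b, h]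
    have h0 := measure_mono_null hsub hzero
    rw [hν₀, Finset.prod_eq_zero_iff] at h0
    obtain ⟨i, -, hi⟩ := h0
    have := hcd i
    split_ifs at hi
    · rw [ENNReal.ofReal_eq_zero] at hi
      linarith
    · rw [ENNReal.ofReal_eq_zero] at hi
      linarith
  · intro hno
    by_cases hne : ∃ x y, Φ y + (t : UnitAddCircle) = Φ x
    · obtain ⟨x, y, hxy⟩ := hne
      obtain ⟨k, hk⟩ := (hiff x y).1 hxy
      set lam : ℕ → ℤ := fun i => ((x i : ℕ) : ℤ) - ((y i : ℕ) : ℤ) with hlam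
      have hinf : (Function.support lam).Infinite := by
        intro hfin
        refine hno ⟨lam, hfin, fun i => ?_, k, hk⟩
        have := (x i).isLt
        have := (y i).isLt
        simp only [hlam]
        omega
      refine measure_mono_null ?_ (measure_infinite_cylinder_eq_zero
        (M := ENNReal.ofReal (max d (1 - c)))
        (p := fun i b => if b = 0 then ENNReal.ofReal (a i) else ENNReal.ofReal (1 - a i))
        ?_ ?_ hν₀ hinf x)
      · rintro x' ⟨y', hxy'⟩ i hi
        obtain ⟨k', hk'⟩ := (hiff x' y').1 hxy'
        have huniq := congrFun (digits_unique_of_lt_third hm0 hmdec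
          (lam := lam) (mu := fun i => ((x' i : ℕ) : ℤ) - ((y' i : ℕ) : ℤ))
          (hdiff x y) (hdiff x' y') (hk.symm.trans hk')) i
        have hi' : lam i ≠ 0 := hi
        simp only [hlam] at huniq hi'
        have := (x i).isLt
        have := (y i).isLt
        have := (x' i).isLt
        have := (y' i).isLt
        exact Fin.ext (by omega)
      · rw [ENNReal.ofReal_lt_one]
        exact max_lt hd (by linarith)
      · intro i b
        have := hcd i
        split_ifs
        · exact ENNReal.ofReal_le_ofReal (le_max_of_le_left this.2)
        · exact ENNReal.ofReal_le_ofReal (le_max_of_le_right (by linarith))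
    · convert measure_empty (μ := ν₀)
      exact Set.eq_empty_of_forall_notMem fun x ⟨y, hxy⟩ => hne ⟨x, y, hxy⟩
end

section
/- For every k ∈ ℤ, the restriction of ν to the set σᵏ(Φ(P)) = Φ(P) + kθ and the restriction to this set of the measure A ↦ ν₀'(A − kθ) are mutually absolutely continuous. In particular, ν restricted to Φ(P) is mutually absolutely continuous with ν₀'. -/
open MeasureTheory

section LacunarySums

variable {t : ℕ → ℝ}

lemma abs_add_le_geometric (h : ∀ i, |t (i + 1)| < |t i| / 3) (n j : ℕ) :
    |t (n + j)| ≤ |t n| * (1 / 3) ^ j := by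
  induction j with
  | zero => simp
  | succ j ih =>
    have h' := h (n + j)
    rw [← add_assoc, pow_succ]
    linarith

lemma summable_abs_tail (h : ∀ i, |t (i + 1)| < |t i| / 3) (n : ℕ) :
    Summable fun j => |t (n + j)| :=
  .of_nonneg_of_le (fun _ => abs_nonneg _) (abs_add_le_geometric h n)
    ((summable_geometric_of_lt_one (by norm_num) (by norm_num)).mul_left _)

lemma tsum_abs_tail_le (h : ∀ i, |t (i + 1)| < |t i| / 3) (n : ℕ) :
    ∑' j, |t (n + j)| ≤ 3 / 2 * |t n| := by
  refine ((summable_abs_tail h n).tsum_le_tsum (abs_add_le_geometric h n)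
    ((summable_geometric_of_lt_one (by norm_num) (by norm_num)).mul_left _)).trans_eq ?_
  rw [tsum_mul_left, tsum_geometric_of_lt_one (by norm_num) (by norm_num)]
  ring

lemma summable_mul_tail (h : ∀ i, |t (i + 1)| < |t i| / 3) {δ : ℕ → ℝ} {C : ℝ}
    (hδ : ∀ i, |δ i| ≤ C) (n : ℕ) : Summable fun j => δ (n + j) * t (n + j) :=
  .of_norm_bounded ((summable_abs_tail h n).mul_left C) fun j => by
    rw [Real.norm_eq_abs, abs_mul]
    exact mul_le_mul_of_nonneg_right (hδ _) (abs_nonneg _)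

lemma abs_tsum_mul_tail_le (h : ∀ i, |t (i + 1)| < |t i| / 3) {δ : ℕ → ℝ} {C : ℝ}
    (hδ : ∀ i, |δ i| ≤ C) (n : ℕ) :
    |∑' j, δ (n + j) * t (n + j)| ≤ C * (3 / 2 * |t n|) := by
  have hC : 0 ≤ C := (abs_nonneg _).trans (hδ 0)
  rw [← Real.norm_eq_abs]
  refine (tsum_of_norm_bounded (((summable_abs_tail h n).mul_left C).hasSum) fun j => ?_).trans ?_
  · rw [Real.norm_eq_abs, abs_mul]
    exact mul_le_mul_of_nonneg_right (hδ _) (abs_nonneg _)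
  · rw [tsum_mul_left]
    exact mul_le_mul_of_nonneg_left (tsum_abs_tail_le h n) hC

/-- An expansion in a lacunary sequence with integer digits of size at most `2` which sums to an
integer is trivial. -/
lemma eq_zero_of_tsum_mul_eq_int (h0 : |t 0| < 1 / 3) (h : ∀ i, |t (i + 1)| < |t i| / 3)
    {δ : ℕ → ℤ} (hδ : ∀ i, |δ i| ≤ 2) {N : ℤ} (hN : ∑' i, (δ i : ℝ) * t i = N) (n : ℕ) :
    δ n = 0 := by
  have hδ' : ∀ i, |(δ i : ℝ)| ≤ 2 := fun i => by exact_mod_cast hδ i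
  have hzero : ∑' i, (δ i : ℝ) * t i = 0 := by
    have hb := abs_tsum_mul_tail_le (δ := fun i => (δ i : ℝ)) h hδ' 0
    simp only [zero_add] at hb
    rw [hN] at hb ⊢
    have : |(N : ℝ)| < 1 := by linarith
    have : |N| < 1 := by exact_mod_cast this
    rw [Int.abs_lt_one_iff] at this
    simp [this]
  induction n using Nat.strong_induction_on with
  | _ n ih =>
    have hs : Summable fun i => (δ i : ℝ) * t i := by
      simpa using summable_mul_tail (δ := fun i => (δ i : ℝ)) h hδ' 0
    have hsplit := hs.sum_add_tsum_nat_add (n + 1)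
    rw [hzero, Finset.sum_range_succ, Finset.sum_eq_zero fun i hi => by
      rw [ih i (Finset.mem_range.1 hi)]; simp, zero_add] at hsplit
    have hb := abs_tsum_mul_tail_le (δ := fun i => (δ i : ℝ)) h hδ' (n + 1)
    simp only [add_comm (n + 1)] at hb
    rw [eq_neg_of_add_eq_zero_right hsplit] at hb
    by_contra hne
    have h1 : (1 : ℝ) ≤ |(δ n : ℝ)| := by exact_mod_cast Int.one_le_abs hne
    have h2 := mul_le_mul_of_nonneg_right h1 (abs_nonneg (t n))
    rw [abs_neg, abs_mul] at hb
    linarith [h n]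

end LacunarySums

section BernoulliProduct

variable {μ : Measure (ℕ → Fin 2)} {p : ℕ → Fin 2 → ENNReal}

lemma iIndep_coordinates (hμ : ∀ (s : Finset ℕ) (b : ℕ → Fin 2),
      μ {x | ∀ i ∈ s, x i = b i} = ∏ i ∈ s, p i (b i)) :
    ProbabilityTheory.iIndep
      (fun i : ℕ => MeasurableSpace.comap (fun x : ℕ → Fin 2 => x i) inferInstance) μ := by
  have hprob : IsProbabilityMeasure μ := ⟨by simpa using hμ ∅ 0⟩
  refine ProbabilityTheory.iIndepSets.iIndep (fun i => (measurable_pi_apply i).comap_le)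
    (fun i => Set.range fun b : Fin 2 => (fun x : ℕ → Fin 2 => x i) ⁻¹' {b}) ?_ ?_ ?_
  · rintro i _ ⟨b, rfl⟩ _ ⟨c, rfl⟩ ⟨x, hb, hc⟩
    obtain rfl : x i = b := hb
    obtain rfl : x i = c := hc
    exact ⟨x i, by simp⟩
  · intro i
    refine le_antisymm ?_ (MeasurableSpace.generateFrom_le ?_)
    · rintro _ ⟨A, -, rfl⟩
      rw [← Set.biUnion_preimage_singleton]
      exact .biUnion A.to_countable fun b _ => MeasurableSpace.measurableSet_generateFrom ⟨b, rfl⟩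
    · rintro _ ⟨b, rfl⟩
      exact ⟨{b}, measurableSet_singleton _, rfl⟩
  · rw [ProbabilityTheory.iIndepSets_iff]
    intro s f hf
    choose! b hb using hf
    have h1 : ∀ i ∈ s, μ (f i) = p i (b i) := fun i hi => by
      rw [← hb i hi]
      simpa [Set.preimage] using hμ {i} b
    rw [Finset.prod_congr rfl h1, ← hμ s b]
    congr 1
    ext x
    simp only [Set.mem_iInter, Set.mem_ofPred_eq]
    refine forall₂_congr fun i hi => ?_
    rw [← hb i hi]
    simp

open Classical in
/-- Changing finitely many coordinates of a product measure with full support is nonsingular. -/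
lemma measure_piecewise_preimage_eq_zero (hμ : ∀ (s : Finset ℕ) (b : ℕ → Fin 2),
      μ {x | ∀ i ∈ s, x i = b i} = ∏ i ∈ s, p i (b i))
    (hp : ∀ i b, p i b ≠ 0) (s : Finset ℕ) (b : ℕ → Fin 2) {N : Set (ℕ → Fin 2)}
    (hN : MeasurableSet N) (hN0 : μ N = 0) : μ {x | s.piecewise b x ∈ N} = 0 := by
  have hind := ProbabilityTheory.indep_iSup_of_disjoint
    (fun i => (measurable_pi_apply i).comap_le) (iIndep_coordinates hμ)
    (disjoint_compl_right (a := (s : Set ℕ)))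
  rw [ProbabilityTheory.Indep_iff] at hind
  have hcoord : ∀ (S : Set ℕ), ∀ i ∈ S,
      Measurable[⨆ i ∈ S, MeasurableSpace.comap (fun x : ℕ → Fin 2 => x i) inferInstance]
        (fun x : ℕ → Fin 2 => x i) := fun S i hi =>
    measurable_iff_comap_le.2
      (le_iSup₂ (f := fun i (_ : i ∈ S) =>
        MeasurableSpace.comap (fun x : ℕ → Fin 2 => x i) inferInstance) i hi)
  have key := hind {x | ∀ i ∈ s, x i = b i} {x | s.piecewise b x ∈ N} ?_ ?_
  · have hsub : {x | ∀ i ∈ s, x i = b i} ∩ {x | s.piecewise b x ∈ N} ⊆ N := by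
      rintro x ⟨hx, hxN⟩
      have : s.piecewise b x = x := by
        ext1 i
        by_cases hi : i ∈ s
        · simp [hi, hx i hi]
        · simp [hi]
      rwa [Set.mem_ofPred_eq, this] at hxN
    rw [measure_mono_null hsub hN0, eq_comm, mul_eq_zero, hμ] at key
    exact key.resolve_left (Finset.prod_ne_zero_iff.2 fun i _ => hp i _)
  · have : {x : ℕ → Fin 2 | ∀ i ∈ s, x i = b i} =
        ⋂ i ∈ (s : Set ℕ), (fun x => x i) ⁻¹' {b i} := by
      ext x; simp
    rw [this]
    exact MeasurableSet.biInter (s : Set ℕ).to_countable fun i hi =>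
      hcoord s i hi (measurableSet_singleton _)
  · suffices h : Measurable[⨆ i ∈ (s : Set ℕ)ᶜ,
        MeasurableSpace.comap (fun x : ℕ → Fin 2 => x i) inferInstance]
        (fun x => s.piecewise b x) from h hN
    refine @measurable_pi_lambda _ _ _ (_) _ _ fun i => ?_
    by_cases hi : i ∈ s
    · simp only [hi, Finset.piecewise_eq_of_mem]
      exact measurable_const
    · simp only [hi, not_false_eq_true, Finset.piecewise_eq_of_notMem]
      exact hcoord _ i hi

lemma measure_agree_infinite_eq_zero (hμ : ∀ (s : Finset ℕ) (b : ℕ → Fin 2),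
      μ {x | ∀ i ∈ s, x i = b i} = ∏ i ∈ s, p i (b i))
    {q : ENNReal} (hq : q < 1) (hp : ∀ i b, p i b ≤ q) {D : Set ℕ} (hD : D.Infinite)
    (b : ℕ → Fin 2) : μ {x | ∀ i ∈ D, x i = b i} = 0 := by
  refine le_antisymm (ge_of_tendsto' (ENNReal.tendsto_pow_atTop_nhds_zero_of_lt_one hq)
    fun n => ?_) zero_le
  obtain ⟨s, hsD, rfl⟩ := hD.exists_subset_card_eq n
  calc μ {x | ∀ i ∈ D, x i = b i} ≤ μ {x | ∀ i ∈ s, x i = b i} :=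
        measure_mono fun x hx i hi => hx i (hsD hi)
    _ = ∏ i ∈ s, p i (b i) := hμ s b
    _ ≤ q ^ s.card := Finset.prod_le_pow_card _ _ _ fun i _ => hp i _

/-- If translation differences of `Φ` determine digit differences, then every translation acts
nonsingularly on the part of the image of `Φ` that it maps into this image. -/
lemma map_image_add_right_eq_zero {Φ : (ℕ → Fin 2) → UnitAddCircle} (hΦ : Measurable Φ)
    (hdiff : ∀ x y x' y', Φ y - Φ x = Φ y' - Φ x' →
      ∀ i, ((y i : ℕ) : ℤ) - (x i : ℕ) = (y' i : ℕ) - (x' i : ℕ))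
    (hμ : ∀ (s : Finset ℕ) (b : ℕ → Fin 2),
      μ {x | ∀ i ∈ s, x i = b i} = ∏ i ∈ s, p i (b i))
    (hp0 : ∀ i b, p i b ≠ 0) {q : ENNReal} (hq : q < 1) (hp : ∀ i b, p i b ≤ q)
    {B : Set UnitAddCircle} (hB : MeasurableSet B) (hBK : B ⊆ Set.range Φ)
    (hB0 : μ.map Φ B = 0) (r : UnitAddCircle) : μ.map Φ ((fun x => x + r) '' B) = 0 := by
  classical
  have himg : MeasurableSet ((fun x => x + r) '' B) :=
    (MeasurableEquiv.addRight r).measurableSet_image.2 hB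
  rw [Measure.map_apply hΦ hB] at hB0
  rw [Measure.map_apply hΦ himg]
  have hmem : ∀ y ∈ Φ ⁻¹' ((fun x => x + r) '' B), ∃ x, Φ x ∈ B ∧ Φ y - Φ x = r := by
    rintro y ⟨z, hz, hzy⟩
    obtain ⟨x, rfl⟩ := hBK hz
    exact ⟨x, hz, by rw [← hzy]; simp⟩
  rcases Set.eq_empty_or_nonempty (Φ ⁻¹' ((fun x => x + r) '' B)) with he | ⟨y₀, hy₀⟩
  · rw [he, measure_empty]
  obtain ⟨x₀, -, hr₀⟩ := hmem y₀ hy₀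
  let D : Set ℕ := {i | y₀ i ≠ x₀ i}
  have hdig : ∀ x y, Φ y - Φ x = r → ∀ i,
      (y₀ i ≠ x₀ i → y i = y₀ i ∧ x i = x₀ i) ∧ (y₀ i = x₀ i → x i = y i) := by
    intro x y hxy i
    have h := hdiff x y x₀ y₀ (hxy.trans hr₀.symm) i
    generalize y i = a, x i = b, y₀ i = c, x₀ i = d at h
    revert a b c d
    decide
  rcases D.finite_or_infinite with hD | hD
  · refine measure_mono_null ?_
      (measure_piecewise_preimage_eq_zero hμ hp0 hD.toFinset x₀ (hΦ hB) hB0)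
    intro y hy
    obtain ⟨x, hx, hxy⟩ := hmem y hy
    have : hD.toFinset.piecewise x₀ y = x := by
      ext1 i
      by_cases hi : y₀ i = x₀ i
      · rw [Finset.piecewise_eq_of_notMem _ _ _ (by simpa [D] using hi), (hdig x y hxy i).2 hi]
      · rw [Finset.piecewise_eq_of_mem _ _ _ (by simpa [D] using hi), ((hdig x y hxy i).1 hi).2]
    rwa [Set.mem_ofPred_eq, this]
  · refine measure_mono_null ?_ (measure_agree_infinite_eq_zero hμ hq hp hD y₀)
    intro y hy i hi
    obtain ⟨x, -, hxy⟩ := hmem y hy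
    exact ((hdig x y hxy i).1 hi).1

end BernoulliProduct

/-- With ν = Σ_k γ^{1+|k|} ν₀'∘σᵏ as above, for every k ∈ ℤ the
restriction of ν to σᵏ(Φ(P)) = Φ(P) + kθ and the restriction of the measure
A ↦ ν₀'(A − kθ) to this set are mutually absolutely continuous; in particular ν and
ν₀' are mutually absolutely continuous on Φ(P). -/
theorem stmt17
    (θ : ℝ) (hθirr : Irrational θ) (hθmem : θ ∈ Set.Ioo (0 : ℝ) 1)
    (e : ℝ → ℝ)
    (he : ∀ x : ℝ, e x ∈ Set.Ioc (-(1 / 2) : ℝ) (1 / 2) ∧ ∃ k : ℤ, x - e x = k)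
    (m : ℕ → ℕ) (hmono : StrictMono m) (hpos : ∀ i, 0 < m i)
    (hm0 : |e ((m 0 : ℝ) * θ)| < 1 / 3)
    (hmdec : ∀ i : ℕ, |e ((m (i + 1) : ℝ) * θ)| < |e ((m i : ℝ) * θ)| / 3)
    (Φ : (ℕ → Fin 2) → UnitAddCircle)
    (hΦ : ∀ x : ℕ → Fin 2,
      Φ x = ((∑' i : ℕ, ((x i : ℕ) : ℝ) * e ((m i : ℝ) * θ) : ℝ) : UnitAddCircle))
    (a : ℕ → ℝ) (ha : ∃ c d : ℝ, 0 < c ∧ d < 1 ∧ ∀ i, c ≤ a i ∧ a i ≤ d)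
    (ν₀ : Measure (ℕ → Fin 2)) [IsProbabilityMeasure ν₀]
    (hν₀ : ∀ (s : Finset ℕ) (b : ℕ → Fin 2),
      ν₀ {x | ∀ i ∈ s, x i = b i} =
        ∏ i ∈ s, (if b i = 0 then ENNReal.ofReal (a i) else ENNReal.ofReal (1 - a i)))
    (ν₀' : Measure UnitAddCircle) (hν₀' : ν₀' = Measure.map Φ ν₀)
    (γ : ℝ) (hγ : γ = Real.sqrt 2 - 1)
    (ν : Measure UnitAddCircle)
    (hν : ∀ A : Set UnitAddCircle, MeasurableSet A →
      ν A = ∑' k : ℤ, ENNReal.ofReal (γ ^ (1 + k.natAbs)) *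
        ν₀' ((fun x => x + (((k : ℝ) * θ : ℝ) : UnitAddCircle)) '' A)) :
    (∀ k : ℤ,
      ν.restrict ((fun x => x + (((k : ℝ) * θ : ℝ) : UnitAddCircle)) '' Set.range Φ) ≪
        (Measure.map (fun x => x + (((k : ℝ) * θ : ℝ) : UnitAddCircle)) ν₀').restrict
          ((fun x => x + (((k : ℝ) * θ : ℝ) : UnitAddCircle)) '' Set.range Φ) ∧
      (Measure.map (fun x => x + (((k : ℝ) * θ : ℝ) : UnitAddCircle)) ν₀').restrict
          ((fun x => x + (((k : ℝ) * θ : ℝ) : UnitAddCircle)) '' Set.range Φ) ≪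
        ν.restrict ((fun x => x + (((k : ℝ) * θ : ℝ) : UnitAddCircle)) '' Set.range Φ)) ∧
    (ν.restrict (Set.range Φ) ≪ ν₀'.restrict (Set.range Φ) ∧
      ν₀'.restrict (Set.range Φ) ≪ ν.restrict (Set.range Φ)) := by
  subst hν₀'
  set t : ℕ → ℝ := fun i => e ((m i : ℝ) * θ)
  have hm0' : |t 0| < 1 / 3 := hm0
  have hdec : ∀ i, |t (i + 1)| < |t i| / 3 := hmdec
  have hdigit : ∀ (x : ℕ → Fin 2) (i : ℕ), |((x i : ℕ) : ℝ)| ≤ 1 := fun x i => by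
    rw [Nat.abs_cast]
    exact_mod_cast Nat.lt_succ_iff.1 (x i).2
  have hsum : ∀ x : ℕ → Fin 2, Summable fun i => ((x i : ℕ) : ℝ) * t i := fun x => by
    simpa using summable_mul_tail (δ := fun i => ((x i : ℕ) : ℝ)) hdec (hdigit x) 0
  have hcont : Continuous Φ := by
    rw [funext hΦ]
    refine (AddCircle.continuous_mk' 1).comp (continuous_tsum (u := fun i => |t i|)
      (fun i => ?_) (by simpa using summable_abs_tail hdec 0) fun i x => ?_)
    · exact (((continuous_of_discreteTopology (f := fun b : Fin 2 => ((b : ℕ) : ℝ))).comp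
        (continuous_apply i)).mul continuous_const)
    · rw [Real.norm_eq_abs, abs_mul]
      exact mul_le_of_le_one_left (abs_nonneg _) (hdigit x i)
  have hK : MeasurableSet (Set.range Φ) := (isCompact_range hcont).measurableSet
  have hdiff : ∀ x y x' y', Φ y - Φ x = Φ y' - Φ x' →
      ∀ i, ((y i : ℕ) : ℤ) - (x i : ℕ) = (y' i : ℕ) - (x' i : ℕ) := by
    intro x y x' y' hxy i
    have hS := ((hsum y).sub (hsum x)).tsum_sub ((hsum y').sub (hsum x'))
    rw [(hsum y).tsum_sub (hsum x), (hsum y').tsum_sub (hsum x')] at hS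
    simp only [hΦ] at hxy
    rw [← sub_eq_zero, ← AddCircle.coe_sub, ← AddCircle.coe_sub, ← AddCircle.coe_sub, ← hS,
      AddCircle.coe_eq_zero_iff] at hxy
    obtain ⟨N, hN⟩ := hxy
    refine sub_eq_zero.1 (eq_zero_of_tsum_mul_eq_int hm0' hdec (N := N)
      (δ := fun i => ((y i : ℕ) : ℤ) - (x i : ℕ) - ((y' i : ℕ) - (x' i : ℕ))) (fun j => ?_) ?_ i)
    · generalize y j = a, x j = b, y' j = c, x' j = d
      revert a b c d
      decide
    · rw [zsmul_one] at hN
      rw [hN]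
      refine tsum_congr fun j => ?_
      push_cast
      ring
  obtain ⟨c, d, hc, hd, hcd⟩ := ha
  let p : ℕ → Fin 2 → ENNReal := fun i b =>
    if b = 0 then ENNReal.ofReal (a i) else ENNReal.ofReal (1 - a i)
  have hp0 : ∀ i b, p i b ≠ 0 := fun i b => by
    have := hcd i
    simp only [p]
    split_ifs <;> rw [Ne, ENNReal.ofReal_eq_zero] <;> linarith
  have hp : ∀ i b, p i b ≤ ENNReal.ofReal (max d (1 - c)) := fun i b => by
    have := hcd i
    simp only [p]
    split_ifs <;> refine ENNReal.ofReal_le_ofReal ?_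
    · exact this.2.trans (le_max_left _ _)
    · exact le_trans (by linarith) (le_max_right _ _)
  have hq : ENNReal.ofReal (max d (1 - c)) < 1 := by
    rw [ENNReal.ofReal_lt_one]
    exact max_lt hd (by linarith)
  have hnull : ∀ B, MeasurableSet B → B ⊆ Set.range Φ → ν₀.map Φ B = 0 → ∀ r : UnitAddCircle,
      ν₀.map Φ ((fun x => x + r) '' B) = 0 := fun B hB hBK hB0 r =>
    map_image_add_right_eq_zero (p := p) hcont.measurable hdiff hν₀ hp0 hq hp hB hBK hB0 r
  have hγ0 : 0 < γ := by
    rw [hγ, sub_pos]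
    exact Real.lt_sqrt_of_sq_lt (by norm_num)
  have main : ∀ k : ℤ,
      ν.restrict ((fun x => x + (((k : ℝ) * θ : ℝ) : UnitAddCircle)) '' Set.range Φ) ≪
        (Measure.map (fun x => x + (((k : ℝ) * θ : ℝ) : UnitAddCircle)) (ν₀.map Φ)).restrict
          ((fun x => x + (((k : ℝ) * θ : ℝ) : UnitAddCircle)) '' Set.range Φ) ∧
      (Measure.map (fun x => x + (((k : ℝ) * θ : ℝ) : UnitAddCircle)) (ν₀.map Φ)).restrict
          ((fun x => x + (((k : ℝ) * θ : ℝ) : UnitAddCircle)) '' Set.range Φ) ≪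
        ν.restrict ((fun x => x + (((k : ℝ) * θ : ℝ) : UnitAddCircle)) '' Set.range Φ) := by
    intro k
    set r : UnitAddCircle := (((k : ℝ) * θ : ℝ) : UnitAddCircle) with hr
    have hKr : MeasurableSet ((fun x => x + r) '' Set.range Φ) :=
      (MeasurableEquiv.addRight r).measurableSet_image.2 hK
    constructor
    · refine Measure.AbsolutelyContinuous.mk fun s hs h0 => ?_
      rw [Measure.restrict_apply hs] at h0 ⊢
      have hA := hs.inter hKr
      rw [Measure.map_apply (measurable_add_const r) hA] at h0
      rw [hν _ hA, ENNReal.tsum_eq_zero]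
      intro j
      have h := hnull _ (measurable_add_const r hA) ?_ h0
        (r + (((j : ℝ) * θ : ℝ) : UnitAddCircle))
      · rw [mul_eq_zero]
        right
        convert h using 2
        rw [← Set.image_preimage_eq (s ∩ _) (AddGroup.addRight_bijective r).2, Set.image_image]
        simp only [add_assoc, Set.preimage_image_eq _ (add_left_injective r)]
      · rintro x ⟨-, z, hz, hzx⟩
        rwa [← add_right_cancel hzx]
    · refine Measure.AbsolutelyContinuous.restrict (Measure.AbsolutelyContinuous.mk
        fun s hs h0 => ?_) _
      rw [hν s hs, ENNReal.tsum_eq_zero] at h0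
      rw [Measure.map_apply (measurable_add_const r) hs]
      have h := (mul_eq_zero.1 (h0 (-k))).resolve_left
        (ENNReal.ofReal_pos.2 (pow_pos hγ0 _)).ne'
      convert h using 2
      rw [Int.cast_neg, neg_mul, AddCircle.coe_neg, ← hr, Set.image_add_right, neg_neg]
  exact ⟨main, by simpa using main 0⟩
end

section
/- The measure ν is a non-atomic Borel probability measure on 𝕋 which is mutually singular with the Haar (Lebesgue) measure on 𝕋, is σ-quasi-invariant (ν and the pushforward ν∘σ⁻¹ are mutually absolutely continuous), and is ergodic with respect to σ: every Borel set A ⊆ 𝕋 with ν(σ(A) Δ A) = 0 satisfies ν(A) = 0 or ν(A) = 1. -/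
open MeasureTheory

open ProbabilityTheory

/-- The real number `∑ xᵢ tᵢ` attached to a binary sequence `x` and a weight sequence `t`. -/
noncomputable def binarySum (t : ℕ → ℝ) (x : ℕ → Fin 2) : ℝ :=
  ∑' i, ((x i : ℕ) : ℝ) * t i

section BinarySum

variable {t : ℕ → ℝ}

lemma abs_add_le_of_lt_third (ht : ∀ i, |t (i + 1)| < |t i| / 3) (n i : ℕ) :
    |t (i + n)| ≤ |t n| * (1 / 3) ^ i := by
  induction i with
  | zero => simp
  | succ i ih =>
    have h := ht (i + n)
    rw [show i + 1 + n = i + n + 1 by ring, pow_succ]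
    linarith

lemma abs_le_third_pow (ht0 : |t 0| < 1 / 3) (ht : ∀ i, |t (i + 1)| < |t i| / 3) (n : ℕ) :
    |t n| ≤ (1 / 3) ^ n := by
  have h := abs_add_le_of_lt_third ht 0 n
  have : (0 : ℝ) ≤ (1 / 3) ^ n := by positivity
  rw [add_zero] at h
  nlinarith

lemma summable_mul_of_lt_third (ht : ∀ i, |t (i + 1)| < |t i| / 3) {u : ℕ → ℝ}
    (hu : ∀ i, |u i| ≤ 1) : Summable fun i => u i * t i := by
  refine Summable.of_norm_bounded
    ((summable_geometric_of_lt_one (r := 1 / 3) (by norm_num) (by norm_num)).mul_left |t 0|)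
    fun i => ?_
  have h := abs_add_le_of_lt_third ht 0 i
  rw [Real.norm_eq_abs, abs_mul]
  exact (mul_le_of_le_one_left (abs_nonneg _) (hu i)).trans h

lemma abs_tsum_tail_le (ht : ∀ i, |t (i + 1)| < |t i| / 3) {u : ℕ → ℝ}
    (hu : ∀ i, |u i| ≤ 1) (n : ℕ) : |∑' i, u (i + n) * t (i + n)| ≤ 3 / 2 * |t n| := by
  have hs : HasSum (fun i : ℕ => |t n| * (1 / 3 : ℝ) ^ i) (3 / 2 * |t n|) := by
    have h := (hasSum_geometric_of_lt_one (r := (1 / 3 : ℝ)) (by norm_num)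
      (by norm_num)).mul_left |t n|
    rwa [show |t n| * (1 - 1 / 3)⁻¹ = 3 / 2 * |t n| by ring] at h
  rw [← Real.norm_eq_abs]
  refine tsum_of_norm_bounded hs fun i => ?_
  rw [Real.norm_eq_abs, abs_mul]
  exact (mul_le_of_le_one_left (abs_nonneg _) (hu _)).trans (abs_add_le_of_lt_third ht n i)

lemma abs_fin_two_sub_le (a b : Fin 2) : |((a : ℕ) : ℝ) - ((b : ℕ) : ℝ)| ≤ 1 := by
  fin_cases a <;> fin_cases b <;> simp

lemma abs_fin_two_sub_of_ne {a b : Fin 2} (h : a ≠ b) :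
    |((a : ℕ) : ℝ) - ((b : ℕ) : ℝ)| = 1 := by
  fin_cases a <;> fin_cases b <;> simp at h ⊢

lemma abs_fin_two_le (a : Fin 2) : |((a : ℕ) : ℝ)| ≤ 1 := by
  simpa using abs_fin_two_sub_le a 0

lemma binarySum_sub (ht : ∀ i, |t (i + 1)| < |t i| / 3) (x y : ℕ → Fin 2) (n : ℕ) :
    binarySum t x - binarySum t y =
      ∑ i ∈ Finset.range n, (((x i : ℕ) : ℝ) - ((y i : ℕ) : ℝ)) * t i +
        ∑' i, (((x (i + n) : ℕ) : ℝ) - ((y (i + n) : ℕ) : ℝ)) * t (i + n) := by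
  rw [(summable_mul_of_lt_third ht (u := fun i => ((x i : ℕ) : ℝ) - ((y i : ℕ) : ℝ))
    fun i => abs_fin_two_sub_le _ _).sum_add_tsum_nat_add n, binarySum, binarySum,
    ← Summable.tsum_sub (summable_mul_of_lt_third ht fun i => abs_fin_two_le _)
      (summable_mul_of_lt_third ht fun i => abs_fin_two_le _)]
  simp only [sub_mul]

lemma abs_binarySum_sub_le (ht : ∀ i, |t (i + 1)| < |t i| / 3) {x y : ℕ → Fin 2} {n : ℕ}
    (hxy : ∀ i < n, x i = y i) : |binarySum t x - binarySum t y| ≤ 3 / 2 * |t n| := by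
  rw [binarySum_sub ht x y n, Finset.sum_eq_zero, zero_add]
  · exact abs_tsum_tail_le ht (u := fun i => ((x i : ℕ) : ℝ) - ((y i : ℕ) : ℝ))
      (fun i => abs_fin_two_sub_le _ _) n
  · intro i hi
    rw [hxy i (Finset.mem_range.1 hi), sub_self, zero_mul]

lemma binarySum_injective (ht : ∀ i, |t (i + 1)| < |t i| / 3) :
    Function.Injective (binarySum t) := by
  classical
  intro x y h
  by_contra hne
  have hex : ∃ n, x n ≠ y n := Function.ne_iff.1 hne
  have hlt : ∀ i < Nat.find hex, x i = y i := fun i hi => not_not.1 (Nat.find_min hex hi)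
  have hn := abs_fin_two_sub_of_ne (Nat.find_spec hex)
  generalize Nat.find hex = n at hlt hn
  have hsub := binarySum_sub ht x y (n + 1)
  have htail := abs_tsum_tail_le ht (u := fun i => ((x i : ℕ) : ℝ) - ((y i : ℕ) : ℝ))
    (fun i => abs_fin_two_sub_le _ _) (n + 1)
  rw [h, sub_self, Finset.sum_range_succ, Finset.sum_eq_zero, zero_add] at hsub
  · have habs : |(((x n : ℕ) : ℝ) - ((y n : ℕ) : ℝ)) * t n| ≤ 3 / 2 * |t (n + 1)| := by
      rw [eq_neg_of_add_eq_zero_left hsub.symm, abs_neg]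
      exact htail
    rw [abs_mul, hn, one_mul] at habs
    have := ht n
    have := abs_nonneg (t n)
    linarith
  · intro i hi
    rw [hlt i (Finset.mem_range.1 hi), sub_self, zero_mul]

lemma continuous_binarySum (ht : ∀ i, |t (i + 1)| < |t i| / 3) :
    Continuous (binarySum t) := by
  refine continuous_tsum (u := fun i => |t i|) (fun i => ?_) ?_ fun i x => ?_
  · exact (continuous_of_discreteTopology (f := fun b : Fin 2 => ((b : ℕ) : ℝ) * t i)).comp
      (continuous_apply i)
  · simpa using (summable_mul_of_lt_third ht (u := fun _ => 1) (by simp)).abs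
  · rw [Real.norm_eq_abs, abs_mul]
    exact mul_le_of_le_one_left (abs_nonneg _) (abs_fin_two_le _)

lemma continuous_coe_binarySum (ht : ∀ i, |t (i + 1)| < |t i| / 3) :
    Continuous fun x => (binarySum t x : UnitAddCircle) :=
  (AddCircle.continuous_mk' 1).comp (continuous_binarySum ht)

lemma coe_binarySum_injective (ht0 : |t 0| < 1 / 3) (ht : ∀ i, |t (i + 1)| < |t i| / 3) :
    Function.Injective fun x => (binarySum t x : UnitAddCircle) := by
  intro x y h
  obtain ⟨k, hk⟩ := (AddCircle.coe_eq_zero_iff (1 : ℝ)).1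
    ((AddCircle.coe_sub 1 (x := binarySum t x) (y := binarySum t y)).trans (sub_eq_zero.2 h))
  have hle := abs_binarySum_sub_le ht (x := x) (y := y) (n := 0) (by simp)
  rw [zsmul_one] at hk
  rw [← hk] at hle
  have hk1 : |(k : ℝ)| < 1 := by linarith
  have hk0 : k = 0 := by
    rw [← Int.abs_lt_one_iff]
    exact_mod_cast hk1
  rw [hk0, Int.cast_zero] at hk
  exact binarySum_injective ht (sub_eq_zero.1 hk.symm)

lemma volume_range_coe_binarySum (ht0 : |t 0| < 1 / 3) (ht : ∀ i, |t (i + 1)| < |t i| / 3) :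
    volume (Set.range fun x => (binarySum t x : UnitAddCircle)) = 0 := by
  have hbound : ∀ n : ℕ, volume (Set.range fun x => (binarySum t x : UnitAddCircle)) ≤
      ENNReal.ofReal (3 * (2 / 3) ^ n) := by
    intro n
    let pad : (Fin n → Fin 2) → ℕ → Fin 2 := fun b i => if h : i < n then b ⟨i, h⟩ else 0
    have hcover : (Set.range fun x => (binarySum t x : UnitAddCircle)) ⊆
        ⋃ b : Fin n → Fin 2, Metric.closedBall (binarySum t (pad b) : UnitAddCircle)
          (3 / 2 * (1 / 3) ^ n) := by
      rintro _ ⟨x, rfl⟩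
      refine Set.mem_iUnion.2 ⟨fun i => x i, ?_⟩
      rw [Metric.mem_closedBall, dist_eq_norm]
      dsimp only
      rw [← AddCircle.coe_sub]
      refine (QuotientAddGroup.norm_mk_le_norm).trans ?_
      refine (abs_binarySum_sub_le ht (n := n) fun i hi => ?_).trans ?_
      · simp [pad, hi]
      · exact mul_le_mul_of_nonneg_left (abs_le_third_pow ht0 ht n) (by norm_num)
    refine (measure_mono hcover).trans ((measure_iUnion_fintype_le _ _).trans ?_)
    simp only [AddCircle.volume_closedBall, Finset.sum_const, Finset.card_univ, Fintype.card_fun,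
      Fintype.card_fin]
    rw [nsmul_eq_mul, ← ENNReal.ofReal_natCast, ← ENNReal.ofReal_mul (by positivity)]
    refine ENNReal.ofReal_le_ofReal ?_
    push_cast
    calc (2 : ℝ) ^ n * min 1 (2 * (3 / 2 * (1 / 3) ^ n))
        ≤ 2 ^ n * (2 * (3 / 2 * (1 / 3) ^ n)) :=
          mul_le_mul_of_nonneg_left (min_le_right _ _) (by positivity)
      _ = 3 * (2 / 3) ^ n := by
          rw [div_pow, div_pow, one_pow]
          ring
  have hlim : Filter.Tendsto (fun n : ℕ => ENNReal.ofReal (3 * (2 / 3) ^ n)) Filter.atTop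
      (nhds 0) := by
    have h := (tendsto_pow_atTop_nhds_zero_of_lt_one (r := (2 / 3 : ℝ)) (by norm_num)
      (by norm_num)).const_mul 3
    simpa using ENNReal.tendsto_ofReal h
  exact le_antisymm (ge_of_tendsto' hlim hbound) zero_le

end BinarySum

section ProductMeasure

variable {a : ℕ → ℝ} {μ : Measure (ℕ → Fin 2)}

lemma measure_singleton_eq_zero_of_cylinder
    (ha : ∃ c d : ℝ, 0 < c ∧ d < 1 ∧ ∀ i, c ≤ a i ∧ a i ≤ d)
    (hμ : ∀ (s : Finset ℕ) (b : ℕ → Fin 2), μ {x | ∀ i ∈ s, x i = b i} =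
      ∏ i ∈ s, (if b i = 0 then ENNReal.ofReal (a i) else ENNReal.ofReal (1 - a i)))
    (b : ℕ → Fin 2) : μ {b} = 0 := by
  obtain ⟨c, d, hc, hd, hcd⟩ := ha
  have hbound : ∀ n : ℕ, μ {b} ≤ ENNReal.ofReal (max d (1 - c)) ^ n := by
    intro n
    have hsub : ({b} : Set (ℕ → Fin 2)) ⊆ {x | ∀ i ∈ Finset.range n, x i = b i} := by
      rintro _ rfl i _
      rfl
    refine (measure_mono hsub).trans ?_
    rw [hμ]
    refine (Finset.prod_le_pow_card _ _ (ENNReal.ofReal (max d (1 - c))) fun i _ => ?_).trans_eq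
      (by rw [Finset.card_range])
    split_ifs
    · exact ENNReal.ofReal_le_ofReal ((hcd i).2.trans (le_max_left _ _))
    · exact ENNReal.ofReal_le_ofReal ((sub_le_sub_left (hcd i).1 1).trans (le_max_right _ _))
  have hlt : ENNReal.ofReal (max d (1 - c)) < 1 := by
    rw [← ENNReal.ofReal_one]
    exact (ENNReal.ofReal_lt_ofReal_iff one_pos).2 (max_lt hd (by linarith))
  exact le_antisymm (ge_of_tendsto' (ENNReal.tendsto_pow_atTop_nhds_zero_of_lt_one hlt) hbound)
    zero_le

lemma iIndep_comap_eval_of_cylinder {p : ℕ → Fin 2 → ENNReal}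
    (hμ : ∀ (s : Finset ℕ) (b : ℕ → Fin 2), μ {x | ∀ i ∈ s, x i = b i} = ∏ i ∈ s, p i (b i)) :
    iIndep (fun i : ℕ => MeasurableSpace.comap (fun x : ℕ → Fin 2 => x i) inferInstance) μ := by
  refine iIndepSets.iIndep (fun i => (measurable_pi_apply i).comap_le)
    (fun i => Set.range fun b : Fin 2 => (fun x : ℕ → Fin 2 => x i) ⁻¹' {b}) (fun i => ?_)
    (fun i => ?_) ?_
  · rintro _ ⟨b, rfl⟩ _ ⟨b', rfl⟩ ⟨x, hx, hx'⟩
    obtain rfl : x i = b := hx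
    obtain rfl : x i = b' := hx'
    exact ⟨x i, (Set.inter_self _).symm⟩
  · refine le_antisymm ?_ (MeasurableSpace.generateFrom_le ?_)
    · rintro _ ⟨S, -, rfl⟩
      rw [← Set.biUnion_of_singleton S, Set.preimage_iUnion₂]
      refine MeasurableSet.biUnion S.to_countable fun b _ => ?_
      exact MeasurableSpace.measurableSet_generateFrom ⟨b, rfl⟩
    · rintro _ ⟨b, rfl⟩
      exact ⟨{b}, measurableSet_singleton b, rfl⟩
  · rw [iIndepSets_iff]
    intro s f hf
    choose! b hb using hf
    have hinter : (⋂ i ∈ s, f i) = {x | ∀ i ∈ s, x i = b i} := by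
      ext x
      simp only [Set.mem_iInter, Set.mem_ofPred_eq]
      refine forall₂_congr fun i hi => ?_
      rw [← hb i hi]
      rfl
    rw [hinter, hμ]
    refine Finset.prod_congr rfl fun i hi => ?_
    have hsingle := hμ {i} b
    rw [Finset.prod_singleton] at hsingle
    rw [← hsingle, ← hb i hi]
    congr 1
    ext x
    simp

/-- Zero-one law for measurable sets invariant under zeroing finitely many coordinates. -/
lemma measure_zero_or_one_of_finite_change
    (hind : iIndep (fun i : ℕ => MeasurableSpace.comap (fun x : ℕ → Fin 2 => x i) inferInstance) μ)
    {B : Set (ℕ → Fin 2)} (hB : MeasurableSet B)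
    (hinv : ∀ (n : ℕ) (x : ℕ → Fin 2), (fun i => if i < n then 0 else x i) ∈ B ↔ x ∈ B) :
    μ B = 0 ∨ μ B = 1 := by
  refine measure_zero_or_one_of_measurableSet_limsup_atTop
    (fun i => (measurable_pi_apply i).comap_le) hind ?_
  rw [Filter.limsup_eq_iInf_iSup_of_nat, MeasurableSpace.measurableSet_iInf]
  intro n
  have hmeas : Measurable[⨆ i, ⨆ (_ : i ≥ n), MeasurableSpace.comap
      (fun x : ℕ → Fin 2 => x i) inferInstance]
      (fun (x : ℕ → Fin 2) i => if i < n then 0 else x i) := by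
    refine @measurable_pi_lambda _ _ _ (_) _ _ fun i => ?_
    by_cases hi : i < n
    · simp only [hi, if_true]
      exact @measurable_const _ _ _ (_) _
    · simp only [hi, if_false]
      exact (comap_measurable fun x : ℕ → Fin 2 => x i).mono
        (le_iSup₂_of_le i (not_lt.1 hi) le_rfl) le_rfl
  have hpre := hmeas hB
  rwa [show (fun (x : ℕ → Fin 2) i => if i < n then 0 else x i) ⁻¹' B = B from
    Set.ext fun x => hinv n x] at hpre

end ProductMeasure

lemma hasSum_pow_one_add_natAbs {r : ℝ} (h0 : 0 ≤ r) (h1 : r < 1) :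
    HasSum (fun k : ℤ => r ^ (1 + k.natAbs)) (r * (1 + r) * (1 - r)⁻¹) := by
  have hgeom := hasSum_geometric_of_lt_one h0 h1
  have hnat : HasSum (fun n : ℕ => r ^ (1 + (n : ℤ).natAbs)) (r * (1 - r)⁻¹) := by
    simpa only [pow_add, pow_one, Int.natAbs_natCast] using hgeom.mul_left r
  have hneg : HasSum (fun n : ℕ => r ^ (1 + (-((n : ℤ) + 1)).natAbs)) (r ^ 2 * (1 - r)⁻¹) := by
    have heq : ∀ n : ℕ, r ^ (1 + (-((n : ℤ) + 1)).natAbs) = r ^ 2 * r ^ n := by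
      intro n
      rw [← pow_add]
      congr 1
      omega
    simpa only [heq] using hgeom.mul_left (r ^ 2)
  have hsum := HasSum.of_nat_of_neg_add_one (f := fun k : ℤ => r ^ (1 + k.natAbs)) hnat hneg
  rwa [show r * (1 - r)⁻¹ + r ^ 2 * (1 - r)⁻¹ = r * (1 + r) * (1 - r)⁻¹ by ring] at hsum

lemma tsum_ofReal_sqrt_two_sub_one_pow :
    ∑' k : ℤ, ENNReal.ofReal ((√2 - 1) ^ (1 + k.natAbs)) = 1 := by
  have hsq : √2 * √2 = 2 := Real.mul_self_sqrt (by norm_num)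
  have h0 : 0 ≤ √2 - 1 := by
    rw [sub_nonneg, Real.le_sqrt] <;> norm_num
  have h1 : √2 - 1 < 1 := by nlinarith
  have hsum := hasSum_pow_one_add_natAbs h0 h1
  rw [← ENNReal.ofReal_tsum_of_nonneg (fun k => pow_nonneg h0 _) hsum.summable, hsum.tsum_eq,
    ← div_eq_mul_inv, (div_eq_one_iff_eq (sub_pos.2 h1).ne').2 (by linarith), ENNReal.ofReal_one]

section Rotation

variable {θ : ℝ}

lemma add_neg_coe_intCast_mul_add (x : UnitAddCircle) (j k : ℤ) :
    x + -((j * θ : ℝ) : UnitAddCircle) + -((k * θ : ℝ) : UnitAddCircle) =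
      x + -(((j + k : ℤ) * θ : ℝ) : UnitAddCircle) := by
  rw [Int.cast_add, add_mul, AddCircle.coe_add]
  abel

/-- A set that is almost invariant under a rotation along every rotated copy of a measure agrees
almost everywhere with the intersection of all its rotated copies. -/
lemma preimage_ae_eq_of_symmDiff {ρ : Measure UnitAddCircle} {A : Set UnitAddCircle}
    (h : ∀ k : ℤ, ρ ((fun x => x + -((k * θ : ℝ) : UnitAddCircle)) ⁻¹'
      symmDiff ((fun x => x + (θ : UnitAddCircle)) '' A) A) = 0) (k : ℤ) :
    (fun x => x + -((k * θ : ℝ) : UnitAddCircle)) ⁻¹' A =ᵐ[ρ] A := by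
  have hstep : ∀ k : ℤ, (fun x => x + -(((k + 1 : ℤ) * θ : ℝ) : UnitAddCircle)) ⁻¹' A =ᵐ[ρ]
      (fun x => x + -((k * θ : ℝ) : UnitAddCircle)) ⁻¹' A := by
    intro k
    rw [← measure_symmDiff_eq_zero_iff, ← h k, Set.image_add_right]
    congr 1
    ext x
    have := add_neg_coe_intCast_mul_add (θ := θ) x k 1
    rw [Int.cast_one, one_mul] at this
    simp only [Set.mem_symmDiff, Set.mem_preimage, this]
  induction k with
  | zero => simpa using Filter.EventuallyEq.refl _ A
  | succ n ih => exact (hstep n).trans ih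
  | pred n ih => exact (by simpa using (hstep (-n - 1)).symm : _ =ᵐ[ρ] _).trans ih

end Rotation

/-- The measure ν = Σ_k γ^{1+|k|} ν₀'∘σᵏ is a non-atomic probability
measure on 𝕋 = ℝ/ℤ, mutually singular with Haar (Lebesgue) measure, σ-quasi-invariant,
and ergodic for the irrational rotation σ(x) = x + θ. -/
theorem stmt18
    (θ : ℝ) (hθirr : Irrational θ) (hθmem : θ ∈ Set.Ioo (0 : ℝ) 1)
    (e : ℝ → ℝ)
    (he : ∀ x : ℝ, e x ∈ Set.Ioc (-(1 / 2) : ℝ) (1 / 2) ∧ ∃ k : ℤ, x - e x = k)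
    (m : ℕ → ℕ) (hmono : StrictMono m) (hpos : ∀ i, 0 < m i)
    (hm0 : |e ((m 0 : ℝ) * θ)| < 1 / 3)
    (hmdec : ∀ i : ℕ, |e ((m (i + 1) : ℝ) * θ)| < |e ((m i : ℝ) * θ)| / 3)
    (Φ : (ℕ → Fin 2) → UnitAddCircle)
    (hΦ : ∀ x : ℕ → Fin 2,
      Φ x = ((∑' i : ℕ, ((x i : ℕ) : ℝ) * e ((m i : ℝ) * θ) : ℝ) : UnitAddCircle))
    (a : ℕ → ℝ) (ha : ∃ c d : ℝ, 0 < c ∧ d < 1 ∧ ∀ i, c ≤ a i ∧ a i ≤ d)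
    (ν₀ : Measure (ℕ → Fin 2)) [IsProbabilityMeasure ν₀]
    (hν₀ : ∀ (s : Finset ℕ) (b : ℕ → Fin 2),
      ν₀ {x | ∀ i ∈ s, x i = b i} =
        ∏ i ∈ s, (if b i = 0 then ENNReal.ofReal (a i) else ENNReal.ofReal (1 - a i)))
    (ν₀' : Measure UnitAddCircle) (hν₀' : ν₀' = Measure.map Φ ν₀)
    (γ : ℝ) (hγ : γ = Real.sqrt 2 - 1)
    (ν : Measure UnitAddCircle)
    (hν : ∀ A : Set UnitAddCircle, MeasurableSet A →
      ν A = ∑' k : ℤ, ENNReal.ofReal (γ ^ (1 + k.natAbs)) *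
        ν₀' ((fun x => x + (((k : ℝ) * θ : ℝ) : UnitAddCircle)) '' A)) :
    IsProbabilityMeasure ν ∧
    (∀ x : UnitAddCircle, ν {x} = 0) ∧
    ν.MutuallySingular volume ∧
    (ν ≪ ν.map (fun x => x + (θ : UnitAddCircle)) ∧
      ν.map (fun x => x + (θ : UnitAddCircle)) ≪ ν) ∧
    (∀ A : Set UnitAddCircle, MeasurableSet A →
      ν (symmDiff ((fun x => x + (θ : UnitAddCircle)) '' A) A) = 0 →
      ν A = 0 ∨ ν A = 1) := by
  have hΦ' : Φ = fun x => (binarySum (fun i => e ((m i : ℝ) * θ)) x : UnitAddCircle) := funext hΦ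
  have hcont : Continuous Φ := hΦ' ▸ continuous_coe_binarySum hmdec
  have hinj : Function.Injective Φ := hΦ' ▸ coe_binarySum_injective hm0 hmdec
  have hvol : volume (Set.range Φ) = 0 := hΦ' ▸ volume_range_coe_binarySum hm0 hmdec
  have hmeas : ∀ k : ℤ, Measurable fun x : UnitAddCircle => x + -((k * θ : ℝ) : UnitAddCircle) :=
    fun k => measurable_add_const _
  have : IsProbabilityMeasure ν₀' :=
    hν₀' ▸ Measure.isProbabilityMeasure_map hcont.measurable.aemeasurable
  simp only [Set.image_add_right] at hν
  have hγpos : 0 < γ := by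
    rw [hγ, sub_pos, Real.lt_sqrt] <;> norm_num
  have hzero : ∀ A : Set UnitAddCircle, MeasurableSet A →
      (ν A = 0 ↔ ∀ k : ℤ, ν₀' ((fun x => x + -((k * θ : ℝ) : UnitAddCircle)) ⁻¹' A) = 0) := by
    intro A hA
    rw [hν A hA, ENNReal.tsum_eq_zero]
    refine forall_congr' fun k => ?_
    rw [mul_eq_zero, or_iff_right]
    exact (ENNReal.ofReal_pos.2 (pow_pos hγpos _)).ne'
  have hconst : ∀ A : Set UnitAddCircle, MeasurableSet A →
      (∀ k : ℤ, ν₀' ((fun x => x + -((k * θ : ℝ) : UnitAddCircle)) ⁻¹' A) = ν₀' A) →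
      ν A = ν₀' A := by
    intro A hA h
    simp only [hν A hA, h]
    rw [ENNReal.tsum_mul_right, hγ, tsum_ofReal_sqrt_two_sub_one_pow, one_mul]
  refine ⟨⟨?_⟩, fun x => ?_, ?_, ⟨?_, ?_⟩, fun A hA h => ?_⟩
  · rw [hconst _ MeasurableSet.univ fun k => by rw [Set.preimage_univ], measure_univ]
  · rw [hzero _ (measurableSet_singleton x)]
    intro k
    rw [hν₀', Measure.map_apply hcont.measurable (hmeas k (measurableSet_singleton x)),
      ← Set.preimage_comp]
    have hsub := (Set.subsingleton_singleton (a := x)).preimage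
      ((add_left_injective (-((k * θ : ℝ) : UnitAddCircle))).comp hinj)
    rcases hsub.eq_empty_or_singleton with hp | ⟨p, hp⟩
    · exact (congrArg ν₀ hp).trans measure_empty
    · exact (congrArg ν₀ hp).trans (measure_singleton_eq_zero_of_cylinder ha hν₀ p)
  · have hK : MeasurableSet (Set.range Φ) := (isCompact_range hcont).measurableSet
    have hU : MeasurableSet (⋃ k : ℤ, (fun x => x + ((k * θ : ℝ) : UnitAddCircle)) ⁻¹'
        Set.range Φ) := MeasurableSet.iUnion fun k => measurable_add_const _ hK
    refine ⟨_, hU.compl, ?_, ?_⟩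
    · rw [hzero _ hU.compl]
      intro k
      rw [hν₀', Measure.map_apply hcont.measurable (hmeas k hU.compl)]
      convert measure_empty (μ := ν₀)
      refine Set.eq_empty_of_forall_notMem fun x hx => hx (Set.mem_iUnion.2 ⟨k, x, ?_⟩)
      exact (neg_add_cancel_right _ _).symm
    · rw [compl_compl, measure_iUnion_null_iff]
      intro k
      rw [measure_preimage_add_right, hvol]
  · refine Measure.AbsolutelyContinuous.mk fun A hA h => ?_
    rw [Measure.map_apply (measurable_add_const _) hA,
      hzero _ (measurable_add_const _ hA)] at h
    rw [hzero A hA]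
    intro k
    have hk := h (k + 1)
    rw [← Set.preimage_comp] at hk
    convert hk using 3
    ext x
    simp only [Function.comp_apply, Int.cast_add, Int.cast_one, add_mul, one_mul,
      AddCircle.coe_add, neg_add, add_assoc, neg_add_cancel, add_zero]
  · refine Measure.AbsolutelyContinuous.mk fun A hA h => ?_
    rw [Measure.map_apply (measurable_add_const _) hA,
      hzero _ (measurable_add_const _ hA)]
    rw [hzero A hA] at h
    intro k
    have hk := h (k - 1)
    rw [← Set.preimage_comp]
    convert hk using 3
    ext x
    simp [sub_mul, add_assoc, neg_add_eq_sub]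
  · have hD : MeasurableSet (symmDiff ((fun x => x + (θ : UnitAddCircle)) '' A) A) := by
      rw [Set.image_add_right]
      exact (measurable_add_const _ hA).symmDiff hA
    have hae := preimage_ae_eq_of_symmDiff ((hzero _ hD).1 h)
    have hinter : (⋂ k : ℤ, (fun x => x + -((k * θ : ℝ) : UnitAddCircle)) ⁻¹' A) =ᵐ[ν₀'] A := by
      simpa only [Set.iInter_const] using Filter.EventuallyEq.countable_iInter hae
    have hA' : MeasurableSet (⋂ k : ℤ, (fun x => x + -((k * θ : ℝ) : UnitAddCircle)) ⁻¹' A) :=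
      MeasurableSet.iInter fun k => hmeas k hA
    rw [hconst A hA fun k => measure_congr (hae k), ← measure_congr hinter, hν₀',
      Measure.map_apply hcont.measurable hA']
    refine measure_zero_or_one_of_finite_change
      (iIndep_comap_eval_of_cylinder (p := fun i b =>
        if b = 0 then ENNReal.ofReal (a i) else ENNReal.ofReal (1 - a i)) hν₀)
      (hcont.measurable hA') fun n x => ?_
    obtain ⟨j, hj⟩ : ∃ j : ℤ, Φ (fun i => if i < n then 0 else x i) =
        Φ x + -((j * θ : ℝ) : UnitAddCircle) := by
      refine ⟨∑ i ∈ Finset.range n, ((x i : ℕ) : ℤ) * m i, ?_⟩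
      have hcoe : ∀ i, (e (m i * θ) : UnitAddCircle) = ((m i * θ : ℝ) : UnitAddCircle) := by
        intro i
        obtain ⟨k, hk⟩ := (he (m i * θ)).2
        rw [eq_comm, ← sub_eq_zero, ← AddCircle.coe_sub, hk]
        exact (AddCircle.coe_eq_zero_iff (1 : ℝ)).2 ⟨k, zsmul_one k⟩
      have hsub := binarySum_sub (t := fun i => e ((m i : ℝ) * θ)) hmdec x
        (fun i => if i < n then 0 else x i) n
      simp only [not_lt.2 (Nat.le_add_left n _), if_false, sub_self, zero_mul, tsum_zero,
        add_zero] at hsub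
      rw [← sub_eq_add_neg, eq_sub_iff_add_eq, ← eq_sub_iff_add_eq', hΦ']
      dsimp only
      rw [← AddCircle.coe_sub, hsub]
      push_cast
      rw [Finset.sum_mul]
      have hsum : ∀ f : ℕ → ℝ, ((∑ i ∈ Finset.range n, f i : ℝ) : UnitAddCircle) =
          ∑ i ∈ Finset.range n, (f i : UnitAddCircle) :=
        fun f => map_sum (QuotientAddGroup.mk' (AddSubgroup.zmultiples (1 : ℝ))) f _
      rw [hsum, hsum]
      refine Finset.sum_congr rfl fun i hi => ?_
      rw [if_pos (Finset.mem_range.1 hi), mul_assoc]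
      have hnsmul : ∀ (c : ℕ) (r : ℝ), ((c * r : ℝ) : UnitAddCircle) =
          c • (r : UnitAddCircle) := fun c r => by rw [← nsmul_eq_mul, AddCircle.coe_nsmul]
      simp [hnsmul, hcoe]
    simp only [Set.mem_preimage, Set.mem_iInter, hj, add_neg_coe_intCast_mul_add]
    exact (Equiv.addLeft j).forall_congr_right
      (q := fun k : ℤ => Φ x + -((k * θ : ℝ) : UnitAddCircle) ∈ A)
end

section
/- If a, b ∈ (0,1) and a ≠ b, then the measures ν_a and ν_b on 𝕋 are mutually singular. -/
open MeasureTheory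

open ProbabilityTheory Filter Topology

section LacunarySeries

variable {t : ℕ → ℝ}

lemma abs_le_geometric_of_lacunary (ht : ∀ i, |t (i + 1)| < |t i| / 3) (n j : ℕ) :
    |t (n + j)| ≤ |t n| * (1 / 3) ^ j := by
  induction j with
  | zero => simp
  | succ j ih =>
    have := ht (n + j)
    rw [← add_assoc, pow_succ]
    linarith

lemma summable_abs_of_lacunary (ht : ∀ i, |t (i + 1)| < |t i| / 3) :
    Summable fun i => |t i| := by
  refine Summable.of_nonneg_of_le (fun _ => abs_nonneg _) (fun i => ?_)
    ((summable_geometric_of_lt_one (r := 1 / 3) (by norm_num) (by norm_num)).mul_left |t 0|)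
  simpa using abs_le_geometric_of_lacunary ht 0 i

lemma tsum_abs_le_of_lacunary (ht : ∀ i, |t (i + 1)| < |t i| / 3) (n : ℕ) :
    ∑' j, |t (n + j)| ≤ 3 / 2 * |t n| := by
  have hg := (summable_geometric_of_lt_one (r := (1 / 3 : ℝ)) (by norm_num) (by norm_num))
  calc ∑' j, |t (n + j)| ≤ ∑' j : ℕ, |t n| * (1 / 3) ^ j :=
        ((summable_abs_of_lacunary ht).comp_injective (add_right_injective n)).tsum_le_tsum
          (abs_le_geometric_of_lacunary ht n) (hg.mul_left _)
    _ = 3 / 2 * |t n| := by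
        rw [tsum_mul_left, tsum_geometric_of_lt_one (by norm_num) (by norm_num)]
        ring

lemma summable_mul_of_lacunary (ht : ∀ i, |t (i + 1)| < |t i| / 3) {d : ℕ → ℝ} {C : ℝ}
    (hd : ∀ i, |d i| ≤ C) : Summable fun i => d i * t i := by
  refine Summable.of_abs (Summable.of_nonneg_of_le (fun _ => abs_nonneg _) (fun i => ?_)
    ((summable_abs_of_lacunary ht).mul_left C))
  rw [abs_mul]
  exact mul_le_mul_of_nonneg_right (hd i) (abs_nonneg _)

lemma abs_tsum_mul_le_of_lacunary (ht : ∀ i, |t (i + 1)| < |t i| / 3) {d : ℕ → ℝ}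
    (hd : ∀ i, |d i| ≤ 2) (n : ℕ) : |∑' j, d (n + j) * t (n + j)| ≤ 3 * |t n| := by
  have hs : Summable fun j => |t (n + j)| :=
    (summable_abs_of_lacunary ht).comp_injective (add_right_injective n)
  have hle : ∀ j, |d (n + j) * t (n + j)| ≤ 2 * |t (n + j)| := fun j => by
    rw [abs_mul]
    exact mul_le_mul_of_nonneg_right (hd _) (abs_nonneg _)
  have h : |∑' j, d (n + j) * t (n + j)| ≤ ∑' j, 2 * |t (n + j)| :=
    tsum_of_norm_bounded (f := fun j => d (n + j) * t (n + j)) (hs.mul_left 2).hasSum hle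
  rw [tsum_mul_left] at h
  linarith [tsum_abs_le_of_lacunary ht n]

/-- An integer combination of a lacunary sequence with coefficients bounded by `2` is an integer
only if all coefficients vanish. -/
lemma eq_zero_of_lacunary_tsum_eq_int (ht0 : |t 0| < 1 / 3) (ht : ∀ i, |t (i + 1)| < |t i| / 3)
    {d : ℕ → ℤ} (hd : ∀ i, |d i| ≤ 2) {z : ℤ} (hz : ∑' i, (d i : ℝ) * t i = z) (i : ℕ) :
    d i = 0 := by
  have hd' : ∀ i, |(d i : ℝ)| ≤ 2 := fun i => by exact_mod_cast hd i
  have hz0 : z = 0 := by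
    have h := abs_tsum_mul_le_of_lacunary ht hd' 0
    simp only [zero_add, hz] at h
    have : |(z : ℝ)| < 1 := by linarith
    exact Int.abs_lt_one_iff.mp (by exact_mod_cast this)
  subst hz0
  induction i using Nat.strong_induction_on with
  | _ n ih =>
    by_contra hn
    have hsum := (summable_mul_of_lacunary ht hd').sum_add_tsum_nat_add (n + 1)
    rw [hz, Finset.sum_range_succ, Finset.sum_eq_zero, zero_add] at hsum
    · have h := abs_tsum_mul_le_of_lacunary ht hd' (n + 1)
      have hcomm : ∑' j, (d (j + (n + 1)) : ℝ) * t (j + (n + 1)) =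
          ∑' j, (d (n + 1 + j) : ℝ) * t (n + 1 + j) := by
        simp only [add_comm]
      rw [hcomm] at hsum
      have h1 : |(d n : ℝ) * t n| ≤ 3 * |t (n + 1)| := by
        rw [show (d n : ℝ) * t n = -∑' j, (d (n + 1 + j) : ℝ) * t (n + 1 + j) by
          push_cast at hsum; linarith, abs_neg]
        exact h
      have h2 : (1 : ℝ) ≤ |(d n : ℝ)| := by exact_mod_cast Int.one_le_abs hn
      rw [abs_mul] at h1
      nlinarith [ht n, abs_nonneg (t n)]
    · intro i hi
      simp [ih i (Finset.mem_range.mp hi)]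

lemma abs_fin_two_cast_le (c : Fin 2) : |((c : ℕ) : ℝ)| ≤ 1 := by
  fin_cases c <;> simp

lemma continuous_lacunary_tsum (ht : ∀ i, |t (i + 1)| < |t i| / 3) :
    Continuous fun x : ℕ → Fin 2 => ∑' i, ((x i : ℕ) : ℝ) * t i := by
  refine continuous_tsum (fun i => ?_) (summable_abs_of_lacunary ht) (fun i x => ?_)
  · exact ((continuous_of_discreteTopology (f := fun c : Fin 2 => ((c : ℕ) : ℝ))).comp
      (continuous_apply i)).mul continuous_const
  · rw [Real.norm_eq_abs, abs_mul]
    exact mul_le_of_le_one_left (abs_nonneg _) (abs_fin_two_cast_le _)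

/-- The difference of two points in the image of the coding map determines the difference of
their codes. -/
lemma sub_eq_sub_of_lacunary_coding (ht0 : |t 0| < 1 / 3) (ht : ∀ i, |t (i + 1)| < |t i| / 3)
    {Φ : (ℕ → Fin 2) → UnitAddCircle}
    (hΦ : ∀ x, Φ x = ((∑' i, ((x i : ℕ) : ℝ) * t i : ℝ) : UnitAddCircle))
    {x y x' y' : ℕ → Fin 2} (h : Φ x - Φ y = Φ x' - Φ y') (i : ℕ) :
    ((x i : ℕ) : ℤ) - (y i : ℕ) = ((x' i : ℕ) : ℤ) - (y' i : ℕ) := by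
  have hs : ∀ x : ℕ → Fin 2, Summable fun i => ((x i : ℕ) : ℝ) * t i := fun x =>
    summable_mul_of_lacunary ht (fun i => abs_fin_two_cast_le (x i))
  rw [hΦ, hΦ, hΦ, hΦ, ← AddCircle.coe_sub, ← AddCircle.coe_sub, ← sub_eq_zero,
    ← AddCircle.coe_sub, AddCircle.coe_eq_zero_iff, ← (hs x).tsum_sub (hs y),
    ← (hs x').tsum_sub (hs y'), ← ((hs x).sub (hs y)).tsum_sub ((hs x').sub (hs y'))] at h
  obtain ⟨z, hz⟩ := h
  have key := eq_zero_of_lacunary_tsum_eq_int ht0 ht (z := z)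
    (d := fun i => (((x i : ℕ) : ℤ) - (y i : ℕ)) - (((x' i : ℕ) : ℤ) - (y' i : ℕ)))
    (fun i => by rw [abs_le]; omega)
    (by
      rw [show (z : ℝ) = z • (1 : ℝ) by simp, hz]
      refine tsum_congr fun i => ?_
      push_cast
      ring) i
  exact sub_eq_zero.mp key

end LacunarySeries

section BernoulliMeasure

variable {a b : ℝ} {μ ν : Measure (ℕ → Fin 2)}

/-- `μ` is the product measure on `{0,1}^ℕ` giving mass `a` to the symbol `0`, expressed through
its values on cylinders. -/
def IsBernoulliMeasure (a : ℝ) (μ : Measure (ℕ → Fin 2)) : Prop :=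
  ∀ (s : Finset ℕ) (c : ℕ → Fin 2), μ {x | ∀ i ∈ s, x i = c i} =
    ∏ i ∈ s, (if c i = 0 then ENNReal.ofReal a else ENNReal.ofReal (1 - a))

lemma IsBernoulliMeasure.measure_coord (h : IsBernoulliMeasure a μ) (i : ℕ) (c : Fin 2) :
    μ {x | x i = c} = if c = 0 then ENNReal.ofReal a else ENNReal.ofReal (1 - a) := by
  simpa using h {i} fun _ => c

lemma IsBernoulliMeasure.indepFun (h : IsBernoulliMeasure a μ) [IsProbabilityMeasure μ]
    {i j : ℕ} (hij : i ≠ j) :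
    IndepFun (fun x : ℕ → Fin 2 => x i) (fun x => x j) μ := by
  rw [indepFun_iff_map_prod_eq_prod_map_map (measurable_pi_apply i).aemeasurable
    (measurable_pi_apply j).aemeasurable]
  refine Measure.ext_of_singleton fun ⟨c, d⟩ => ?_
  rw [← Set.singleton_prod_singleton, Measure.prod_prod,
    Measure.map_apply (by fun_prop) (by measurability),
    Measure.map_apply (by fun_prop) (by measurability),
    Measure.map_apply (by fun_prop) (by measurability)]
  have h2 := h {i, j} (fun k => if k = i then c else d)
  have hi := h.measure_coord i c
  have hj := h.measure_coord j d
  rw [Finset.prod_pair hij] at h2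
  simp only [Finset.mem_insert, Finset.mem_singleton, forall_eq_or_imp, forall_eq, if_true,
    if_neg hij.symm] at h2
  rw [← hi, ← hj] at h2
  exact h2

/-- Sequences in which the symbol `1` has asymptotic frequency `1 - a`. -/
def frequencySet (a : ℝ) : Set (ℕ → Fin 2) :=
  {x | Tendsto (fun n : ℕ => (∑ i ∈ Finset.range n, ((x i : ℕ) : ℝ)) / n) atTop (𝓝 (1 - a))}

lemma measurable_fin_two_coord (i : ℕ) : Measurable fun x : ℕ → Fin 2 => ((x i : ℕ) : ℝ) :=
  (measurable_of_countable fun c : Fin 2 => ((c : ℕ) : ℝ)).comp (measurable_pi_apply i)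

lemma measurableSet_frequencySet (a : ℝ) : MeasurableSet (frequencySet a) :=
  measurableSet_tendsto _ fun _ =>
    (Finset.measurable_sum _ fun i _ => measurable_fin_two_coord i).div_const _

lemma disjoint_frequencySet (hab : a ≠ b) : Disjoint (frequencySet a) (frequencySet b) := by
  rw [Set.disjoint_left]
  intro x ha hb
  have := tendsto_nhds_unique (a := 1 - a) (b := 1 - b) ha hb
  exact hab (by linarith)

lemma mem_frequencySet_of_finite_ne {x y : ℕ → Fin 2} (hxy : {i | x i ≠ y i}.Finite)
    (hx : x ∈ frequencySet a) : y ∈ frequencySet a := by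
  obtain ⟨N, hN⟩ := hxy.bddAbove
  have hN' : ∀ i, N < i → x i = y i := fun i hi => by
    by_contra hne
    exact absurd (hN hne) (by omega)
  have hconst := tendsto_const_div_atTop_nhds_zero_nat
    (∑ i ∈ Finset.range (N + 1), (((y i : ℕ) : ℝ) - ((x i : ℕ) : ℝ)))
  have hadd := Tendsto.add (show Tendsto _ _ _ from hx) hconst
  rw [add_zero] at hadd
  refine hadd.congr' ?_
  filter_upwards [eventually_ge_atTop (N + 1)] with n hn
  rw [← add_div]
  congr 1
  have : ∑ i ∈ Finset.range (N + 1), (((y i : ℕ) : ℝ) - ((x i : ℕ) : ℝ)) =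
      ∑ i ∈ Finset.range n, (((y i : ℕ) : ℝ) - ((x i : ℕ) : ℝ)) := by
    refine Finset.sum_subset (Finset.range_mono hn) fun i _ hi => ?_
    rw [Finset.mem_range] at hi
    rw [hN' i (by omega), sub_self]
  rw [this, Finset.sum_sub_distrib]
  ring

lemma IsBernoulliMeasure.ae_mem_frequencySet (h : IsBernoulliMeasure a μ)
    [IsProbabilityMeasure μ] (ha : a ∈ Set.Ioo (0 : ℝ) 1) : ∀ᵐ x ∂μ, x ∈ frequencySet a := by
  let X : ℕ → (ℕ → Fin 2) → ℝ := fun i x => ((x i : ℕ) : ℝ)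
  have hind : ∀ i, X i = Set.indicator {x : ℕ → Fin 2 | x i = 1} 1 := fun i => by
    ext x
    by_cases hx : x i = 1
    · simp [X, hx]
    · simp [X, show x i = 0 by omega]
  have hms : ∀ i, MeasurableSet {x : ℕ → Fin 2 | x i = 1} := fun i =>
    measurable_pi_apply i (measurableSet_singleton 1)
  have hint : Integrable (X 0) μ := by
    rw [hind]
    exact (integrable_const (1 : ℝ)).indicator (hms 0)
  have hident : ∀ i, IdentDistrib (X i) (X 0) μ μ := fun i => by
    have : IdentDistrib (fun x : ℕ → Fin 2 => x i) (fun x => x 0) μ μ := by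
      refine ⟨(measurable_pi_apply i).aemeasurable, (measurable_pi_apply 0).aemeasurable,
        Measure.ext_of_singleton fun c => ?_⟩
      rw [Measure.map_apply (by fun_prop) (by measurability),
        Measure.map_apply (by fun_prop) (by measurability)]
      exact (h.measure_coord i c).trans (h.measure_coord 0 c).symm
    exact this.comp (measurable_of_countable fun c : Fin 2 => ((c : ℕ) : ℝ))
  have hmean : ∫ x, X 0 x ∂μ = 1 - a := by
    rw [hind, integral_indicator_one (hms 0), measureReal_def, h.measure_coord]
    simp [ha.2.le]
  have hlaw := strong_law_ae_real X hint
    (fun i j hij => (h.indepFun hij).comp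
      (measurable_of_countable fun c : Fin 2 => ((c : ℕ) : ℝ))
      (measurable_of_countable fun c : Fin 2 => ((c : ℕ) : ℝ))) hident
  rw [hmean] at hlaw
  exact hlaw

/-- Prescribing infinitely many coordinates gives a null set. -/
lemma IsBernoulliMeasure.measure_eq_zero_of_infinite (h : IsBernoulliMeasure a μ)
    (ha : a ∈ Set.Ioo (0 : ℝ) 1) {I : Set ℕ} (hI : I.Infinite) (c : ℕ → Fin 2) :
    μ {x | ∀ i ∈ I, x i = c i} = 0 := by
  set r : ENNReal := max (ENNReal.ofReal a) (ENNReal.ofReal (1 - a)) with hr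
  have hr1 : r < 1 := by
    rw [hr, max_lt_iff, ENNReal.ofReal_lt_one, ENNReal.ofReal_lt_one]
    exact ⟨ha.2, by linarith [ha.1]⟩
  have hle : ∀ n : ℕ, μ {x | ∀ i ∈ I, x i = c i} ≤ r ^ n := fun n => by
    obtain ⟨s, hsI, hs⟩ := hI.exists_subset_card_eq n
    calc μ {x | ∀ i ∈ I, x i = c i} ≤ μ {x | ∀ i ∈ s, x i = c i} :=
          measure_mono fun x hx i hi => hx i (hsI hi)
      _ = _ := h s c
      _ ≤ ∏ _i ∈ s, r := Finset.prod_le_prod' fun i _ => by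
          split_ifs
          · exact le_max_left _ _
          · exact le_max_right _ _
      _ = r ^ n := by rw [Finset.prod_const, hs]
  exact le_antisymm
    (ge_of_tendsto' (ENNReal.tendsto_pow_atTop_nhds_zero_of_lt_one hr1) hle) bot_le

/-- Images of Bernoulli measures with distinct parameters under two embeddings are mutually
singular if coinciding images force a fixed difference of the arguments. -/
lemma IsBernoulliMeasure.mutuallySingular_map {Y : Type*} [MeasurableSpace Y]
    [IsProbabilityMeasure μ] [IsProbabilityMeasure ν]
    (hμ : IsBernoulliMeasure a μ) (hν : IsBernoulliMeasure b ν)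
    (ha : a ∈ Set.Ioo (0 : ℝ) 1) (hb : b ∈ Set.Ioo (0 : ℝ) 1) (hab : a ≠ b)
    {F G : (ℕ → Fin 2) → Y} (hF : MeasurableEmbedding F) (hG : MeasurableEmbedding G)
    (ε : ℕ → ℤ) (hε : ∀ x y, F x = G y → ∀ i, ((x i : ℕ) : ℤ) - (y i : ℕ) = ε i) :
    (μ.map F).MutuallySingular (ν.map G) := by
  by_cases hfin : {i | ε i ≠ 0}.Finite
  · refine Measure.MutuallySingular.symm ⟨F '' frequencySet a,
      hF.measurableSet_image.mpr (measurableSet_frequencySet a), ?_, ?_⟩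
    · rw [hG.map_apply]
      refine measure_mono_null ?_ (hν.ae_mem_frequencySet hb)
      rintro y ⟨x, hx, hxy⟩ hy
      refine Set.disjoint_left.mp (disjoint_frequencySet hab)
        (mem_frequencySet_of_finite_ne (hfin.subset fun i hi h0 => hi ?_) hx) hy
      have := hε x y hxy i
      omega
    · rw [hF.map_apply]
      refine measure_mono_null ?_ (hμ.ae_mem_frequencySet ha)
      exact fun x hx hxa => hx ⟨x, hxa, rfl⟩
  · refine ⟨Set.range G, hG.measurableSet_range, ?_, ?_⟩
    · rw [hF.map_apply]
      refine measure_mono_null ?_ (hμ.measure_eq_zero_of_infinite ha hfin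
        fun i => if 0 < ε i then 1 else 0)
      rintro x ⟨y, hy⟩ i (hi : ε i ≠ 0)
      have := hε x y hy.symm i
      split_ifs <;> omega
    · rw [hG.map_apply]
      simp

end BernoulliMeasure

lemma eq_sum_smul_map_of_apply_image_add {μ ν : Measure UnitAddCircle} {w : ℤ → ENNReal}
    {α : ℤ → UnitAddCircle}
    (h : ∀ A, MeasurableSet A → ν A = ∑' k, w k * μ ((fun x => x + α k) '' A)) :
    ν = Measure.sum fun k => w k • μ.map fun x => x + -α k := by
  ext A hA
  rw [h A hA, Measure.sum_apply _ hA]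
  refine tsum_congr fun k => ?_
  rw [Measure.smul_apply, smul_eq_mul, Measure.map_apply (by fun_prop) hA, Set.image_add_right]

/-- If a ≠ b in (0,1), the measures ν_a and ν_b on 𝕋 built from the
Bernoulli(a) and Bernoulli(b) product measures via Φ and the rotation by θ are
mutually singular. -/
theorem stmt19
    (θ : ℝ) (hθirr : Irrational θ) (hθmem : θ ∈ Set.Ioo (0 : ℝ) 1)
    (e : ℝ → ℝ)
    (he : ∀ x : ℝ, e x ∈ Set.Ioc (-(1 / 2) : ℝ) (1 / 2) ∧ ∃ k : ℤ, x - e x = k)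
    (m : ℕ → ℕ) (hmono : StrictMono m) (hpos : ∀ i, 0 < m i)
    (hm0 : |e ((m 0 : ℝ) * θ)| < 1 / 3)
    (hmdec : ∀ i : ℕ, |e ((m (i + 1) : ℝ) * θ)| < |e ((m i : ℝ) * θ)| / 3)
    (Φ : (ℕ → Fin 2) → UnitAddCircle)
    (hΦ : ∀ x : ℕ → Fin 2,
      Φ x = ((∑' i : ℕ, ((x i : ℕ) : ℝ) * e ((m i : ℝ) * θ) : ℝ) : UnitAddCircle))
    (a b : ℝ) (haI : a ∈ Set.Ioo (0 : ℝ) 1) (hbI : b ∈ Set.Ioo (0 : ℝ) 1) (hab : a ≠ b)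
    (ν₀a ν₀b : Measure (ℕ → Fin 2))
    [IsProbabilityMeasure ν₀a] [IsProbabilityMeasure ν₀b]
    (hν₀a : ∀ (s : Finset ℕ) (c : ℕ → Fin 2),
      ν₀a {x | ∀ i ∈ s, x i = c i} =
        ∏ i ∈ s, (if c i = 0 then ENNReal.ofReal a else ENNReal.ofReal (1 - a)))
    (hν₀b : ∀ (s : Finset ℕ) (c : ℕ → Fin 2),
      ν₀b {x | ∀ i ∈ s, x i = c i} =
        ∏ i ∈ s, (if c i = 0 then ENNReal.ofReal b else ENNReal.ofReal (1 - b)))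
    (γ : ℝ) (hγ : γ = Real.sqrt 2 - 1)
    (νa νb : Measure UnitAddCircle)
    (hνa : ∀ A : Set UnitAddCircle, MeasurableSet A →
      νa A = ∑' k : ℤ, ENNReal.ofReal (γ ^ (1 + k.natAbs)) *
        (Measure.map Φ ν₀a) ((fun x => x + (((k : ℝ) * θ : ℝ) : UnitAddCircle)) '' A))
    (hνb : ∀ A : Set UnitAddCircle, MeasurableSet A →
      νb A = ∑' k : ℤ, ENNReal.ofReal (γ ^ (1 + k.natAbs)) *
        (Measure.map Φ ν₀b) ((fun x => x + (((k : ℝ) * θ : ℝ) : UnitAddCircle)) '' A)) :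
    νa.MutuallySingular νb := by
  have hB : IsBernoulliMeasure a ν₀a := hν₀a
  have hB' : IsBernoulliMeasure b ν₀b := hν₀b
  have hdiff := fun {x y x' y'} =>
    sub_eq_sub_of_lacunary_coding (t := fun i => e ((m i : ℝ) * θ)) hm0 hmdec hΦ
      (x := x) (y := y) (x' := x') (y' := y')
  have hcont : Continuous Φ := by
    rw [funext hΦ]
    exact (AddCircle.continuous_mk' 1).comp
      (continuous_lacunary_tsum (t := fun i => e ((m i : ℝ) * θ)) hmdec)
  have hemb : ∀ α : UnitAddCircle, MeasurableEmbedding fun x => Φ x + α := fun α => by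
    refine ((hcont.add continuous_const).isClosedEmbedding fun x y hxy => ?_).measurableEmbedding
    have hΦxy : Φ x = Φ y := add_right_cancel hxy
    funext i
    have := hdiff (x := x) (y := y) (x' := y) (y' := y) (by rw [hΦxy]) i
    omega
  rw [eq_sum_smul_map_of_apply_image_add hνa, eq_sum_smul_map_of_apply_image_add hνb]
  refine Measure.MutuallySingular.sum_left.mpr fun k =>
    Measure.MutuallySingular.sum_right.mpr fun l => ?_
  refine .smul _ (Measure.MutuallySingular.smul _ (.symm ?_)).symm
  rw [Measure.map_map (by fun_prop) hcont.measurable,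
    Measure.map_map (by fun_prop) hcont.measurable]
  set α : UnitAddCircle := -(((k : ℝ) * θ : ℝ) : UnitAddCircle)
  set β : UnitAddCircle := -(((l : ℝ) * θ : ℝ) : UnitAddCircle)
  suffices h : ∃ ε : ℕ → ℤ, ∀ x y, Φ x + α = Φ y + β →
      ∀ i, ((x i : ℕ) : ℤ) - (y i : ℕ) = ε i by
    obtain ⟨ε, hε⟩ := h
    exact hB.mutuallySingular_map hB' haI hbI hab (hemb α) (hemb β) ε hε
  by_cases hex : ∃ x y, Φ x + α = Φ y + β
  · obtain ⟨x₀, y₀, h₀⟩ := hex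
    refine ⟨fun i => ((x₀ i : ℕ) : ℤ) - (y₀ i : ℕ), fun x y hxy => hdiff ?_⟩
    have h1 : ∀ x y, Φ x + α = Φ y + β → Φ x - Φ y = β - α := fun x y hxy => by
      rw [sub_eq_sub_iff_add_eq_add, hxy, add_comm]
    rw [h1 x y hxy, h1 x₀ y₀ h₀]
  · push Not at hex
    exact ⟨0, fun x y hxy => absurd hxy (hex x y)⟩
end
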